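/- arXiv:2310.13493 — 4 statements merged into one kernel-verified Lean document; each statement's English description precedes it below -/
import Mathlib

section
/- Let m and n be integers with m ≥ 3 and n ≥ 3, where n is a multiple of 3. Then the Cartesian product C_m □ C_n can be decomposed into 3 cycles of equal length (necessarily each of length 2mn/3). -/
open SimpleGraph

/-- The edge set `E` is that of a closed cycle visiting `N` distinct vertices. -/
def IsCycleEdges {V : Type*} (E : Set (Sym2 V)) (N : ℕ) : Prop :=
  3 ≤ N ∧ ∃ f : ℕ → V, Set.InjOn f (Set.Iio N) ∧ E = {e | ∃ t < N, e = s(f t, f ((t + 1) % N))}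

/-- The edges joining consecutive entries of a list. -/
def pathEdges {V : Type*} : List V → List (Sym2 V)
  | [] => []
  | [_] => []
  | a :: b :: l => s(a, b) :: pathEdges (b :: l)

namespace IsCycleEdges

variable {V : Type*} {E : Set (Sym2 V)} {N : ℕ}

lemma ne_of_mem (hE : IsCycleEdges E N) {x y : V} (hxy : s(x, y) ∈ E) : x ≠ y := by
  obtain ⟨hN, f, hf, rfl⟩ := hE
  obtain ⟨t, ht, he⟩ := hxy
  have hlt : (t + 1) % N < N := Nat.mod_lt _ (by omega)
  have hne : f t ≠ f ((t + 1) % N) := by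
    intro h
    have := hf ht hlt h
    rcases Nat.lt_or_ge (t + 1) N with h1 | h1
    · rw [Nat.mod_eq_of_lt h1] at this; omega
    · have h2 : t + 1 = N := by omega
      rw [h2, Nat.mod_self] at this
      omega
  rintro rfl
  rcases Sym2.eq_iff.1 he with ⟨h1, h2⟩ | ⟨h1, h2⟩
  · exact hne (h1 ▸ h2)
  · exact hne (h2 ▸ h1)

lemma eq_of_apply_edge_eq {f : ℕ → V} (hN : 3 ≤ N) (hf : Set.InjOn f (Set.Iio N)) {t u : ℕ}
    (ht : t < N) (hu : u < N) (h : s(f t, f ((t + 1) % N)) = s(f u, f ((u + 1) % N))) : t = u := by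
  have h1 : (t + 1) % N < N := Nat.mod_lt _ (by omega)
  have h2 : (u + 1) % N < N := Nat.mod_lt _ (by omega)
  rcases Sym2.eq_iff.1 h with ⟨h3, -⟩ | ⟨h3, h4⟩
  · exact hf ht hu h3
  · have h5 := hf ht h2 h3
    have h6 := hf h1 hu h4
    rcases Nat.lt_or_ge (t + 1) N with h7 | h7 <;> rcases Nat.lt_or_ge (u + 1) N with h8 | h8
    · rw [Nat.mod_eq_of_lt h7] at h6; rw [Nat.mod_eq_of_lt h8] at h5; omega
    · have : u + 1 = N := by omega
      rw [this, Nat.mod_self] at h5; rw [Nat.mod_eq_of_lt h7] at h6; omega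
    · have : t + 1 = N := by omega
      rw [this, Nat.mod_self] at h6; rw [Nat.mod_eq_of_lt h8] at h5; omega
    · omega

lemma exists_rotation (hE : IsCycleEdges E N) {e : Sym2 V} (he : e ∈ E) :
    ∃ f : ℕ → V, Set.InjOn f (Set.Iio N) ∧ E = {e | ∃ t < N, e = s(f t, f ((t + 1) % N))} ∧
      e = s(f (N - 1), f 0) := by
  obtain ⟨hN, f, hf, rfl⟩ := hE
  obtain ⟨t, ht, rfl⟩ := he
  refine ⟨fun u => f ((u + (t + 1)) % N), ?_, ?_, ?_⟩
  · intro u hu v hv huv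
    have h1 := hf (Nat.mod_lt _ (by omega) : (u + (t + 1)) % N < N)
      (Nat.mod_lt _ (by omega) : (v + (t + 1)) % N < N) huv
    have h2 : u ≡ v [MOD N] := Nat.ModEq.add_right_cancel' _ h1
    exact Nat.ModEq.eq_of_lt_of_lt h2 hu hv
  · ext e
    simp only [Set.mem_ofPred_eq]
    constructor
    · rintro ⟨u, hu, rfl⟩
      refine ⟨(u + (N - (t + 1))) % N, Nat.mod_lt _ (by omega), ?_⟩
      have h1 : ((u + (N - (t + 1))) % N + (t + 1)) % N = u := by
        rw [Nat.mod_add_mod, show u + (N - (t + 1)) + (t + 1) = u + N by omega, Nat.add_mod_right,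
          Nat.mod_eq_of_lt hu]
      have h2 : (((u + (N - (t + 1))) % N + 1) % N + (t + 1)) % N = (u + 1) % N := by
        rw [Nat.mod_add_mod, add_assoc, Nat.mod_add_mod,
          show u + (N - (t + 1)) + (1 + (t + 1)) = u + 1 + N by omega, Nat.add_mod_right]
      simp only [h1, h2]
    · rintro ⟨u, hu, rfl⟩
      refine ⟨(u + (t + 1)) % N, Nat.mod_lt _ (by omega), ?_⟩
      have h1 : ((u + 1) % N + (t + 1)) % N = ((u + (t + 1)) % N + 1) % N := by
        rw [Nat.mod_add_mod, Nat.mod_add_mod]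
        congr 1
        omega
      rw [h1]
  · simp only [zero_add]
    congr 3
    rw [show N - 1 + (t + 1) = t + N by omega, Nat.add_mod_right, Nat.mod_eq_of_lt ht]

/-- Subdividing one edge of a cycle by a new vertex gives a cycle. -/
lemma subdivide (hE : IsCycleEdges E N) {x y p : V} (hxy : s(x, y) ∈ E)
    (hp : ∀ e ∈ E, p ∉ e) :
    IsCycleEdges ((E \ {s(x, y)}) ∪ {s(x, p), s(p, y)}) (N + 1) := by
  have hN := hE.1
  obtain ⟨f, hf, hEf, he⟩ := hE.exists_rotation hxy
  have hfp : ∀ t < N, f t ≠ p := by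
    intro t ht h
    refine hp s(f t, f ((t + 1) % N)) (hEf ▸ ⟨t, ht, rfl⟩) (by simp [h])
  refine ⟨by omega, fun u => if u < N then f u else p, ?_, ?_⟩
  · intro u hu v hv huv
    simp only [Set.mem_Iio] at hu hv
    by_cases h1 : u < N <;> by_cases h2 : v < N <;> simp only [h1, h2, if_true, if_false] at huv
    · exact hf h1 h2 huv
    · exact absurd huv (hfp u h1)
    · exact absurd huv.symm (hfp v h2)
    · omega
  · have hpair : ({s(x, p), s(p, y)} : Set (Sym2 V)) = {s(f (N - 1), p), s(p, f 0)} := by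
      rcases Sym2.eq_iff.1 he with ⟨rfl, rfl⟩ | ⟨rfl, rfl⟩
      · rfl
      · rw [Set.pair_comm, Sym2.eq_swap, Sym2.eq_swap (a := f 0)]
    rw [hpair, he]
    ext e
    simp only [Set.mem_union, Set.mem_sdiff, Set.mem_singleton_iff, Set.mem_insert_iff,
      Set.mem_ofPred_eq]
    constructor
    · rintro (⟨h1, h2⟩ | rfl | rfl)
      · rw [hEf] at h1
        obtain ⟨t, ht, rfl⟩ := h1
        have : t + 1 < N := by
          by_contra h3
          have h4 : t + 1 = N := by omega
          apply h2
          rw [h4, Nat.mod_self, show t = N - 1 by omega]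
        refine ⟨t, by omega, ?_⟩
        rw [Nat.mod_eq_of_lt this, Nat.mod_eq_of_lt (by omega)]
        simp [ht, this]
      · refine ⟨N - 1, by omega, ?_⟩
        rw [show N - 1 + 1 = N by omega, Nat.mod_eq_of_lt (by omega)]
        simp [show 0 < N by omega]
      · refine ⟨N, by omega, ?_⟩
        simp [show 0 < N by omega]
    · rintro ⟨t, ht, rfl⟩
      rcases Nat.lt_trichotomy (t + 1) N with h | h | h
      · left
        rw [Nat.mod_eq_of_lt (by omega : t + 1 < N + 1)]
        simp only [h, show t < N by omega, if_true]
        refine ⟨hEf ▸ ⟨t, by omega, by rw [Nat.mod_eq_of_lt h]⟩, ?_⟩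
        intro h1
        have h2 := eq_of_apply_edge_eq (t := t) (u := N - 1) hN hf (by omega) (by omega)
        rw [Nat.mod_eq_of_lt h, show N - 1 + 1 = N by omega, Nat.mod_self] at h2
        have := h2 h1
        omega
      · right; left
        subst h
        simp
      · right; right
        obtain rfl : t = N := by omega
        simp [show 0 < t by omega]

end IsCycleEdges

lemma mem_of_mem_pathEdges {V : Type*} {l : List V} {e : Sym2 V} {p : V} (he : e ∈ pathEdges l)
    (hp : p ∈ e) : p ∈ l := by
  induction l using pathEdges.induct with
  | case1 => simp [pathEdges] at he
  | case2 => simp [pathEdges] at he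
  | case3 a b l ih =>
    rw [pathEdges, List.mem_cons] at he
    rcases he with rfl | he
    · rw [Sym2.mem_iff] at hp
      rcases hp with rfl | rfl <;> simp
    · exact List.mem_cons_of_mem _ (ih he)

lemma exists_mem_of_mem_pathEdges {V : Type*} {x y : V} {ps : List V} (hps : ps ≠ [])
    {e : Sym2 V} (he : e ∈ pathEdges (x :: (ps ++ [y]))) : ∃ p ∈ ps, p ∈ e := by
  induction ps generalizing x with
  | nil => exact absurd rfl hps
  | cons a l ih =>
    rw [List.cons_append, pathEdges, List.mem_cons] at he
    rcases he with rfl | he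
    · exact ⟨a, by simp, by simp⟩
    · by_cases hl : l = []
      · subst hl
        simp only [List.nil_append, pathEdges, List.mem_cons, List.not_mem_nil, or_false] at he
        exact ⟨a, by simp, by simp [he]⟩
      · obtain ⟨p, hp, hpe⟩ := ih hl he
        exact ⟨p, List.mem_cons_of_mem _ hp, hpe⟩

lemma pathEdges_map {V W : Type*} (φ : V → W) (l : List V) :
    pathEdges (l.map φ) = (pathEdges l).map (Sym2.map φ) := by
  induction l using pathEdges.induct with
  | case1 => simp [pathEdges]
  | case2 => simp [pathEdges]
  | case3 a b l ih => simpa [pathEdges] using ih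

namespace IsCycleEdges

variable {V : Type*} {E : Set (Sym2 V)} {N : ℕ}

/-- Replacing one edge of a cycle by a path through new vertices gives a cycle. -/
lemma insertPath (hE : IsCycleEdges E N) {x y : V} (hxy : s(x, y) ∈ E) {ps : List V}
    (hnd : ps.Nodup) (hps : ∀ p ∈ ps, ∀ e ∈ E, p ∉ e) :
    IsCycleEdges ((E \ {s(x, y)}) ∪ {e | e ∈ pathEdges (x :: (ps ++ [y]))}) (N + ps.length) := by
  induction ps generalizing x E N with
  | nil =>
    have : E \ {s(x, y)} ∪ {e | e ∈ pathEdges (x :: ([] ++ [y]))} = E := by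
      simp [pathEdges, hxy]
    rw [this]
    simpa using hE
  | cons p ps ih =>
    have hp := hps p (by simp)
    have hxyne := hE.ne_of_mem hxy
    have hxp : x ≠ p := by
      rintro rfl
      exact hp _ hxy (by simp)
    have hyp : y ≠ p := by
      rintro rfl
      exact hp _ hxy (by simp)
    rw [List.nodup_cons] at hnd
    have h1 := ih (hE.subdivide hxy hp) (x := p) (by simp) hnd.2 (by
      rintro p' hp' e (he | rfl | rfl)
      · exact hps p' (List.mem_cons_of_mem _ hp') e he.1
      · have hne : p' ≠ p := by rintro rfl; exact hnd.1 hp'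
        have := hps p' (List.mem_cons_of_mem _ hp') _ hxy
        simp only [Sym2.mem_iff, not_or] at this ⊢
        exact ⟨this.1, hne⟩
      · have hne : p' ≠ p := by rintro rfl; exact hnd.1 hp'
        have := hps p' (List.mem_cons_of_mem _ hp') _ hxy
        simp only [Sym2.mem_iff, not_or] at this ⊢
        exact ⟨hne, this.2⟩)
    have h2 : N + (p :: ps).length = N + 1 + ps.length := by simp; omega
    rw [h2]
    convert h1 using 1
    ext e
    have h3 : e = s(p, y) → e ∉ E := by
      rintro rfl h
      exact hp _ h (by simp)
    have h4 : s(x, p) ≠ s(p, y) := by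
      intro h
      rcases Sym2.eq_iff.1 h with ⟨h, -⟩ | ⟨h, -⟩
      · exact hxp h
      · exact hxyne h
    simp only [List.cons_append, pathEdges, Set.mem_union, Set.mem_sdiff, Set.mem_singleton_iff,
      Set.mem_insert_iff, Set.mem_ofPred_eq, List.mem_cons]
    by_cases h5 : e = s(p, y)
    · have := h3 h5
      have : e ≠ s(x, p) := by rw [h5]; exact h4.symm
      simp_all
    · tauto

/-- Replacing several edges of a cycle by paths through new vertices gives a cycle. -/
lemma insertPaths (hE : IsCycleEdges E N) (I : List (V × List V × V))
    (hI : ∀ i ∈ I, s(i.1, i.2.2) ∈ E) (hne : ∀ i ∈ I, i.2.1 ≠ [])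
    (hedge : (I.map fun i => s(i.1, i.2.2)).Nodup)
    (hnd : (I.flatMap fun i => i.2.1).Nodup)
    (hnew : ∀ p ∈ I.flatMap fun i => i.2.1, ∀ e ∈ E, p ∉ e) :
    IsCycleEdges ((E \ {e | ∃ i ∈ I, e = s(i.1, i.2.2)}) ∪
      {e | ∃ i ∈ I, e ∈ pathEdges (i.1 :: (i.2.1 ++ [i.2.2]))})
      (N + (I.flatMap fun i => i.2.1).length) := by
  induction I generalizing E N with
  | nil => simpa using hE
  | cons i I ih =>
    obtain ⟨x, ps, y⟩ := i
    simp only [List.map_cons, List.nodup_cons, List.mem_map, not_exists, not_and] at hedge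
    simp only [List.flatMap_cons, List.nodup_append] at hnd
    simp only [List.forall_mem_cons] at hI hne
    simp only [List.flatMap_cons, List.mem_append] at hnew
    have h1 := hE.insertPath hI.1 hnd.1 fun p hp => hnew p (Or.inl hp)
    have hpath : ∀ e ∈ pathEdges (x :: (ps ++ [y])), e ∉ E := by
      intro e he heE
      obtain ⟨p, hp, hpe⟩ := exists_mem_of_mem_pathEdges hne.1 he
      exact hnew p (Or.inl hp) e heE hpe
    have h2 := ih h1 (fun i hi => Or.inl ⟨hI.2 i hi, hedge.1 i hi⟩) hne.2 hedge.2 hnd.2.1 (by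
      rintro p hp e (he | he) hpe
      · exact hnew p (Or.inr hp) e he.1 hpe
      · have := mem_of_mem_pathEdges he hpe
        simp only [List.mem_cons, List.mem_append, List.not_mem_nil, or_false] at this
        rcases this with rfl | h | rfl
        · exact hnew _ (Or.inr hp) _ hI.1 (by simp)
        · exact hnd.2.2 p h p hp rfl
        · exact hnew _ (Or.inr hp) _ hI.1 (by simp))
    have h3 : N + (List.flatMap (fun i => i.2.1) ((x, ps, y) :: I)).length
        = N + ps.length + (I.flatMap fun i => i.2.1).length := by
      simp; omega
    rw [h3]
    convert h2 using 1
    ext e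
    have h4 := hpath e
    have h5 : (∃ i ∈ I, e = s(i.1, i.2.2)) → e ∈ E := by
      rintro ⟨i, hi, rfl⟩
      exact hI.2 i hi
    simp only [Set.mem_union, Set.mem_sdiff, Set.mem_singleton_iff, Set.mem_ofPred_eq,
      List.exists_mem_cons_iff]
    have key : ∀ A B C D F : Prop, (B → ¬A) → (D → A) →
        ((A ∧ ¬(C ∨ D) ∨ B ∨ F) ↔ ((A ∧ ¬C ∨ B) ∧ ¬D ∨ F)) := by tauto
    exact key _ _ _ _ _ h4 h5

lemma image {W : Type*} (hE : IsCycleEdges E N) (φ : V → W)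
    (hφ : ∀ e ∈ E, ∀ e' ∈ E, ∀ x ∈ e, ∀ y ∈ e', φ x = φ y → x = y) :
    IsCycleEdges (Sym2.map φ '' E) N := by
  obtain ⟨hN, f, hf, rfl⟩ := hE
  refine ⟨hN, φ ∘ f, ?_, ?_⟩
  · intro t ht u hu htu
    exact hf ht hu (hφ _ ⟨t, ht, rfl⟩ _ ⟨u, hu, rfl⟩ _ (by simp) _ (by simp) htu)
  · ext e
    simp only [Set.mem_image, Set.mem_ofPred_eq]
    constructor
    · rintro ⟨_, ⟨t, ht, rfl⟩, rfl⟩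
      exact ⟨t, ht, rfl⟩
    · rintro ⟨t, ht, rfl⟩
      exact ⟨_, ⟨t, ht, rfl⟩, rfl⟩

end IsCycleEdges

/-- Successor of the column labelled `j` in the cyclic order on `n` columns in which the labels
congruent to a given residue modulo `q` are consecutive. -/
def columnSucc (q n j : ℕ) : ℕ := if j + q < n then j + q else (j + 1) % q

/-- The edges of colour `c` of the torus with `m` rows and `n` columns: `h i j` is the colour
(modulo 3) of the edge leaving `(i, j)` within its row, `v i j` that of the edge leaving it within
its column. -/
def colourClass (q m n : ℕ) (h v : ℕ → ℕ → ℕ) (c : ℕ) : Set (Sym2 (ℕ × ℕ)) :=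
  {e | (∃ i < m, ∃ j < n, h i j % 3 = c ∧ e = s((i, j), (i, columnSucc q n j))) ∨
    ∃ i < m, ∃ j < n, v i j % 3 = c ∧ e = s((i, j), ((i + 1) % m, j))}

/-- The edges of colour `c` within rows from column `a` on and within columns from column `b` on. -/
def edgesFrom (q m n : ℕ) (h v : ℕ → ℕ → ℕ) (c a b : ℕ) : List (Sym2 (ℕ × ℕ)) :=
  ((List.range m ×ˢ List.range n).filter fun x => a ≤ x.2 ∧ h x.1 x.2 % 3 = c).map
      (fun x => s(x, (x.1, columnSucc q n x.2))) ++
    ((List.range m ×ˢ List.range n).filter fun x => b ≤ x.2 ∧ v x.1 x.2 % 3 = c).map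
      fun x => s(x, ((x.1 + 1) % m, x.2))

/-- The edges of colour `c` joining the last `q` columns to the first `q` columns. -/
def seamEdges (q m n : ℕ) (h : ℕ → ℕ → ℕ) (c : ℕ) : List (Sym2 (ℕ × ℕ)) :=
  ((List.range m ×ˢ List.range q).filter fun x => h x.1 (n - q + x.2) % 3 = c).map
    fun x => s((x.1, n - q + x.2), (x.1, (x.2 + 1) % q))

lemma mem_edgesFrom {q m n : ℕ} {h v : ℕ → ℕ → ℕ} {c a b : ℕ} {e : Sym2 (ℕ × ℕ)} :
    e ∈ edgesFrom q m n h v c a b ↔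
      (∃ i < m, ∃ j < n, a ≤ j ∧ h i j % 3 = c ∧ e = s((i, j), (i, columnSucc q n j))) ∨
        ∃ i < m, ∃ j < n, b ≤ j ∧ v i j % 3 = c ∧ e = s((i, j), ((i + 1) % m, j)) := by
  simp only [edgesFrom, List.mem_append, List.mem_map, List.mem_filter, decide_eq_true_eq,
    Prod.exists, List.mem_product, List.mem_range]
  refine or_congr ?_ ?_
  · constructor
    · rintro ⟨i, j, ⟨⟨h1, h2⟩, h3, h4⟩, rfl⟩
      exact ⟨i, h1, j, h2, h3, h4, rfl⟩
    · rintro ⟨i, h1, j, h2, h3, h4, rfl⟩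
      exact ⟨i, j, ⟨⟨h1, h2⟩, h3, h4⟩, rfl⟩
  · constructor
    · rintro ⟨i, j, ⟨⟨h1, h2⟩, h3, h4⟩, rfl⟩
      exact ⟨i, h1, j, h2, h3, h4, rfl⟩
    · rintro ⟨i, h1, j, h2, h3, h4, rfl⟩
      exact ⟨i, j, ⟨⟨h1, h2⟩, h3, h4⟩, rfl⟩

lemma mem_seamEdges {q m n : ℕ} {h : ℕ → ℕ → ℕ} {c : ℕ} {e : Sym2 (ℕ × ℕ)} :
    e ∈ seamEdges q m n h c ↔ ∃ i < m, ∃ r < q, h i (n - q + r) % 3 = c ∧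
      e = s((i, n - q + r), (i, (r + 1) % q)) := by
  simp only [seamEdges, List.mem_map, List.mem_filter, decide_eq_true_eq,
    Prod.exists, List.mem_product, List.mem_range]
  constructor
  · rintro ⟨i, j, ⟨⟨h1, h2⟩, h3⟩, rfl⟩
    exact ⟨i, h1, j, h2, h3, rfl⟩
  · rintro ⟨i, h1, j, h2, h3, rfl⟩
    exact ⟨i, j, ⟨⟨h1, h2⟩, h3⟩, rfl⟩

lemma coe_edgesFrom_zero {q m n : ℕ} {h v : ℕ → ℕ → ℕ} {c : ℕ} :
    {e | e ∈ edgesFrom q m n h v c 0 0} = colourClass q m n h v c := by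
  ext e
  simp [mem_edgesFrom, colourClass]

/-- Renumbering of the columns that moves all but the first `q` of them by `d`. -/
def shiftColumn (q d : ℕ) (x : ℕ × ℕ) : ℕ × ℕ := (x.1, if x.2 < q then x.2 else x.2 + d)

lemma shiftColumn_injective (q d : ℕ) : Function.Injective (shiftColumn q d) := by
  rintro ⟨i, j⟩ ⟨i', j'⟩ h
  simp only [shiftColumn, Prod.mk.injEq] at h ⊢
  refine ⟨h.1, ?_⟩
  have := h.2
  split_ifs at this <;> omega

lemma mem_edgesFrom_shift {q m n₀ p d : ℕ} {h v : ℕ → ℕ → ℕ} {c : ℕ} (hqn : 2 * q ≤ n₀)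
    (hq : 0 < q) (hd : q ∣ d)
    (hh : ∀ i < m, ∀ j, n₀ - q ≤ j → h i (j + d) % 3 = h i j % 3)
    (hv : ∀ i < m, ∀ j, n₀ ≤ j → v i (j + d) % 3 = v i j % 3) {e : Sym2 (ℕ × ℕ)} :
    e ∈ edgesFrom q m (n₀ + d + p) h v c (n₀ + d - q) (n₀ + d) ↔
      ∃ e₀ ∈ edgesFrom q m (n₀ + p) h v c (n₀ - q) n₀, e = Sym2.map (shiftColumn q d) e₀ := by
  have key : ∀ j, n₀ - q ≤ j → j < n₀ + p → ∀ i, shiftColumn q d (i, columnSucc q (n₀ + p) j) =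
      (i, columnSucc q (n₀ + d + p) (j + d)) := by
    intro j h1 h2 i
    have h3 : (j + 1) % q < q := Nat.mod_lt _ hq
    obtain ⟨k, rfl⟩ := hd
    have h4 : (j + q * k + 1) % q = (j + 1) % q := by
      rw [show j + q * k + 1 = j + 1 + q * k by ring, Nat.add_mul_mod_self_left]
    refine Prod.ext rfl ?_
    simp only [shiftColumn, columnSucc, h4]
    generalize q * k = d at *
    by_cases h5 : j + q < n₀ + p
    · simp only [if_pos h5, if_neg (show ¬ j + q < q by omega),
        if_pos (show j + d + q < n₀ + d + p by omega)]
      omega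
    · simp only [if_neg h5, if_pos h3, if_neg (show ¬ j + d + q < n₀ + d + p by omega)]
  simp only [mem_edgesFrom]
  constructor
  · rintro (⟨i, hi, j, hj, h1, h2, rfl⟩ | ⟨i, hi, j, hj, h1, h2, rfl⟩)
    · obtain ⟨j, rfl⟩ : ∃ k, j = k + d := ⟨j - d, by omega⟩
      refine ⟨_, Or.inl ⟨i, hi, j, by omega, by omega, ?_, rfl⟩, ?_⟩
      · rw [← hh i hi j (by omega)]; exact h2
      · rw [Sym2.map_mk, key j (by omega) (by omega)]
        simp only [shiftColumn, if_neg (show ¬ j < q by omega)]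
    · obtain ⟨j, rfl⟩ : ∃ k, j = k + d := ⟨j - d, by omega⟩
      refine ⟨_, Or.inr ⟨i, hi, j, by omega, by omega, ?_, rfl⟩, ?_⟩
      · rw [← hv i hi j (by omega)]; exact h2
      · simp only [Sym2.map_mk, shiftColumn, if_neg (show ¬ j < q by omega)]
  · rintro ⟨_, ⟨i, hi, j, hj, h1, h2, rfl⟩ | ⟨i, hi, j, hj, h1, h2, rfl⟩, rfl⟩
    · refine Or.inl ⟨i, hi, j + d, by omega, by omega, ?_, ?_⟩
      · rw [hh i hi j (by omega)]; exact h2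
      · rw [Sym2.map_mk, key j (by omega) (by omega)]
        simp only [shiftColumn, if_neg (show ¬ j < q by omega)]
    · refine Or.inr ⟨i, hi, j + d, by omega, by omega, ?_, ?_⟩
      · rw [hv i hi j (by omega)]; exact h2
      · simp only [Sym2.map_mk, shiftColumn, if_neg (show ¬ j < q by omega)]

lemma mem_seamEdges_shift {q m n₀ d : ℕ} {h : ℕ → ℕ → ℕ} {c : ℕ} (hqn : 2 * q ≤ n₀) (hq : 0 < q)
    (hh : ∀ i < m, ∀ j, n₀ - q ≤ j → h i (j + d) % 3 = h i j % 3) {e : Sym2 (ℕ × ℕ)} :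
    e ∈ seamEdges q m (n₀ + d) h c ↔
      ∃ e₀ ∈ seamEdges q m n₀ h c, e = Sym2.map (shiftColumn q d) e₀ := by
  simp only [mem_seamEdges]
  have key : ∀ i r, Sym2.map (shiftColumn q d) s((i, n₀ - q + r), (i, (r + 1) % q)) =
      s((i, n₀ + d - q + r), (i, (r + 1) % q)) := by
    intro i r
    have h3 : (r + 1) % q < q := Nat.mod_lt _ hq
    simp only [Sym2.map_mk, shiftColumn, if_neg (show ¬ n₀ - q + r < q by omega), if_pos h3]
    rw [show n₀ - q + r + d = n₀ + d - q + r by omega]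
  have hcol : ∀ i < m, ∀ r, h i (n₀ + d - q + r) % 3 = h i (n₀ - q + r) % 3 := by
    intro i hi r
    rw [← hh i hi (n₀ - q + r) (by omega), show n₀ - q + r + d = n₀ + d - q + r by omega]
  constructor
  · rintro ⟨i, hi, r, hr, h1, rfl⟩
    exact ⟨_, ⟨i, hi, r, hr, hcol i hi r ▸ h1, rfl⟩, (key i r).symm⟩
  · rintro ⟨_, ⟨i, hi, r, hr, h1, rfl⟩, rfl⟩
    exact ⟨i, hi, r, hr, (hcol i hi r).symm ▸ h1, key i r⟩

/-- Adding columns removes the seam edges and adds the edges of the new columns. -/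
lemma colourClass_add_columns {q m n p : ℕ} {h v : ℕ → ℕ → ℕ} {c : ℕ} (hqn : 3 * q ≤ n)
    (hq : 0 < q) (hdvd : q ∣ n) :
    colourClass q m (n + p) h v c =
      (colourClass q m n h v c \ {e | e ∈ seamEdges q m n h c}) ∪
        {e | e ∈ edgesFrom q m (n + p) h v c (n - q) n} := by
  have hmod : ∀ r, (n - q + r + 1) % q = (r + 1) % q := by
    intro r
    obtain ⟨k, hk⟩ := Nat.dvd_sub hdvd (dvd_refl q)
    rw [hk, show q * k + r + 1 = r + 1 + q * k by ring, Nat.add_mul_mod_self_left]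
  ext e
  simp only [Set.mem_union, Set.mem_sdiff, Set.mem_ofPred_eq, mem_edgesFrom, mem_seamEdges,
    colourClass]
  constructor
  · rintro (⟨i, hi, j, hj, h1, rfl⟩ | ⟨i, hi, j, hj, h1, rfl⟩)
    · by_cases h2 : n - q ≤ j
      · exact Or.inr (Or.inl ⟨i, hi, j, hj, h2, h1, rfl⟩)
      · refine Or.inl ⟨Or.inl ⟨i, hi, j, by omega, h1, ?_⟩, ?_⟩
        · simp only [columnSucc]
          rw [if_pos (by omega), if_pos (by omega)]
        · rintro ⟨i', hi', r, hr, -, h3⟩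
          have h4 : (r + 1) % q < q := Nat.mod_lt _ hq
          simp only [columnSucc] at h3
          rw [if_pos (by omega)] at h3
          simp only [Sym2.eq_iff, Prod.mk.injEq] at h3
          omega
    · by_cases h2 : n ≤ j
      · exact Or.inr (Or.inr ⟨i, hi, j, hj, h2, h1, rfl⟩)
      · refine Or.inl ⟨Or.inr ⟨i, hi, j, by omega, h1, rfl⟩, ?_⟩
        rintro ⟨i', hi', r, hr, -, h3⟩
        have h4 : (r + 1) % q < q := Nat.mod_lt _ hq
        simp only [Sym2.eq_iff, Prod.mk.injEq] at h3
        omega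
  · rintro (⟨⟨i, hi, j, hj, h1, rfl⟩ | ⟨i, hi, j, hj, h1, rfl⟩, h2⟩ |
      ⟨i, hi, j, hj, -, h1, rfl⟩ | ⟨i, hi, j, hj, -, h1, rfl⟩)
    · refine Or.inl ⟨i, hi, j, by omega, h1, ?_⟩
      by_cases h3 : j + q < n
      · simp only [columnSucc]
        rw [if_pos h3, if_pos (by omega)]
      · obtain ⟨r, rfl⟩ : ∃ r, j = n - q + r := ⟨j - (n - q), by omega⟩
        refine absurd ⟨i, hi, r, by omega, h1, ?_⟩ h2
        simp only [columnSucc]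
        rw [if_neg h3, hmod]
    · exact Or.inr ⟨i, hi, j, by omega, h1, rfl⟩
    · exact Or.inl ⟨i, hi, j, hj, h1, rfl⟩
    · exact Or.inr ⟨i, hi, j, hj, h1, rfl⟩

/-- The paths `I` reroute the seam edges of colour `c` of the torus with `n` columns through all
edges of colour `c` of `p` additional columns. -/
structure IsRerouting (q m n p : ℕ) (h v : ℕ → ℕ → ℕ) (c : ℕ)
    (I : List ((ℕ × ℕ) × List (ℕ × ℕ) × (ℕ × ℕ))) : Prop where
  seam_subset : ∀ e ∈ seamEdges q m n h c, e ∈ I.map fun i => s(i.1, i.2.2)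
  subset_seam : ∀ e ∈ I.map fun i => s(i.1, i.2.2), e ∈ seamEdges q m n h c
  edges_subset : ∀ e ∈ edgesFrom q m (n + p) h v c (n - q) n,
    e ∈ I.flatMap fun i => pathEdges (i.1 :: (i.2.1 ++ [i.2.2]))
  subset_edges : ∀ e ∈ I.flatMap fun i => pathEdges (i.1 :: (i.2.1 ++ [i.2.2])),
    e ∈ edgesFrom q m (n + p) h v c (n - q) n
  ne_nil : ∀ i ∈ I, i.2.1 ≠ []
  nodup_seam : (I.map fun i => s(i.1, i.2.2)).Nodup
  nodup : (I.flatMap fun i => i.2.1).Nodup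
  le_column : ∀ x ∈ I.flatMap fun i => i.2.1, n ≤ x.2

lemma columnSucc_lt {q n j : ℕ} (hq : 0 < q) (hqn : q ≤ n) : columnSucc q n j < n := by
  have : (j + 1) % q < q := Nat.mod_lt _ hq
  rw [columnSucc]
  split_ifs <;> omega

lemma lt_of_mem_colourClass {q m n : ℕ} {h v : ℕ → ℕ → ℕ} {c : ℕ} (hq : 0 < q) (hqn : q ≤ n)
    {e : Sym2 (ℕ × ℕ)} (he : e ∈ colourClass q m n h v c) {x : ℕ × ℕ} (hx : x ∈ e) :
    x.1 < m ∧ x.2 < n := by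
  rcases he with ⟨i, hi, j, hj, -, rfl⟩ | ⟨i, hi, j, hj, -, rfl⟩
  · have := columnSucc_lt (j := j) hq hqn
    rcases Sym2.mem_iff.1 hx with rfl | rfl <;> simp_all
  · have := Nat.mod_lt (i + 1) (show 0 < m by omega)
    rcases Sym2.mem_iff.1 hx with rfl | rfl <;> simp_all

lemma IsRerouting.isCycleEdges {q m n₀ p d N : ℕ} {h v : ℕ → ℕ → ℕ} {c : ℕ}
    {I : List ((ℕ × ℕ) × List (ℕ × ℕ) × (ℕ × ℕ))} (hI : IsRerouting q m n₀ p h v c I)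
    (hqn : 3 * q ≤ n₀) (hq : 0 < q) (hdvd : q ∣ n₀) (hd : q ∣ d)
    (hh : ∀ i < m, ∀ j, n₀ - q ≤ j → h i (j + d) % 3 = h i j % 3)
    (hv : ∀ i < m, ∀ j, n₀ ≤ j → v i (j + d) % 3 = v i j % 3)
    (hE : IsCycleEdges (colourClass q m (n₀ + d) h v c) N) :
    IsCycleEdges (colourClass q m (n₀ + d + p) h v c) (N + (I.flatMap fun i => i.2.1).length) := by
  set φ := shiftColumn q d with hφ
  have hinj : Function.Injective φ := shiftColumn_injective q d
  let J : List ((ℕ × ℕ) × List (ℕ × ℕ) × (ℕ × ℕ)) :=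
    I.map fun i => (φ i.1, i.2.1.map φ, φ i.2.2)
  have hflat : (J.flatMap fun i => i.2.1) = (I.flatMap fun i => i.2.1).map φ := by
    simp [J, List.flatMap_map, List.map_flatMap]
  have hmap : (J.map fun i => s(i.1, i.2.2)) =
      (I.map fun i => s(i.1, i.2.2)).map (Sym2.map φ) := by
    simp [J, Function.comp_def]
  have hseam : ∀ e, e ∈ seamEdges q m (n₀ + d) h c ↔ ∃ i ∈ J, e = s(i.1, i.2.2) := by
    intro e
    have h1 : (∃ i ∈ J, e = s(i.1, i.2.2)) ↔ e ∈ J.map fun i => s(i.1, i.2.2) := by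
      simp only [List.mem_map, eq_comm]
    rw [h1, hmap, mem_seamEdges_shift (by omega) hq hh]
    simp only [List.mem_map (f := Sym2.map φ), eq_comm (a := e)]
    exact exists_congr fun e₀ => and_congr_left' ⟨hI.seam_subset e₀, hI.subset_seam e₀⟩
  have hedges : ∀ e, e ∈ edgesFrom q m (n₀ + d + p) h v c (n₀ + d - q) (n₀ + d) ↔
      ∃ i ∈ J, e ∈ pathEdges (i.1 :: (i.2.1 ++ [i.2.2])) := by
    intro e
    have h1 : (∃ i ∈ J, e ∈ pathEdges (i.1 :: (i.2.1 ++ [i.2.2]))) ↔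
        e ∈ (I.flatMap fun i => pathEdges (i.1 :: (i.2.1 ++ [i.2.2]))).map (Sym2.map φ) := by
      rw [← List.mem_flatMap, List.flatMap_map, List.map_flatMap]
      simp only [← pathEdges_map, List.map_cons, List.map_append, List.map_nil]
    rw [h1, mem_edgesFrom_shift (by omega) hq hd hh hv]
    simp only [List.mem_map, eq_comm (a := e)]
    exact exists_congr fun e₀ => and_congr_left' ⟨hI.edges_subset e₀, hI.subset_edges e₀⟩
  have h1 := hE.insertPaths J (fun i hi => ?_) ?_ ?_ ?_ ?_
  · rw [hflat, List.length_map] at h1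
    rw [colourClass_add_columns (by omega) hq (dvd_add hdvd hd)]
    simpa only [hseam, hedges] using h1
  · obtain ⟨a, ha, r, hr, hc, he⟩ := mem_seamEdges.1 ((hseam s(i.1, i.2.2)).2 ⟨i, hi, rfl⟩)
    rw [he]
    refine Or.inl ⟨a, ha, _, by omega, hc, ?_⟩
    rw [columnSucc, if_neg (by omega)]
    obtain ⟨k, hk⟩ := Nat.dvd_sub (dvd_add hdvd hd) (dvd_refl q)
    rw [hk, show q * k + r + 1 = r + 1 + q * k by ring, Nat.add_mul_mod_self_left]
  · simp only [J, List.forall_mem_map, ne_eq, List.map_eq_nil_iff]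
    exact hI.ne_nil
  · rw [hmap]
    exact hI.nodup_seam.map (Sym2.map.injective hinj)
  · rw [hflat]
    exact hI.nodup.map hinj
  · rw [hflat]
    intro x hx e he hxe
    obtain ⟨y, hy, rfl⟩ := List.mem_map.1 hx
    have h2 := hI.le_column y hy
    have h3 := (lt_of_mem_colourClass hq (by omega) he hxe).2
    simp only [hφ, shiftColumn] at h3
    rw [if_neg (by omega)] at h3
    omega

lemma columnSucc_one {n j : ℕ} (hj : j < n) : columnSucc 1 n j = (j + 1) % n := by
  rw [columnSucc]
  split_ifs with h
  · rw [Nat.mod_eq_of_lt h]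
  · rw [show j + 1 = n by omega, Nat.mod_one, Nat.mod_self]

lemma eq_of_mem_colourClass {m n : ℕ} (hm : 3 ≤ m) (hn : 3 ≤ n) {h v : ℕ → ℕ → ℕ} {c c' : ℕ}
    {e : Sym2 (ℕ × ℕ)} (he : e ∈ colourClass 1 m n h v c) (he' : e ∈ colourClass 1 m n h v c') :
    c = c' := by
  have hmod : ∀ N ≥ 3, ∀ i < N, (i + 1) % N = if i + 1 < N then i + 1 else 0 := by
    intro N hN i hi
    split_ifs with h
    · exact Nat.mod_eq_of_lt h
    · rw [show i + 1 = N by omega, Nat.mod_self]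
  rcases he with ⟨i, hi, j, hj, h1, rfl⟩ | ⟨i, hi, j, hj, h1, rfl⟩ <;>
  rcases he' with ⟨i', hi', j', hj', h2, h3⟩ | ⟨i', hi', j', hj', h2, h3⟩
  · rw [columnSucc_one hj, columnSucc_one hj', hmod n hn j hj, hmod n hn j' hj'] at h3
    simp only [Sym2.eq_iff, Prod.mk.injEq] at h3
    obtain ⟨rfl, rfl⟩ : i = i' ∧ j = j' := by split_ifs at h3 <;> omega
    exact h1.symm.trans h2
  · rw [columnSucc_one hj, hmod n hn j hj, hmod m hm i' hi'] at h3
    simp only [Sym2.eq_iff, Prod.mk.injEq] at h3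
    split_ifs at h3 <;> omega
  · rw [columnSucc_one hj', hmod n hn j' hj', hmod m hm i hi] at h3
    simp only [Sym2.eq_iff, Prod.mk.injEq] at h3
    split_ifs at h3 <;> omega
  · rw [hmod m hm i hi, hmod m hm i' hi'] at h3
    simp only [Sym2.eq_iff, Prod.mk.injEq] at h3
    obtain ⟨rfl, rfl⟩ : i = i' ∧ j = j' := by split_ifs at h3 <;> omega
    exact h1.symm.trans h2

lemma cycleGraph_adj_iff_val {n : ℕ} (hn : 3 ≤ n) (u v : Fin n) :
    (cycleGraph n).Adj u v ↔ v.val = (u.val + 1) % n ∨ u.val = (v.val + 1) % n := by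
  have hu := u.2
  have hv := v.2
  have hmod : ∀ i < n, (i + 1) % n = if i + 1 < n then i + 1 else 0 := by
    intro i hi
    split_ifs with h
    · exact Nat.mod_eq_of_lt h
    · rw [show i + 1 = n by omega, Nat.mod_self]
  rw [cycleGraph_adj', hmod _ hu, hmod _ hv, Fin.sub_def, Fin.sub_def]
  simp only
  have hsub : ∀ a b : ℕ, a < n → b < n → (n - b + a) % n = if b ≤ a then a - b else n - b + a := by
    intro a b ha hb
    split_ifs with h
    · rw [show n - b + a = a - b + n by omega, Nat.add_mod_right, Nat.mod_eq_of_lt (by omega)]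
    · exact Nat.mod_eq_of_lt (by omega)
  rw [hsub _ _ hu hv, hsub _ _ hv hu]
  split_ifs <;> omega

lemma IsCycleEdges.exists_subgraph {V : Type*} {G : SimpleGraph V} {E : Set (Sym2 V)} {N : ℕ}
    (hE : IsCycleEdges E N) (hEG : E ⊆ G.edgeSet) :
    ∃ D : G.Subgraph, D.edgeSet = E ∧ Nonempty (D.coe ≃g cycleGraph N) := by
  obtain ⟨hN, f, hf, rfl⟩ := hE
  let D : G.Subgraph :=
    { verts := f '' Set.Iio N
      Adj := fun x y => ∃ t < N, s(x, y) = s(f t, f ((t + 1) % N))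
      adj_sub := fun {x y} h => hEG h
      edge_vert := by
        rintro x y ⟨t, ht, h⟩
        have hlt : (t + 1) % N < N := Nat.mod_lt _ (by omega)
        rcases Sym2.eq_iff.1 h with ⟨rfl, -⟩ | ⟨rfl, -⟩
        · exact ⟨t, ht, rfl⟩
        · exact ⟨_, hlt, rfl⟩
      symm := ⟨by
        rintro x y ⟨t, ht, h⟩
        exact ⟨t, ht, Sym2.eq_swap.trans h⟩⟩ }
  refine ⟨D, ?_, ⟨RelIso.symm
    { toEquiv := Equiv.ofBijective (fun t : Fin N => (⟨f t, t, t.2, rfl⟩ : D.verts)) ⟨?_, ?_⟩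
      map_rel_iff' := ?_ }⟩⟩
  · ext e
    induction e with | h x y => rfl
  · intro t u h
    exact Fin.ext (hf t.2 u.2 (congrArg Subtype.val h))
  · rintro ⟨_, t, ht, rfl⟩
    exact ⟨⟨t, ht⟩, rfl⟩
  · intro t u
    rw [cycleGraph_adj_iff_val hN]
    change (∃ w < N, s(f t, f u) = s(f w, f ((w + 1) % N))) ↔ _
    constructor
    · rintro ⟨w, hw, h⟩
      have hlt : (w + 1) % N < N := Nat.mod_lt _ (by omega)
      rcases Sym2.eq_iff.1 h with ⟨h1, h2⟩ | ⟨h1, h2⟩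
      · rw [hf t.2 hw h1, hf u.2 hlt h2]
        exact Or.inl rfl
      · rw [hf u.2 hw h2, hf t.2 hlt h1]
        exact Or.inr rfl
    · rintro (h | h)
      · exact ⟨t, t.2, by rw [h]⟩
      · exact ⟨u, u.2, by rw [h, Sym2.eq_swap]⟩

/-- A colouring of the edges of the torus whose colour classes are cycles gives a decomposition
into cycles. -/
lemma exists_decomposition_of_isCycleEdges {m n N : ℕ} (hm : 3 ≤ m) (hn : 3 ≤ n)
    {h v : ℕ → ℕ → ℕ} (H : ∀ c < 3, IsCycleEdges (colourClass 1 m n h v c) N) :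
    ∃ D : Fin 3 → (cycleGraph m □ cycleGraph n).Subgraph,
      (∀ i, Nonempty ((D i).coe ≃g cycleGraph N)) ∧
      ∀ e ∈ (cycleGraph m □ cycleGraph n).edgeSet, ∃! i, e ∈ (D i).edgeSet := by
  let ψ : ℕ × ℕ → Fin m × Fin n := fun x =>
    (⟨x.1 % m, Nat.mod_lt _ (by omega)⟩, ⟨x.2 % n, Nat.mod_lt _ (by omega)⟩)
  let ι : Fin m × Fin n → ℕ × ℕ := fun x => (x.1, x.2)
  have hψι : ∀ x, ψ (ι x) = x := fun x =>
    Prod.ext (Fin.ext (Nat.mod_eq_of_lt x.1.2)) (Fin.ext (Nat.mod_eq_of_lt x.2.2))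
  have hιψ : ∀ c, ∀ e ∈ colourClass 1 m n h v c, ∀ x ∈ e, ι (ψ x) = x := by
    intro c e he x hx
    have hlt := lt_of_mem_colourClass one_pos (by omega) he hx
    exact Prod.ext (Nat.mod_eq_of_lt hlt.1) (Nat.mod_eq_of_lt hlt.2)
  have hιψe : ∀ c, ∀ e ∈ colourClass 1 m n h v c, Sym2.map ι (Sym2.map ψ e) = e := by
    intro c e he
    have hx := hιψ c e he
    induction e with | h x y => simp only [Sym2.map_mk, hx x (by simp), hx y (by simp)]
  have hcycle : ∀ c : Fin 3, IsCycleEdges (Sym2.map ψ '' colourClass 1 m n h v c) N := by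
    intro c
    refine (H c c.2).image ψ fun e he e' he' x hx y hy hxy => ?_
    rw [← hιψ c e he x hx, ← hιψ c e' he' y hy, hxy]
  have hsub : ∀ c : Fin 3, Sym2.map ψ '' colourClass 1 m n h v c ⊆
      (cycleGraph m □ cycleGraph n).edgeSet := by
    rintro c _ ⟨_, ⟨i, hi, j, hj, -, rfl⟩ | ⟨i, hi, j, hj, -, rfl⟩, rfl⟩
    · rw [Sym2.map_mk, mem_edgeSet, boxProd_adj, cycleGraph_adj_iff_val hn]
      refine Or.inr ⟨Or.inl ?_, rfl⟩
      simp only [ψ, columnSucc_one hj]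
      simp
    · rw [Sym2.map_mk, mem_edgeSet, boxProd_adj, cycleGraph_adj_iff_val hm]
      refine Or.inl ⟨Or.inl ?_, rfl⟩
      simp [ψ]
  choose D hD hiso using fun c => (hcycle c).exists_subgraph (hsub c)
  refine ⟨D, hiso, fun e he => ?_⟩
  have hex : ∃ c < 3, Sym2.map ι e ∈ colourClass 1 m n h v c := by
    induction e with | h x y =>
    obtain ⟨a, b⟩ := x
    obtain ⟨a', b'⟩ := y
    rw [mem_edgeSet, boxProd_adj, cycleGraph_adj_iff_val hn, cycleGraph_adj_iff_val hm] at he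
    simp only at he
    rw [Sym2.map_mk]
    rcases he with ⟨h1 | h1, rfl⟩ | ⟨h1 | h1, rfl⟩
    · exact ⟨_, Nat.mod_lt _ (by omega), Or.inr ⟨a, a.2, b, b.2, rfl, by simp only [ι, h1]⟩⟩
    · exact ⟨_, Nat.mod_lt _ (by omega), Or.inr ⟨a', a'.2, b, b.2, rfl,
        by simp only [ι, h1]; exact Sym2.eq_swap⟩⟩
    · exact ⟨_, Nat.mod_lt _ (by omega), Or.inl ⟨a, a.2, b, b.2, rfl,
        by simp only [ι, columnSucc_one b.2, h1]⟩⟩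
    · exact ⟨_, Nat.mod_lt _ (by omega), Or.inl ⟨a, a.2, b', b'.2, rfl,
        by simp only [ι, columnSucc_one b'.2, h1]; exact Sym2.eq_swap⟩⟩
  obtain ⟨c, hc, hce⟩ := hex
  refine ⟨⟨c, hc⟩, ?_, ?_⟩
  · simp only [hD]
    refine ⟨_, hce, ?_⟩
    rw [Sym2.map_map, show ψ ∘ ι = id from funext hψι, Sym2.map_id, id]
  · intro c' hc'
    simp only [hD] at hc'
    obtain ⟨e', he', rfl⟩ := hc'
    rw [hιψe _ _ he'] at hce
    exact Fin.ext (eq_of_mem_colourClass hm hn he' hce)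

lemma colourClass_congr {q m n : ℕ} {h v h' v' : ℕ → ℕ → ℕ} {c : ℕ}
    (hh : ∀ i < m, ∀ j < n, h i j % 3 = h' i j % 3)
    (hv : ∀ i < m, ∀ j < n, v i j % 3 = v' i j % 3) :
    colourClass q m n h v c = colourClass q m n h' v' c := by
  ext e
  refine or_congr (exists_congr fun i => and_congr_right fun hi => exists_congr fun j =>
    and_congr_right fun hj => ?_) (exists_congr fun i => and_congr_right fun hi =>
    exists_congr fun j => and_congr_right fun hj => ?_)
  · rw [hh i hi j hj]
  · rw [hv i hi j hj]

/-- Replacing the lower cut edges by paths through two additional rows adds the edges of these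
rows. -/
lemma colourClass_add_rows {m k : ℕ} {h v : ℕ → ℕ → ℕ} {c : ℕ} (hm : 2 ≤ m) (hc : c < 3)
    (hh : ∀ i, m < i → ∀ j, h i j % 3 = j % 3) (hv₀ : ∀ j, v m j % 3 = j % 3)
    (hv₁ : ∀ j, v (m + 1) j % 3 = (j + 2) % 3) (hv₂ : ∀ j, v (m + 2) j % 3 = j % 3) :
    colourClass 1 (m + 1 + 2) (3 * k) h v c =
      (colourClass 1 (m + 1) (3 * k) h v c \
        {e | ∃ s < k, e = s((m, 3 * s + c), (0, 3 * s + c))}) ∪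
      {e | ∃ s < k, e ∈ pathEdges [(m, 3 * s + c), (m + 1, 3 * s + c),
        (m + 1, columnSucc 1 (3 * k) (3 * s + c)), (m + 2, columnSucc 1 (3 * k) (3 * s + c)),
        (m + 2, 3 * s + c), (0, 3 * s + c)]} := by
  have hmod : ∀ i < m, (i + 1) % (m + 1) = i + 1 := fun i hi => Nat.mod_eq_of_lt (by omega)
  have hmod' : ∀ i < m + 2, (i + 1) % (m + 1 + 2) = i + 1 := fun i hi =>
    Nat.mod_eq_of_lt (by omega)
  ext e
  simp only [pathEdges, List.mem_cons, List.not_mem_nil, or_false, Set.mem_union, Set.mem_sdiff,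
    Set.mem_ofPred_eq, colourClass]
  constructor
  · rintro (⟨i, hi, j, hj, h1, rfl⟩ | ⟨i, hi, j, hj, h1, rfl⟩)
    · by_cases h2 : i ≤ m
      · refine Or.inl ⟨Or.inl ⟨i, by omega, j, hj, h1, rfl⟩, ?_⟩
        rintro ⟨s, hs, h3⟩
        simp only [Sym2.eq_iff, Prod.mk.injEq] at h3
        omega
      · rw [hh i (by omega)] at h1
        obtain ⟨s, rfl⟩ : ∃ s, j = 3 * s + c := ⟨j / 3, by omega⟩
        refine Or.inr ⟨s, by omega, ?_⟩
        rcases (show i = m + 1 ∨ i = m + 2 by omega) with rfl | rfl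
        · exact Or.inr (Or.inl rfl)
        · exact Or.inr (Or.inr (Or.inr (Or.inl Sym2.eq_swap)))
    · by_cases h2 : i < m
      · refine Or.inl ⟨Or.inr ⟨i, by omega, j, hj, h1, ?_⟩, ?_⟩
        · rw [hmod i h2, hmod' i (by omega)]
        · rintro ⟨s, hs, h3⟩
          rw [hmod' i (by omega)] at h3
          simp only [Sym2.eq_iff, Prod.mk.injEq] at h3
          omega
      · rcases (show i = m ∨ i = m + 1 ∨ i = m + 2 by omega) with rfl | rfl | rfl
        · rw [hv₀] at h1
          obtain ⟨s, rfl⟩ : ∃ s, j = 3 * s + c := ⟨j / 3, by omega⟩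
          refine Or.inr ⟨s, by omega, Or.inl ?_⟩
          rw [hmod' i (by omega)]
        · rw [hv₁] at h1
          rw [hmod' _ (by omega)]
          obtain ⟨s, hs, h3⟩ : ∃ s < k, j = columnSucc 1 (3 * k) (3 * s + c) := by
            by_cases h4 : j = 0
            · refine ⟨k - 1, by omega, ?_⟩
              rw [columnSucc, if_neg (by omega), Nat.mod_one, h4]
            · refine ⟨(j - 1) / 3, by omega, ?_⟩
              rw [columnSucc, if_pos (by omega)]
              omega
          exact Or.inr ⟨s, hs, Or.inr (Or.inr (Or.inl (by rw [h3])))⟩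
        · rw [hv₂] at h1
          obtain ⟨s, rfl⟩ : ∃ s, j = 3 * s + c := ⟨j / 3, by omega⟩
          refine Or.inr ⟨s, by omega, Or.inr (Or.inr (Or.inr (Or.inr ?_)))⟩
          rw [show m + 2 + 1 = m + 1 + 2 by omega, Nat.mod_self]
  · rintro (⟨⟨i, hi, j, hj, h1, rfl⟩ | ⟨i, hi, j, hj, h1, rfl⟩, h2⟩ |
      ⟨s, hs, rfl | rfl | rfl | rfl | rfl⟩)
    · exact Or.inl ⟨i, by omega, j, hj, h1, rfl⟩
    · by_cases h3 : i < m
      · refine Or.inr ⟨i, by omega, j, hj, h1, ?_⟩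
        rw [hmod i h3, hmod' i (by omega)]
      · obtain rfl : i = m := by omega
        rw [hv₀] at h1
        obtain ⟨s, rfl⟩ : ∃ s, j = 3 * s + c := ⟨j / 3, by omega⟩
        exact absurd ⟨s, by omega, by rw [Nat.mod_self]⟩ h2
    · refine Or.inr ⟨m, by omega, _, (by omega : 3 * s + c < 3 * k), ?_, ?_⟩
      · rw [hv₀]; omega
      · rw [hmod' _ (by omega)]
    · refine Or.inl ⟨m + 1, by omega, _, (by omega : 3 * s + c < 3 * k), ?_, rfl⟩
      rw [hh _ (by omega)]; omega
    · refine Or.inr ⟨m + 1, by omega, _,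
        columnSucc_lt (j := 3 * s + c) (n := 3 * k) one_pos (by omega), ?_, ?_⟩
      · rw [hv₁, columnSucc, Nat.mod_one]
        split_ifs <;> omega
      · rw [hmod' _ (by omega)]
    · refine Or.inl ⟨m + 2, by omega, _, (by omega : 3 * s + c < 3 * k), ?_, Sym2.eq_swap⟩
      rw [hh _ (by omega)]; omega
    · refine Or.inr ⟨m + 2, by omega, _, (by omega : 3 * s + c < 3 * k), ?_, ?_⟩
      · rw [hv₂]; omega
      · rw [show m + 2 + 1 = m + 1 + 2 by omega, Nat.mod_self]

lemma IsCycleEdges.add_rows {m k N : ℕ} {h v : ℕ → ℕ → ℕ} {c : ℕ} (hm : 2 ≤ m) (hc : c < 3)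
    (hh : ∀ i, m < i → ∀ j, h i j % 3 = j % 3) (hv₀ : ∀ j, v m j % 3 = j % 3)
    (hv₁ : ∀ j, v (m + 1) j % 3 = (j + 2) % 3) (hv₂ : ∀ j, v (m + 2) j % 3 = j % 3)
    (hE : IsCycleEdges (colourClass 1 (m + 1) (3 * k) h v c) N) :
    IsCycleEdges (colourClass 1 (m + 1 + 2) (3 * k) h v c) (N + 4 * k) := by
  let J : List ((ℕ × ℕ) × List (ℕ × ℕ) × (ℕ × ℕ)) := (List.range k).map fun s =>
    ((m, 3 * s + c), [(m + 1, 3 * s + c), (m + 1, columnSucc 1 (3 * k) (3 * s + c)),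
      (m + 2, columnSucc 1 (3 * k) (3 * s + c)), (m + 2, 3 * s + c)], (0, 3 * s + c))
  have hlen : (J.flatMap fun i => i.2.1).length = 4 * k := by
    simp [J, List.flatMap_map, mul_comm]
  have hmem : ∀ i ∈ J, ∃ s < k, i = ((m, 3 * s + c), [(m + 1, 3 * s + c),
      (m + 1, columnSucc 1 (3 * k) (3 * s + c)), (m + 2, columnSucc 1 (3 * k) (3 * s + c)),
      (m + 2, 3 * s + c)], (0, 3 * s + c)) := by
    intro i hi
    obtain ⟨s, hs, rfl⟩ := List.mem_map.1 hi
    exact ⟨s, List.mem_range.1 hs, rfl⟩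
  rw [← hlen, colourClass_add_rows hm hc hh hv₀ hv₁ hv₂]
  have hsucc : ∀ s, columnSucc 1 (3 * k) (3 * s + c) =
      if 3 * s + c + 1 < 3 * k then 3 * s + c + 1 else 0 := fun s => by
    rw [columnSucc, Nat.mod_one]
  have h1 := hE.insertPaths J (fun i hi => ?_) (fun i hi => ?_) ?_ ?_ ?_
  · simpa [J] using h1
  · obtain ⟨s, hs, rfl⟩ := hmem i hi
    refine Or.inr ⟨m, by omega, _, (by omega : 3 * s + c < 3 * k), ?_, by rw [Nat.mod_self]⟩
    rw [hv₀]; omega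
  · obtain ⟨s, hs, rfl⟩ := hmem i hi
    simp
  · simp only [J, List.map_map]
    refine List.nodup_range.map fun s t hst => ?_
    simp only [Function.comp_apply, Sym2.eq_iff, Prod.mk.injEq] at hst
    omega
  · simp only [J, List.flatMap_map]
    rw [List.nodup_flatMap]
    constructor
    · intro s hs
      have hs' := List.mem_range.1 hs
      have := hsucc s
      simp only [List.nodup_cons, List.mem_cons, Prod.mk.injEq, List.not_mem_nil, or_false,
        List.nodup_nil, and_true, true_and, not_false_eq_true, not_or]
      split_ifs at this <;> omega
    · refine List.Pairwise.imp_of_mem ?_ List.nodup_range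
      intro s t hs ht hst
      have h1 := hsucc s
      have h2 := hsucc t
      have h3 := List.mem_range.1 hs
      have h4 := List.mem_range.1 ht
      rintro ⟨a, b⟩ h5 h6
      simp only [List.mem_cons, Prod.mk.injEq, List.not_mem_nil, or_false] at h5 h6
      split_ifs at h1 h2 <;> omega
  · intro x hx e he hxe
    obtain ⟨i, hi, hx⟩ := List.mem_flatMap.1 hx
    obtain ⟨s, hs, rfl⟩ := hmem i hi
    have h3 := (lt_of_mem_colourClass one_pos (by omega) he hxe).1
    simp only [List.mem_cons, List.not_mem_nil, or_false] at hx
    rcases hx with rfl | rfl | rfl | rfl <;> simp only at h3 <;> omega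

/-- The colouring that agrees with `h` on the first `b` rows and is `j ↦ j` on the others. -/
def extendRow (b : ℕ) (h : ℕ → ℕ → ℕ) (i j : ℕ) : ℕ := if i < b then h i j else j

/-- The colouring that agrees with `v` on the first `b` rows and is alternately `j ↦ j + 2` and
`j ↦ j` on the others. -/
def extendColumn (b : ℕ) (v : ℕ → ℕ → ℕ) (i j : ℕ) : ℕ :=
  if i < b then v i j else if (i - b) % 2 = 0 then j + 2 else j

lemma IsCycleEdges.add_mul_rows {b k : ℕ} {h v : ℕ → ℕ → ℕ} {c : ℕ} (hb : 3 ≤ b) (hc : c < 3)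
    (hv : ∀ j, v (b - 1) j % 3 = j % 3)
    (hE : IsCycleEdges (colourClass 1 b (3 * k) h v c) (2 * b * k)) (t : ℕ) :
    IsCycleEdges (colourClass 1 (b + 2 * t) (3 * k) (extendRow b h) (extendColumn b v) c)
      (2 * (b + 2 * t) * k) := by
  induction t with
  | zero =>
    rw [colourClass_congr (h' := h) (v' := v)]
    · exact hE
    · intro i hi j _
      rw [extendRow, if_pos (by omega)]
    · intro i hi j _
      rw [extendColumn, if_pos (by omega)]
  | succ t ih =>
    obtain ⟨m, hm⟩ : ∃ m, b + 2 * t = m + 1 := ⟨b + 2 * t - 1, by omega⟩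
    rw [hm] at ih
    have h1 := ih.add_rows (by omega) hc ?_ ?_ ?_ ?_
    · rw [show b + 2 * (t + 1) = m + 1 + 2 by omega]
      rw [show 2 * (m + 1 + 2) * k = 2 * (m + 1) * k + 4 * k by ring]
      exact h1
    · intro i hi j
      rw [extendRow, if_neg (by omega)]
    · intro j
      rw [extendColumn]
      split_ifs with h1 h2
      · rw [show m = b - 1 by omega, hv]
      · omega
      · rfl
    · intro j
      rw [extendColumn, if_neg (by omega), if_pos (by omega)]
    · intro j
      rw [extendColumn, if_neg (by omega), if_neg (by omega)]

lemma IsRerouting.isCycleEdges_mul {q m n₀ p N : ℕ} {h v : ℕ → ℕ → ℕ} {c : ℕ}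
    {I : List ((ℕ × ℕ) × List (ℕ × ℕ) × (ℕ × ℕ))} (hI : IsRerouting q m n₀ p h v c I)
    (hqn : 3 * q ≤ n₀) (hq : 0 < q) (hdvd : q ∣ n₀) (hp : q ∣ p)
    (hh : ∀ i < m, ∀ j, n₀ - q ≤ j → h i (j + p) % 3 = h i j % 3)
    (hv : ∀ i < m, ∀ j, n₀ ≤ j → v i (j + p) % 3 = v i j % 3)
    (hE : IsCycleEdges (colourClass q m n₀ h v c) N) (t : ℕ) :
    IsCycleEdges (colourClass q m (n₀ + p * t) h v c)
      (N + (I.flatMap fun i => i.2.1).length * t) := by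
  have hmul : ∀ (g : ℕ → ℕ) (a : ℕ), (∀ j, a ≤ j → g (j + p) % 3 = g j % 3) →
      ∀ t j, a ≤ j → g (j + p * t) % 3 = g j % 3 := by
    intro g a hg t j hj
    induction t with
    | zero => rfl
    | succ t ih => rw [mul_add, mul_one, ← add_assoc, hg _ (by omega), ih]
  induction t with
  | zero => exact hE
  | succ t ih =>
    have h1 := hI.isCycleEdges hqn hq hdvd (Dvd.dvd.mul_right hp t)
      (fun i hi => hmul _ _ (hh i hi) t) (fun i hi => hmul _ _ (hv i hi) t) ih
    rw [mul_add, mul_add, mul_one, mul_one, ← add_assoc, ← add_assoc]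
    exact h1

/-- Renumbering of `3 * k` columns under which `columnSucc 3` becomes the cyclic order. -/
def sortColumn (k : ℕ) (x : ℕ × ℕ) : ℕ × ℕ := (x.1, x.2 % 3 * k + x.2 / 3)

lemma sortColumn_image_colourClass {m k : ℕ} {h v : ℕ → ℕ → ℕ} {c : ℕ} :
    Sym2.map (sortColumn k) '' colourClass 3 m (3 * k) h v c =
      colourClass 1 m (3 * k) (fun i j => h i (j % k * 3 + j / k))
        (fun i j => v i (j % k * 3 + j / k)) c := by
  have hinv : ∀ j < 3 * k, (j % 3 * k + j / 3) % k * 3 + (j % 3 * k + j / 3) / k = j := by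
    intro j hj
    have h1 : j / 3 < k := by omega
    have h2 : 0 < k := by omega
    rw [mul_comm (j % 3) k, Nat.mul_add_mod, Nat.mul_add_div h2, Nat.mod_eq_of_lt h1,
      Nat.div_eq_of_lt h1]
    omega
  have hlt : ∀ j < 3 * k, j % 3 * k + j / 3 < 3 * k := by
    intro j hj
    have : j % 3 ≤ 2 := by omega
    have := Nat.mul_le_mul_right k this
    omega
  have hinv' : ∀ j < 3 * k, ∃ j₀ < 3 * k, j = j₀ % 3 * k + j₀ / 3 := by
    intro j hj
    have h2 : 0 < k := by omega
    have h3 : j / k < 3 := by rw [Nat.div_lt_iff_lt_mul h2]; exact hj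
    have h4 := Nat.mod_lt j h2
    have h5 : ∀ a b : ℕ, b < 3 → (a * 3 + b) % 3 = b ∧ (a * 3 + b) / 3 = a := by omega
    refine ⟨j % k * 3 + j / k, by omega, ?_⟩
    rw [(h5 _ _ h3).1, (h5 _ _ h3).2, mul_comm, Nat.div_add_mod]
  have hsucc : ∀ i, ∀ j < 3 * k, sortColumn k (i, columnSucc 3 (3 * k) j) =
      (i, columnSucc 1 (3 * k) (j % 3 * k + j / 3)) := by
    intro i j hj
    refine Prod.ext rfl ?_
    simp only [sortColumn, columnSucc, Nat.mod_one]
    have h3 : j % 3 = 0 ∨ j % 3 = 1 ∨ j % 3 = 2 := by omega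
    by_cases h4 : j + 3 < 3 * k
    · rw [if_pos h4, Nat.add_mod_right, show (j + 3) / 3 = j / 3 + 1 by omega, if_pos]
      · omega
      · rcases h3 with h3 | h3 | h3 <;> rw [h3] <;> omega
    · rw [if_neg h4]
      rcases h3 with h3 | h3 | h3
      · rw [show (j + 1) % 3 = 1 by omega, h3, if_pos] <;> omega
      · rw [show (j + 1) % 3 = 2 by omega, h3, if_pos] <;> omega
      · rw [show (j + 1) % 3 = 0 by omega, h3, if_neg] <;> omega
  ext e
  constructor
  · rintro ⟨_, ⟨i, hi, j, hj, h1, rfl⟩ | ⟨i, hi, j, hj, h1, rfl⟩, rfl⟩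
    · refine Or.inl ⟨i, hi, _, hlt j hj, ?_, ?_⟩
      · simp only [hinv j hj, h1]
      · rw [Sym2.map_mk, hsucc i j hj]
        rfl
    · refine Or.inr ⟨i, hi, _, hlt j hj, ?_, rfl⟩
      simp only [hinv j hj, h1]
  · rintro (⟨i, hi, j, hj, h1, rfl⟩ | ⟨i, hi, j, hj, h1, rfl⟩) <;>
    obtain ⟨j, hj', rfl⟩ := hinv' j hj
    · refine ⟨_, Or.inl ⟨i, hi, j, hj', ?_, rfl⟩, ?_⟩
      · simpa only [hinv j hj'] using h1
      · rw [Sym2.map_mk, hsucc i j hj']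
        rfl
    · refine ⟨_, Or.inr ⟨i, hi, j, hj', ?_, rfl⟩, rfl⟩
      simpa only [hinv j hj'] using h1

lemma IsCycleEdges.sortColumn {m k N : ℕ} {h v : ℕ → ℕ → ℕ} {c : ℕ} (hk : 0 < k)
    (hE : IsCycleEdges (colourClass 3 m (3 * k) h v c) N) :
    IsCycleEdges (colourClass 1 m (3 * k) (fun i j => h i (j % k * 3 + j / k))
        (fun i j => v i (j % k * 3 + j / k)) c) N := by
  rw [← sortColumn_image_colourClass]
  refine hE.image _ fun e he e' he' x hx y hy hxy => ?_
  have h1 := (lt_of_mem_colourClass three_pos (by omega) he hx).2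
  have h2 := (lt_of_mem_colourClass three_pos (by omega) he' hy).2
  obtain ⟨a, b⟩ := x
  obtain ⟨a', b'⟩ := y
  simp only [_root_.sortColumn, Prod.mk.injEq] at hxy h1 h2 ⊢
  refine ⟨hxy.1, ?_⟩
  have h3 : (b % 3 * k + b / 3) / k = b % 3 := by
    rw [mul_comm, Nat.mul_add_div hk, Nat.div_eq_of_lt (by omega), add_zero]
  have h4 : (b' % 3 * k + b' / 3) / k = b' % 3 := by
    rw [mul_comm, Nat.mul_add_div hk, Nat.div_eq_of_lt (by omega), add_zero]
  rw [hxy.2, h4] at h3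
  have h5 := hxy.2
  rw [h3] at h5
  omega

/-- The edges within rows of a colouring of the torus that is constant along diagonals. -/
def diagonalRow (i j : ℕ) : ℕ := j + 2 * i

/-- The edges within columns of a colouring of the torus that is constant along diagonals. -/
def diagonalColumn (i j : ℕ) : ℕ := j + 2 * i + 2

/-- Colours of the edges within rows of a torus with four rows and `6 * k` columns. -/
def evenRow (i j : ℕ) : ℕ :=
  if i < 2 ∧ j = 3 then 1 else
    ([[2, 1, 1, 0, 0, 0], [0, 2, 0, 0, 0, 0], [1, 0, 2, 2, 1, 2], [0, 0, 0, 1, 2, 1]].getD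
      i []).getD (j % 6) 0

/-- Colours of the edges within columns of a torus with four rows and `6 * k` columns. -/
def evenColumn (i j : ℕ) : ℕ :=
  if i = 0 ∧ (j = 3 ∨ j = 4) then 0 else
    ([[2, 2, 2, 1, 1, 2], [2, 0, 0, 1, 1, 2], [1, 1, 2, 1, 2, 1], [0, 1, 2, 0, 1, 2]].getD
      i []).getD (j % 6) 0

/-- Colours of the edges within rows of a torus with four rows and `6 * k + 3` columns, the columns
being ordered as by `columnSucc 3`. -/
def oddRow (i j : ℕ) : ℕ :=
  ([[0, 0, 1, 0, 0, 1, 0, 0, 1], [2, 1, 2, 0, 0, 1, 2, 1, 2],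
    [2, 1, 2, 2, 1, 2, 2, 1, 2], [0, 0, 1, 2, 1, 2, 0, 0, 1]].getD i []).getD
      (if j < 3 then j else 3 + (j - 3) % 6) 0

/-- Colours of the edges within columns of a torus with four rows and `6 * k + 3` columns, the
columns being ordered as by `columnSucc 3`. -/
def oddColumn (i j : ℕ) : ℕ :=
  ([[0, 2, 1, 2, 1, 2, 2, 1, 2], [0, 1, 2, 0, 0, 1, 0, 0, 1],
    [0, 2, 1, 0, 0, 1, 0, 0, 1], [1, 2, 0, 2, 1, 2, 2, 1, 2]].getD i []).getD
      (if j < 3 then j else 3 + (j - 3) % 6) 0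

/-- The list `L` runs through the vertices of a cycle formed by all edges of colour `c`. -/
structure IsColourCycle (q m n : ℕ) (h v : ℕ → ℕ → ℕ) (c : ℕ) (L : List (ℕ × ℕ)) : Prop where
  le_length : 3 ≤ L.length
  nodup : L.Nodup
  edges_subset : ∀ e ∈ edgesFrom q m n h v c 0 0, e ∈ (List.range L.length).map fun t =>
    s(L.getD t (0, 0), L.getD ((t + 1) % L.length) (0, 0))
  subset_edges : ∀ e ∈ (List.range L.length).map fun t =>
    s(L.getD t (0, 0), L.getD ((t + 1) % L.length) (0, 0)), e ∈ edgesFrom q m n h v c 0 0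

lemma IsColourCycle.isCycleEdges {q m n : ℕ} {h v : ℕ → ℕ → ℕ} {c : ℕ} {L : List (ℕ × ℕ)}
    (hL : IsColourCycle q m n h v c L) : IsCycleEdges (colourClass q m n h v c) L.length := by
  refine ⟨hL.le_length, fun t => L.getD t (0, 0), ?_, ?_⟩
  · intro t ht u hu htu
    simp only [Set.mem_Iio] at ht hu
    simp only [List.getD_eq_getElem _ _ ht, List.getD_eq_getElem _ _ hu] at htu
    exact hL.nodup.getElem_inj_iff.1 htu
  · rw [← coe_edgesFrom_zero]
    ext e
    have h3 : e ∈ edgesFrom q m n h v c 0 0 ↔ _ := ⟨hL.edges_subset e, hL.subset_edges e⟩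
    simp only [List.mem_map, List.mem_range] at h3
    simp only [Set.mem_ofPred_eq, h3, eq_comm (a := e)]

lemma isCycleEdges_diagonal_three {c : ℕ} (hc : c < 3) (t : ℕ) :
    IsCycleEdges (colourClass 1 3 (3 + 3 * t) diagonalRow diagonalColumn c)
      (6 + 6 * t) := by
  have hh : ∀ i < 3, ∀ j, 3 - 1 ≤ j → diagonalRow i (j + 3) % 3 = diagonalRow i j % 3 := by
    intro i _ j hj
    simp only [diagonalRow]
    omega
  have hv : ∀ i < 3, ∀ j, 3 ≤ j → diagonalColumn i (j + 3) % 3 = diagonalColumn i j % 3 := by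
    intro i _ j hj
    simp only [diagonalColumn]
    omega
  interval_cases c
  · have hL : IsColourCycle 1 3 3 diagonalRow diagonalColumn 0
        [(0, 0), (0, 1), (1, 1), (1, 2), (2, 2), (2, 0)] := by
      constructor <;> decide +kernel
    have hI : IsRerouting 1 3 3 3 diagonalRow diagonalColumn 0
        [((2, 2), [(2, 3), (0, 3), (0, 4), (1, 4), (1, 5), (2, 5)], (2, 0))] := by
      constructor <;> decide +kernel
    exact hI.isCycleEdges_mul (by decide) (by decide) (by decide) (by decide) hh hv
      hL.isCycleEdges t
  · have hL : IsColourCycle 1 3 3 diagonalRow diagonalColumn 1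
        [(0, 1), (0, 2), (1, 2), (1, 0), (2, 0), (2, 1)] := by
      constructor <;> decide +kernel
    have hI : IsRerouting 1 3 3 3 diagonalRow diagonalColumn 1
        [((1, 2), [(1, 3), (2, 3), (2, 4), (0, 4), (0, 5), (1, 5)], (1, 0))] := by
      constructor <;> decide +kernel
    exact hI.isCycleEdges_mul (by decide) (by decide) (by decide) (by decide) hh hv
      hL.isCycleEdges t
  · have hL : IsColourCycle 1 3 3 diagonalRow diagonalColumn 2
        [(0, 0), (0, 2), (2, 2), (2, 1), (1, 1), (1, 0)] := by
      constructor <;> decide +kernel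
    have hI : IsRerouting 1 3 3 3 diagonalRow diagonalColumn 2
        [((0, 2), [(0, 3), (1, 3), (1, 4), (2, 4), (2, 5), (0, 5)], (0, 0))] := by
      constructor <;> decide +kernel
    exact hI.isCycleEdges_mul (by decide) (by decide) (by decide) (by decide) hh hv
      hL.isCycleEdges t

lemma isCycleEdges_diagonal_six {c : ℕ} (hc : c < 3) (t : ℕ) :
    IsCycleEdges (colourClass 1 6 (3 + 6 * t) diagonalRow diagonalColumn c)
      (12 + 24 * t) := by
  have hh : ∀ i < 6, ∀ j, 3 - 1 ≤ j → diagonalRow i (j + 6) % 3 = diagonalRow i j % 3 := by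
    intro i _ j hj
    simp only [diagonalRow]
    omega
  have hv : ∀ i < 6, ∀ j, 3 ≤ j → diagonalColumn i (j + 6) % 3 = diagonalColumn i j % 3 := by
    intro i _ j hj
    simp only [diagonalColumn]
    omega
  interval_cases c
  · have hL : IsColourCycle 1 6 3 diagonalRow diagonalColumn 0
        [(0, 0), (0, 1), (1, 1), (1, 2), (2, 2), (2, 0), (3, 0), (3, 1), (4, 1), (4, 2), (5, 2),
         (5, 0)] := by
      constructor <;> decide +kernel
    have hI : IsRerouting 1 6 3 6 diagonalRow diagonalColumn 0
        [((2, 2), [(2, 3), (3, 3), (3, 4), (4, 4), (4, 5), (5, 5), (5, 6), (0, 6), (0, 7), (1, 7),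
         (1, 8), (2, 8)], (2, 0)), ((5, 2), [(5, 3), (0, 3), (0, 4), (1, 4), (1, 5), (2, 5), (2, 6),
         (3, 6), (3, 7), (4, 7), (4, 8), (5, 8)], (5, 0))] := by
      constructor <;> decide +kernel
    exact hI.isCycleEdges_mul (by decide) (by decide) (by decide) (by decide) hh hv
      hL.isCycleEdges t
  · have hL : IsColourCycle 1 6 3 diagonalRow diagonalColumn 1
        [(0, 1), (0, 2), (1, 2), (1, 0), (2, 0), (2, 1), (3, 1), (3, 2), (4, 2), (4, 0), (5, 0),
         (5, 1)] := by
      constructor <;> decide +kernel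
    have hI : IsRerouting 1 6 3 6 diagonalRow diagonalColumn 1
        [((1, 2), [(1, 3), (2, 3), (2, 4), (3, 4), (3, 5), (4, 5), (4, 6), (5, 6), (5, 7), (0, 7),
         (0, 8), (1, 8)], (1, 0)), ((4, 2), [(4, 3), (5, 3), (5, 4), (0, 4), (0, 5), (1, 5), (1, 6),
         (2, 6), (2, 7), (3, 7), (3, 8), (4, 8)], (4, 0))] := by
      constructor <;> decide +kernel
    exact hI.isCycleEdges_mul (by decide) (by decide) (by decide) (by decide) hh hv
      hL.isCycleEdges t
  · have hL : IsColourCycle 1 6 3 diagonalRow diagonalColumn 2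
        [(0, 0), (0, 2), (5, 2), (5, 1), (4, 1), (4, 0), (3, 0), (3, 2), (2, 2), (2, 1), (1, 1),
         (1, 0)] := by
      constructor <;> decide +kernel
    have hI : IsRerouting 1 6 3 6 diagonalRow diagonalColumn 2
        [((0, 2), [(0, 3), (1, 3), (1, 4), (2, 4), (2, 5), (3, 5), (3, 6), (4, 6), (4, 7), (5, 7),
         (5, 8), (0, 8)], (0, 0)), ((3, 2), [(3, 3), (4, 3), (4, 4), (5, 4), (5, 5), (0, 5), (0, 6),
         (1, 6), (1, 7), (2, 7), (2, 8), (3, 8)], (3, 0))] := by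
      constructor <;> decide +kernel
    exact hI.isCycleEdges_mul (by decide) (by decide) (by decide) (by decide) hh hv
      hL.isCycleEdges t

lemma isCycleEdges_even {c : ℕ} (hc : c < 3) (t : ℕ) :
    IsCycleEdges (colourClass 1 4 (6 + 6 * t) evenRow evenColumn c)
      (16 + 16 * t) := by
  have hh : ∀ i < 4, ∀ j, 6 - 1 ≤ j → evenRow i (j + 6) % 3 = evenRow i j % 3 := by
    intro i _ j hj
    rw [evenRow, evenRow, if_neg (by omega), if_neg (by omega), Nat.add_mod_right]
  have hv : ∀ i < 4, ∀ j, 6 ≤ j → evenColumn i (j + 6) % 3 = evenColumn i j % 3 := by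
    intro i _ j hj
    rw [evenColumn, evenColumn, if_neg (by omega), if_neg (by omega), Nat.add_mod_right]
  interval_cases c
  · have hL : IsColourCycle 1 4 6 evenRow evenColumn 0
        [(0, 0), (0, 5), (0, 4), (1, 4), (1, 5), (1, 0), (1, 1), (2, 1), (2, 2), (1, 2), (1, 3),
         (0, 3), (3, 3), (3, 2), (3, 1), (3, 0)] := by
      constructor <;> decide +kernel
    have hI : IsRerouting 1 4 6 6 evenRow evenColumn 0
        [((0, 5), [(0, 6), (3, 6), (3, 7), (3, 8), (3, 9), (0, 9), (0, 10), (0, 11)], (0, 0)),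
         ((1, 5), [(1, 6), (1, 7), (2, 7), (2, 8), (1, 8), (1, 9), (1, 10), (1, 11)], (1, 0))] := by
      constructor <;> decide +kernel
    exact hI.isCycleEdges_mul (by decide) (by decide) (by decide) (by decide) hh hv
      hL.isCycleEdges t
  · have hL : IsColourCycle 1 4 6 evenRow evenColumn 1
        [(0, 1), (0, 2), (0, 3), (0, 4), (3, 4), (3, 3), (2, 3), (1, 3), (1, 4), (2, 4), (2, 5),
         (3, 5), (3, 0), (2, 0), (2, 1), (3, 1)] := by
      constructor <;> decide +kernel
    have hI : IsRerouting 1 4 6 6 evenRow evenColumn 1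
        [((3, 5), [(3, 6), (2, 6), (2, 7), (3, 7), (0, 7), (0, 8), (0, 9), (1, 9), (2, 9), (3, 9),
         (3, 10), (0, 10), (1, 10), (2, 10), (2, 11), (3, 11)], (3, 0))] := by
      constructor <;> decide +kernel
    exact hI.isCycleEdges_mul (by decide) (by decide) (by decide) (by decide) hh hv
      hL.isCycleEdges t
  · have hL : IsColourCycle 1 4 6 evenRow evenColumn 2
        [(0, 0), (0, 1), (1, 1), (1, 2), (0, 2), (3, 2), (2, 2), (2, 3), (2, 4), (3, 4), (3, 5),
         (0, 5), (1, 5), (2, 5), (2, 0), (1, 0)] := by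
      constructor <;> decide +kernel
    have hI : IsRerouting 1 4 6 6 evenRow evenColumn 2
        [((2, 5), [(2, 6), (1, 6), (0, 6), (0, 7), (1, 7), (1, 8), (0, 8), (3, 8), (2, 8), (2, 9),
         (2, 10), (3, 10), (3, 11), (0, 11), (1, 11), (2, 11)], (2, 0))] := by
      constructor <;> decide +kernel
    exact hI.isCycleEdges_mul (by decide) (by decide) (by decide) (by decide) hh hv
      hL.isCycleEdges t

lemma isCycleEdges_odd {c : ℕ} (hc : c < 3) (t : ℕ) :
    IsCycleEdges (colourClass 3 4 (9 + 6 * t) oddRow oddColumn c)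
      (24 + 16 * t) := by
  have hh : ∀ i < 4, ∀ j, 9 - 3 ≤ j → oddRow i (j + 6) % 3 = oddRow i j % 3 := by
    intro i _ j hj
    rw [oddRow, oddRow, if_neg (by omega), if_neg (by omega),
      show j + 6 - 3 = j - 3 + 6 by omega, Nat.add_mod_right]
  have hv : ∀ i < 4, ∀ j, 9 ≤ j → oddColumn i (j + 6) % 3 = oddColumn i j % 3 := by
    intro i _ j hj
    rw [oddColumn, oddColumn, if_neg (by omega), if_neg (by omega),
      show j + 6 - 3 = j - 3 + 6 by omega, Nat.add_mod_right]
  interval_cases c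
  · have hL : IsColourCycle 3 4 9 oddRow oddColumn 0
        [(0, 0), (0, 3), (0, 6), (0, 1), (0, 4), (0, 7), (0, 2), (3, 2), (3, 7), (2, 7), (1, 7),
         (1, 4), (2, 4), (3, 4), (3, 1), (3, 6), (2, 6), (1, 6), (1, 3), (2, 3), (3, 3), (3, 0),
         (2, 0), (1, 0)] := by
      constructor <;> decide +kernel
    have hI : IsRerouting 3 4 9 6 oddRow oddColumn 0
        [((0, 6), [(0, 9), (0, 12)], (0, 1)), ((0, 7), [(0, 10), (0, 13)], (0, 2)), ((3, 6),
         [(3, 9), (2, 9), (1, 9), (1, 12), (2, 12), (3, 12)], (3, 1)), ((3, 7), [(3, 10), (2, 10),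
         (1, 10), (1, 13), (2, 13), (3, 13)], (3, 2))] := by
      constructor <;> decide +kernel
    exact hI.isCycleEdges_mul (by decide) (by decide) (by decide) (by decide) hh hv
      hL.isCycleEdges t
  · have hL : IsColourCycle 3 4 9 oddRow oddColumn 1
        [(0, 0), (0, 8), (0, 5), (0, 2), (1, 2), (1, 7), (0, 7), (3, 7), (3, 4), (0, 4), (1, 4),
         (1, 1), (2, 1), (2, 4), (2, 7), (2, 2), (3, 2), (3, 5), (2, 5), (1, 5), (1, 8), (2, 8),
         (3, 8), (3, 0)] := by
      constructor <;> decide +kernel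
    have hI : IsRerouting 3 4 9 6 oddRow oddColumn 1
        [((0, 8), [(0, 11), (0, 14)], (0, 0)), ((1, 7), [(1, 10), (0, 10), (3, 10), (3, 13),
         (0, 13), (1, 13)], (1, 2)), ((2, 7), [(2, 10), (2, 13)], (2, 2)), ((3, 8), [(3, 11),
         (2, 11), (1, 11), (1, 14), (2, 14), (3, 14)], (3, 0))] := by
      constructor <;> decide +kernel
    exact hI.isCycleEdges_mul (by decide) (by decide) (by decide) (by decide) hh hv
      hL.isCycleEdges t
  · have hL : IsColourCycle 3 4 9 oddRow oddColumn 2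
        [(0, 1), (1, 1), (1, 6), (0, 6), (3, 6), (3, 3), (0, 3), (1, 3), (1, 0), (1, 8), (0, 8),
         (3, 8), (3, 5), (0, 5), (1, 5), (1, 2), (2, 2), (2, 5), (2, 8), (2, 0), (2, 3), (2, 6),
         (2, 1), (3, 1)] := by
      constructor <;> decide +kernel
    have hI : IsRerouting 3 4 9 6 oddRow oddColumn 2
        [((1, 6), [(1, 9), (0, 9), (3, 9), (3, 12), (0, 12), (1, 12)], (1, 1)), ((1, 8), [(1, 11),
         (0, 11), (3, 11), (3, 14), (0, 14), (1, 14)], (1, 0)), ((2, 6), [(2, 9), (2, 12)], (2, 1)),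
         ((2, 8), [(2, 11), (2, 14)], (2, 0))] := by
      constructor <;> decide +kernel
    exact hI.isCycleEdges_mul (by decide) (by decide) (by decide) (by decide) hh hv
      hL.isCycleEdges t

lemma isCycleEdges_odd_three {c : ℕ} (hc : c < 3) :
    IsCycleEdges (colourClass 3 4 3 oddRow oddColumn c) 8 := by
  interval_cases c
  · have hL : IsColourCycle 3 4 3 oddRow oddColumn 0
        [(0, 0), (0, 1), (0, 2), (3, 2), (3, 1), (3, 0), (2, 0), (1, 0)] := by
      constructor <;> decide +kernel
    exact hL.isCycleEdges
  · have hL : IsColourCycle 3 4 3 oddRow oddColumn 1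
        [(0, 0), (0, 2), (1, 2), (1, 1), (2, 1), (2, 2), (3, 2), (3, 0)] := by
      constructor <;> decide +kernel
    exact hL.isCycleEdges
  · have hL : IsColourCycle 3 4 3 oddRow oddColumn 2
        [(0, 1), (1, 1), (1, 0), (1, 2), (2, 2), (2, 0), (2, 1), (3, 1)] := by
      constructor <;> decide +kernel
    exact hL.isCycleEdges

/-- The edges of the torus can be coloured such that each colour class is a cycle. -/
lemma exists_colouring (m k : ℕ) (hm : 3 ≤ m) (hk : 1 ≤ k) :
    ∃ h v : ℕ → ℕ → ℕ, ∀ c < 3, IsCycleEdges (colourClass 1 m (3 * k) h v c) (2 * m * k) := by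
  rcases Nat.even_or_odd m with hm2 | hm2
  · rcases Nat.even_or_odd k with hk2 | hk2
    · obtain ⟨s, rfl⟩ : ∃ s, m = 4 + 2 * s := by
        obtain ⟨a, rfl⟩ := hm2
        exact ⟨a - 2, by omega⟩
      obtain ⟨t, rfl⟩ : ∃ t, k = 2 + 2 * t := by
        obtain ⟨a, rfl⟩ := hk2
        exact ⟨a - 1, by omega⟩
      refine ⟨extendRow 4 evenRow, extendColumn 4 evenColumn, fun c hc => ?_⟩
      refine IsCycleEdges.add_mul_rows (by omega) hc ?_ ?_ s
      · intro j
        have hlast : ∀ a < 6, [0, 1, 2, 0, 1, 2].getD a 0 % 3 = a % 3 := by decide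
        have hj := hlast (j % 6) (Nat.mod_lt _ (by norm_num))
        rw [Nat.mod_mod_of_dvd _ (by norm_num)] at hj
        exact hj
      · rw [show 3 * (2 + 2 * t) = 6 + 6 * t by ring,
          show 2 * 4 * (2 + 2 * t) = 16 + 16 * t by ring]
        exact isCycleEdges_even hc t
    · obtain ⟨t, rfl⟩ := hk2
      by_cases hm4 : m = 4
      · subst hm4
        refine ⟨_, _, fun c hc => IsCycleEdges.sortColumn (h := oddRow) (v := oddColumn)
          (by omega) ?_⟩
        rcases t with _ | t
        · exact isCycleEdges_odd_three hc
        · rw [show 3 * (2 * (t + 1) + 1) = 9 + 6 * t by ring,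
            show 2 * 4 * (2 * (t + 1) + 1) = 24 + 16 * t by ring]
          exact isCycleEdges_odd hc t
      · obtain ⟨s, rfl⟩ : ∃ s, m = 6 + 2 * s := by
          obtain ⟨a, rfl⟩ := hm2
          exact ⟨a - 3, by omega⟩
        refine ⟨extendRow 6 diagonalRow, extendColumn 6 diagonalColumn, fun c hc => ?_⟩
        refine IsCycleEdges.add_mul_rows (by omega) hc ?_ ?_ s
        · intro j
          simp only [diagonalColumn]
          omega
        · rw [show 3 * (2 * t + 1) = 3 + 6 * t by ring,
            show 2 * 6 * (2 * t + 1) = 12 + 24 * t by ring]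
          exact isCycleEdges_diagonal_six hc t
  · obtain ⟨s, rfl⟩ : ∃ s, m = 3 + 2 * s := by
      obtain ⟨a, rfl⟩ := hm2
      exact ⟨a - 1, by omega⟩
    obtain ⟨t, rfl⟩ : ∃ t, k = 1 + t := ⟨k - 1, by omega⟩
    refine ⟨extendRow 3 diagonalRow, extendColumn 3 diagonalColumn, fun c hc => ?_⟩
    refine IsCycleEdges.add_mul_rows (by omega) hc ?_ ?_ s
    · intro j
      simp only [diagonalColumn]
      omega
    · rw [show 3 * (1 + t) = 3 + 3 * t by ring, show 2 * 3 * (1 + t) = 6 + 6 * t by ring]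
      exact isCycleEdges_diagonal_three hc t

theorem three_cycle_decomposition_of_torus (m n : ℕ) (hm : 3 ≤ m) (hn : 3 ≤ n)
    (hn3 : 3 ∣ n) :
    ∃ (D : Fin 3 → (cycleGraph m □ cycleGraph n).Subgraph) (c : ℕ),
      c = 2 * m * n / 3 ∧
      (∀ i, Nonempty ((D i).coe ≃g cycleGraph c)) ∧
      (∀ e ∈ (cycleGraph m □ cycleGraph n).edgeSet, ∃! i, e ∈ (D i).edgeSet) := by
  obtain ⟨k, rfl⟩ := hn3
  obtain ⟨h, v, H⟩ := exists_colouring m k hm (by omega)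
  obtain ⟨D, hD, hDe⟩ := exists_decomposition_of_isCycleEdges hm hn H
  refine ⟨D, 2 * m * k, ?_, hD, hDe⟩
  rw [show 2 * m * (3 * k) = 2 * m * k * 3 by ring, Nat.mul_div_cancel _ (by norm_num)]
end

section
/- Let k, m, and n be positive integers such that k divides 4mn. Then C_{4k} decomposes C_{4m} □ C_{4n}, i.e., there is a partition of the edge set of C_{4m} □ C_{4n} into subgraphs each isomorphic to the cycle of length 4k. -/
open SimpleGraph

/-- `D` is a decomposition of the graph `G` into copies of the cycle graph `C_k`:
every subgraph in `D` is isomorphic to `C_k`, and every edge of `G` lies in the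
edge set of exactly one member of `D`. -/
def IsCycleDecomposition {V : Type*} (G : SimpleGraph V) (k : ℕ)
    (D : Set G.Subgraph) : Prop :=
  (∀ H ∈ D, Nonempty (H.coe ≃g cycleGraph k)) ∧
  ∀ e ∈ G.edgeSet, ∃! H : D, e ∈ (H : G.Subgraph).edgeSet

/-- The cycle `C_k` decomposes the graph `G`. -/
def CycleDecomposes (k : ℕ) {V : Type*} (G : SimpleGraph V) : Prop :=
  ∃ D : Set G.Subgraph, IsCycleDecomposition G k D

section Orbits

open Equiv Equiv.Perm Function

variable {V : Type*}

theorem Equiv.Perm.pow_apply_eq_pow_apply_iff_modEq [Finite V] (σ : Perm V) (v : V) (i j : ℕ) :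
    (σ ^ i) v = (σ ^ j) v ↔ i ≡ j [MOD minimalPeriod σ v] := by
  have hp : 0 < minimalPeriod σ v :=
    minimalPeriod_pos_of_mem_periodicPts (σ.injective.mem_periodicPts v)
  rw [← iterate_eq_pow, ← iterate_eq_pow, ← iterate_mod_minimalPeriod_eq (n := i),
    ← iterate_mod_minimalPeriod_eq (n := j),
    iterate_eq_iterate_iff_of_lt_minimalPeriod (Nat.mod_lt _ hp) (Nat.mod_lt _ hp)]
  rfl

/-- The orbit of `v` under `σ`, enumerated by the powers of `σ`. -/
noncomputable def orbitEquiv [Finite V] (σ : Perm V) (v : V) :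
    Fin (minimalPeriod σ v) ≃ {w // SameCycle σ v w} :=
  Equiv.ofBijective (fun i => ⟨(σ ^ (i : ℕ)) v, (i : ℕ), by simp⟩) <| by
    have hp : 0 < minimalPeriod σ v :=
      minimalPeriod_pos_of_mem_periodicPts (σ.injective.mem_periodicPts v)
    refine ⟨fun i j h => ?_, ?_⟩
    · have := (σ.pow_apply_eq_pow_apply_iff_modEq v i j).1 (congrArg Subtype.val h)
      exact Fin.ext (this.eq_of_lt_of_lt i.2 j.2)
    · rintro ⟨w, hw⟩
      obtain ⟨i, rfl⟩ := hw.exists_nat_pow_eq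
      refine ⟨⟨i % minimalPeriod σ v, Nat.mod_lt _ hp⟩, Subtype.ext ?_⟩
      exact (σ.pow_apply_eq_pow_apply_iff_modEq v _ _).2 (Nat.mod_modEq _ _)

theorem card_sameCycle [Finite V] (σ : Perm V) (v : V) :
    Nat.card {w // SameCycle σ v w} = minimalPeriod σ v := by
  rw [← Nat.card_congr (orbitEquiv σ v), Nat.card_fin]

theorem cycleGraph_adj_iff_modEq {n : ℕ} (hn : 2 ≤ n) (u v : Fin n) :
    (cycleGraph n).Adj u v ↔ (u : ℕ) + 1 ≡ v [MOD n] ∨ (v : ℕ) + 1 ≡ u [MOD n] := by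
  have key (a b : Fin n) : (b - a).val = 1 ↔ (a : ℕ) + 1 ≡ b [MOD n] := by
    have ha := a.2
    have hb := b.2
    rw [Fin.val_sub, Nat.ModEq, Nat.mod_eq_of_lt hb]
    rcases lt_or_ge (n - a + b : ℕ) n with h | h
    · rw [Nat.mod_eq_of_lt h]
      rcases lt_or_ge (a + 1 : ℕ) n with h' | h'
      · rw [Nat.mod_eq_of_lt h']; omega
      · rw [Nat.mod_eq_sub_mod h', Nat.mod_eq_of_lt (by omega)]; omega
    · rw [Nat.mod_eq_sub_mod h, Nat.mod_eq_of_lt (by omega)]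
      rcases lt_or_ge (a + 1 : ℕ) n with h' | h'
      · rw [Nat.mod_eq_of_lt h']; omega
      · rw [Nat.mod_eq_sub_mod h', Nat.mod_eq_of_lt (by omega)]; omega
  rw [cycleGraph_adj', key, key, or_comm]

/-- The subgraph of `G` traced out by the orbit of `v` under a permutation `σ` moving every
vertex to a neighbour. -/
def orbitSubgraph {G : SimpleGraph V} (σ : Perm V) (h : ∀ v, G.Adj v (σ v)) (v : V) :
    G.Subgraph where
  verts := {w | SameCycle σ v w}
  Adj a b := SameCycle σ v a ∧ (σ a = b ∨ σ b = a)
  adj_sub := by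
    rintro a b ⟨-, rfl | rfl⟩
    · exact h a
    · exact (h b).symm
  edge_vert h := h.1
  symm := ⟨by
    rintro a b ⟨hv, rfl | rfl⟩
    · exact ⟨hv.apply_right, Or.inr rfl⟩
    · exact ⟨sameCycle_apply_right.1 hv, Or.inl rfl⟩⟩

theorem nonempty_orbitSubgraph_iso [Finite V] {G : SimpleGraph V} (σ : Perm V)
    (h : ∀ v, G.Adj v (σ v)) (v : V) (hL : 2 ≤ minimalPeriod σ v) :
    Nonempty ((orbitSubgraph σ h v).coe ≃g cycleGraph (minimalPeriod σ v)) := by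
  refine ⟨RelIso.symm ⟨orbitEquiv σ v, fun {i j} => ?_⟩⟩
  have hi : SameCycle σ v ((σ ^ (i : ℕ)) v) := ⟨(i : ℕ), by simp⟩
  rw [cycleGraph_adj_iff_modEq hL, ← σ.pow_apply_eq_pow_apply_iff_modEq,
    ← σ.pow_apply_eq_pow_apply_iff_modEq]
  change SameCycle σ v ((σ ^ (i : ℕ)) v) ∧ (σ ((σ ^ (i : ℕ)) v) = (σ ^ (j : ℕ)) v ∨
    σ ((σ ^ (j : ℕ)) v) = (σ ^ (i : ℕ)) v) ↔ _
  simp [pow_succ', hi]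

theorem orbitSubgraph_congr {G : SimpleGraph V} (σ : Perm V) (h : ∀ v, G.Adj v (σ v))
    {v w : V} (hvw : SameCycle σ v w) : orbitSubgraph σ h v = orbitSubgraph σ h w := by
  have key (a : V) : SameCycle σ v a ↔ SameCycle σ w a :=
    ⟨hvw.symm.trans, hvw.trans⟩
  ext <;> simp [orbitSubgraph, key]

/-- If every edge of `G` joins a vertex to its successor under exactly one of the permutations
`σ c`, and all orbits have size `k`, then the orbits form a decomposition of `G` into copies of
the `k`-cycle. -/
theorem cycleDecomposes_of_perms [Finite V] {ι : Type*} {G : SimpleGraph V} {k : ℕ} (hk : 2 ≤ k)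
    (σ : ι → Perm V) (hcard : ∀ c v, Nat.card {w // SameCycle (σ c) v w} = k)
    (hadj : ∀ c v, G.Adj v (σ c v))
    (hex : ∀ v w, G.Adj v w → ∃! c, σ c v = w ∨ σ c w = v) :
    CycleDecomposes k G := by
  refine ⟨{H | ∃ c v, H = orbitSubgraph (σ c) (hadj c) v}, ?_, ?_⟩
  · rintro _ ⟨c, v, rfl⟩
    have hp : minimalPeriod (σ c) v = k := by rw [← card_sameCycle, hcard]
    rw [← hp] at hk ⊢
    exact nonempty_orbitSubgraph_iso _ _ _ hk
  · intro e
    induction e with | h a b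
    intro hab
    obtain ⟨c, hc, huniq⟩ := hex a b hab
    refine ⟨⟨orbitSubgraph (σ c) (hadj c) a, c, a, rfl⟩, ⟨SameCycle.refl _ _, hc⟩, ?_⟩
    rintro ⟨_, c', v, rfl⟩ ⟨hva, hc'⟩
    obtain rfl := huniq c' hc'
    exact Subtype.ext (orbitSubgraph_congr (σ c') (hadj c') hva)

end Orbits

/-- A system of square cells. Side `d` of the cell `c` is shared with the cell `nb c d`, whose side
`d + 2` it is; `act c d` says that the cells are merged across this side. -/
structure CellSystem (C : Type*) where
  nb : C → Fin 4 → C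
  act : C → Fin 4 → Prop
  nb_nb : ∀ c d, nb (nb c d) (d + 2) = c
  act_nb : ∀ c d, act c d → act (nb c d) (d + 2)

namespace CellSystem

open Equiv Equiv.Perm

variable {C : Type*} (S : CellSystem C)

open Classical in
/-- Pass from the side `d` of `c` to the other side of the same wall, if the wall is active. -/
noncomputable def cross (x : C × Fin 4) : C × Fin 4 :=
  if S.act x.1 x.2 then (S.nb x.1 x.2, x.2 + 2) else x

theorem cross_of_act {c : C} {d : Fin 4} (h : S.act c d) :
    S.cross (c, d) = (S.nb c d, d + 2) := if_pos h

theorem cross_of_not_act {c : C} {d : Fin 4} (h : ¬ S.act c d) : S.cross (c, d) = (c, d) :=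
  if_neg h

theorem cross_involutive : Function.Involutive S.cross := by
  rintro ⟨c, d⟩
  by_cases h : S.act c d
  · rw [S.cross_of_act h, S.cross_of_act (S.act_nb c d h), S.nb_nb, add_assoc]
    simp
  · rw [S.cross_of_not_act h, S.cross_of_not_act h]

/-- The permutation of corners walking counterclockwise around the merged cells. -/
noncomputable def turn : Perm (C × Fin 4) :=
  S.cross_involutive.toPerm.trans ((Equiv.refl C).prodCongr (Equiv.addRight 1))

theorem turn_apply (x : C × Fin 4) : S.turn x = ((S.cross x).1, (S.cross x).2 + 1) := rfl

theorem turn_of_act {c : C} {d : Fin 4} (h : S.act c d) :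
    S.turn (c, d) = (S.nb c d, d + 3) := by
  rw [turn_apply, S.cross_of_act h, add_assoc]; rfl

theorem turn_of_not_act {c : C} {d : Fin 4} (h : ¬ S.act c d) : S.turn (c, d) = (c, d + 1) := by
  rw [turn_apply, S.cross_of_not_act h]

/-- All active walls of every cell but at most one lead to cells of larger rank. -/
def IsRanking (rank : C → ℕ) : Prop :=
  ∀ c, ∃ d₀, ∀ d ≠ d₀, S.act c d → rank c < rank (S.nb c d)

variable {S} {rank : C → ℕ}

theorem sameCycle_corners [Finite C] (hr : S.IsRanking rank) (c : C) (d d' : Fin 4) :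
    SameCycle S.turn (c, d) (c, d') := by
  obtain ⟨N, hN⟩ : ∃ N, ∀ c, rank c ≤ N := by
    obtain ⟨N, hN⟩ := (Set.finite_range rank).bddAbove
    exact ⟨N, fun c => hN ⟨c, rfl⟩⟩
  induction h : N - rank c using Nat.strong_induction_on generalizing c d d' with
  | _ j ih =>
    obtain ⟨d₀, hd₀⟩ := hr c
    have step (d : Fin 4) (hd : d ≠ d₀) : SameCycle S.turn (c, d) (c, d + 1) := by
      by_cases ha : S.act c d
      · have hlt := hd₀ d hd ha
        have h1 : SameCycle S.turn (c, d) (S.nb c d, d + 3) := ⟨1, by simp [S.turn_of_act ha]⟩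
        have h2 := ih (N - rank (S.nb c d)) (by have := hN (S.nb c d); omega)
          (S.nb c d) (d + 3) (d + 2) rfl
        have h3 : SameCycle S.turn (S.nb c d, d + 2) (c, d + 1) := by
          refine ⟨1, ?_⟩
          rw [zpow_one, S.turn_of_act (S.act_nb c d ha), S.nb_nb, add_assoc]
          rfl
        exact h1.trans (h2.trans h3)
      · exact ⟨1, by simp [S.turn_of_not_act ha]⟩
    have base (i : Fin 4) : SameCycle S.turn (c, d₀ + 1) (c, i) := by
      have h2 := step (d₀ + 1) (by simp)
      have h3 := step (d₀ + 2) (by simp)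
      have h4 := step (d₀ + 3) (by simp)
      rw [add_assoc] at h2 h3 h4
      obtain ⟨i, rfl⟩ : ∃ e, i = d₀ + e := ⟨i - d₀, by simp⟩
      fin_cases i
      · exact h2.trans (h3.trans h4)
      · exact SameCycle.refl _ _
      · exact h2
      · exact h2.trans h3
    exact (base d).symm.trans (base d')

theorem sameCycle_of_act [Finite C] (hr : S.IsRanking rank) {c : C} {d : Fin 4} (h : S.act c d)
    (i j : Fin 4) : SameCycle S.turn (c, i) (S.nb c d, j) :=
  (sameCycle_corners hr c i d).trans <|
    SameCycle.trans ⟨1, by simp [S.turn_of_act h]⟩ (sameCycle_corners hr _ (d + 3) j)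

theorem card_sameCycle_turn [Finite C] {K : Type*} {κ : C → K} {base : K → C} {k : ℕ}
    (hr : S.IsRanking rank) (hκ : ∀ c d, S.act c d → κ (S.nb c d) = κ c)
    (hbase : ∀ c, c = base (κ c) ∨ ∃ d, S.act c d ∧ rank (S.nb c d) < rank c)
    (hcard : ∀ c, Nat.card {c' // κ c' = κ c} = k) (x : C × Fin 4) :
    Nat.card {y // SameCycle S.turn x y} = 4 * k := by
  have hturn (y : C × Fin 4) : κ (S.turn y).1 = κ y.1 := by
    obtain ⟨c, d⟩ := y
    by_cases h : S.act c d
    · rw [S.turn_of_act h]; exact hκ c d h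
    · rw [S.turn_of_not_act h]
  have hpow (y : C × Fin 4) (i : ℕ) : κ ((S.turn ^ i) y).1 = κ y.1 := by
    induction i with
    | zero => rfl
    | succ i ih => rw [pow_succ', Perm.mul_apply, hturn, ih]
  have hto (c : C) (i j : Fin 4) : SameCycle S.turn (c, i) (base (κ c), j) := by
    induction h : rank c using Nat.strong_induction_on generalizing c i j with
    | _ n ih =>
      rcases hbase c with hc | ⟨d, ha, hlt⟩
      · rw [← hc]; exact sameCycle_corners hr c i j
      · rw [← hκ c d ha]
        exact (sameCycle_of_act hr ha i 0).trans (ih _ (h ▸ hlt) _ 0 j rfl)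
  have hiff (y : C × Fin 4) : SameCycle S.turn x y ↔ κ y.1 = κ x.1 := by
    constructor
    · intro h
      obtain ⟨i, rfl⟩ := h.exists_nat_pow_eq
      exact hpow x i
    · intro h
      have h1 := hto x.1 x.2 0
      rw [← h] at h1
      exact h1.trans (hto y.1 y.2 0).symm
  rw [Nat.card_congr (Equiv.subtypeEquivRight hiff),
    Nat.card_congr (Equiv.prodSubtypeFstEquivSubtypeProd (p := fun c => κ c = κ x.1)),
    Nat.card_prod, hcard, Nat.card_fin, mul_comm]

end CellSystem

section Torus

open Equiv Equiv.Perm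

/-- The cells of a toroidal grid, where `H c` merges `c` with its right neighbour and `V c`
merges `c` with its upper neighbour. The sides are numbered down, right, up, left. -/
def gridSystem {A B : Type*} [AddCommGroupWithOne A] [AddCommGroupWithOne B]
    (H V : A × B → Prop) : CellSystem (A × B) where
  nb c d := c + ![(0, -1), (1, 0), (0, 1), (-1, 0)] d
  act c d := ![V (c + (0, -1)), H c, V c, H (c + (-1, 0))] d
  nb_nb c d := by fin_cases d <;> simp [add_assoc]
  act_nb c d := by fin_cases d <;> simp [add_assoc, Prod.mk_zero_zero]

/-- Doubling, as a map from `ZMod (2 * m)` to `ZMod (4 * m)`. -/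
def double (m : ℕ) : ZMod (2 * m) →+ ZMod (4 * m) :=
  ZMod.lift (2 * m) ⟨(Int.castAddHom (ZMod (4 * m))).comp (AddMonoidHom.mulLeft 2), by
    have : ((4 * m : ℕ) : ZMod (4 * m)) = 0 := ZMod.natCast_self _
    push_cast at this
    simp only [AddMonoidHom.comp_apply, AddMonoidHom.coe_mulLeft, Int.coe_castAddHom]
    push_cast
    linear_combination this⟩

theorem double_intCast (m : ℕ) (a : ℤ) : double m a = ((2 * a : ℤ) : ZMod (4 * m)) :=
  ZMod.lift_coe _ _ _

theorem double_one (m : ℕ) : double m 1 = 2 := by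
  simpa using double_intCast m 1

theorem double_add_inj {m : ℕ} {a a' : ZMod (2 * m)} {δ δ' : ℤ} (hδ : δ = 0 ∨ δ = 1)
    (hδ' : δ' = 0 ∨ δ' = 1) (h : double m a + δ = double m a' + δ') : a = a' ∧ δ = δ' := by
  obtain ⟨a, rfl⟩ := ZMod.intCast_surjective a
  obtain ⟨a', rfl⟩ := ZMod.intCast_surjective a'
  rw [double_intCast, double_intCast, ← Int.cast_add, ← Int.cast_add,
    ZMod.intCast_eq_intCast_iff_dvd_sub] at h
  obtain ⟨t, ht⟩ := h
  rw [ZMod.intCast_eq_intCast_iff_dvd_sub]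
  push_cast at ht ⊢
  rw [show (4 * (m : ℤ) * t) = 4 * (m * t) by ring] at ht
  have h1 : a' - a = 2 * (m * t) := by omega
  exact ⟨⟨t, by rw [h1]; ring⟩, by omega⟩

theorem exists_double_add (m : ℕ) (x : ZMod (4 * m)) :
    ∃ a, ∃ δ : ℤ, (δ = 0 ∨ δ = 1) ∧ x = double m a + δ := by
  obtain ⟨x, rfl⟩ := ZMod.intCast_surjective x
  refine ⟨((x / 2 : ℤ) : ZMod (2 * m)), x % 2, by omega, ?_⟩
  rw [double_intCast, ← Int.cast_add, Int.mul_ediv_add_emod]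

variable (m n : ℕ)

/-- The corner `d` of the cell `c`; the corners are numbered counterclockwise, starting with the
lower left one. -/
def corner (x : (ZMod (2 * m) × ZMod (2 * n)) × Fin 4) : ZMod (4 * m) × ZMod (4 * n) :=
  (double m x.1.1 + (![0, 1, 1, 0] x.2 : ℤ), double n x.1.2 + (![0, 0, 1, 1] x.2 : ℤ))

theorem corner_bijective : Function.Bijective (corner m n) := by
  constructor
  · rintro ⟨⟨a, b⟩, d⟩ ⟨⟨a', b'⟩, d'⟩ h
    rw [corner, corner, Prod.mk.injEq] at h
    obtain ⟨rfl, h1⟩ := double_add_inj (by fin_cases d <;> simp) (by fin_cases d' <;> simp) h.1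
    obtain ⟨rfl, h2⟩ := double_add_inj (by fin_cases d <;> simp) (by fin_cases d' <;> simp) h.2
    have : d = d' := by
      clear h
      dsimp only at h1 h2
      revert d d'
      decide
    rw [this]
  · rintro ⟨x, y⟩
    obtain ⟨a, δ, hδ, rfl⟩ := exists_double_add m x
    obtain ⟨b, ε, hε, rfl⟩ := exists_double_add n y
    rcases hδ with rfl | rfl <;> rcases hε with rfl | rfl
    · exact ⟨((a, b), 0), by simp [corner]⟩
    · exact ⟨((a, b), 3), by simp [corner]⟩
    · exact ⟨((a, b), 1), by simp [corner]⟩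
    · exact ⟨((a, b), 2), by simp [corner]⟩

/-- The unit steps right, up, left, down. -/
def step (d : Fin 4) : ZMod (4 * m) × ZMod (4 * n) := ![(1, 0), (0, 1), (-1, 0), (0, -1)] d

variable {m n}

theorem step_add_two (d : Fin 4) : step m n (d + 2) = -step m n d := by
  fin_cases d <;> simp [step]

theorem step_injective [NeZero m] [NeZero n] : Function.Injective (step m n) := by
  have one (k : ℕ) [NeZero k] : (1 : ZMod (4 * k)) ≠ 0 := by
    have := NeZero.pos k
    rw [← Nat.cast_one, Ne, ZMod.natCast_eq_zero_iff]
    exact fun h => by have := Nat.le_of_dvd one_pos h; omega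
  have two (k : ℕ) [NeZero k] : (1 : ZMod (4 * k)) ≠ -1 := by
    have := NeZero.pos k
    rw [Ne, eq_neg_iff_add_eq_zero, one_add_one_eq_two, ← Nat.cast_two, ZMod.natCast_eq_zero_iff]
    exact fun h => by have := Nat.le_of_dvd two_pos h; omega
  have := one m
  have := one n
  have := two m
  have := two n
  intro d d' h
  fin_cases d <;> fin_cases d' <;> simp_all [step, eq_comm]

open Classical in
/-- The direction in which `CellSystem.turn` leaves a corner. -/
noncomputable def CellSystem.dir {C : Type*} (S : CellSystem C) (x : C × Fin 4) : Fin 4 :=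
  if S.act x.1 x.2 then x.2 + 3 else x.2

theorem corner_turn (H V : ZMod (2 * m) × ZMod (2 * n) → Prop)
    (x : (ZMod (2 * m) × ZMod (2 * n)) × Fin 4) :
    corner m n ((gridSystem H V).turn x) =
      corner m n x + step m n ((gridSystem H V).dir x) := by
  obtain ⟨⟨a, b⟩, d⟩ := x
  have h2 (k : ℕ) (t : ZMod (2 * k)) : double k (t + -1) = double k t - 2 := by
    rw [map_add, map_neg, double_one, sub_eq_add_neg]
  have h3 (k : ℕ) (t : ZMod (2 * k)) : double k (t + 1) = double k t + 2 := by
    rw [map_add, double_one]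
  by_cases h : (gridSystem H V).act (a, b) d
  · rw [CellSystem.turn_of_act _ h, CellSystem.dir, if_pos h]
    fin_cases d <;> simp [corner, step, gridSystem, h2, h3] <;> ring
  · rw [CellSystem.turn_of_not_act _ h, CellSystem.dir, if_neg h]
    fin_cases d <;> simp [corner, step]

theorem CellSystem.dir_eq_iff {C : Type*} (S : CellSystem C) (c : C) (d e : Fin 4) :
    S.dir (c, d) = e ↔ S.act c d ∧ d + 3 = e ∨ ¬ S.act c d ∧ d = e := by
  by_cases h : S.act c d <;> simp [dir, h]

/-- The grid system on the complementary cells, each of which has a corner in common with the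
cell of the same name: an active wall merges the complementary cells at its two ends. -/
abbrev dualSystem (H V : ZMod (2 * m) × ZMod (2 * n) → Prop) :=
  gridSystem (fun c => V (c + (1, 0))) (fun c => H (c + (0, 1)))

/-- The name, as a corner of a complementary cell, of a corner of a cell. -/
def dualCorner (x : (ZMod (2 * m) × ZMod (2 * n)) × Fin 4) :
    (ZMod (2 * m) × ZMod (2 * n)) × Fin 4 :=
  (x.1 + ![(-1, -1), (0, -1), (0, 0), (-1, 0)] x.2, x.2 + 2)

theorem corner_dualCorner (x : (ZMod (2 * m) × ZMod (2 * n)) × Fin 4) :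
    corner m n (dualCorner x) + (1, 1) = corner m n x := by
  obtain ⟨⟨a, b⟩, d⟩ := x
  have h2 (k : ℕ) (t : ZMod (2 * k)) : double k (t + -1) = double k t - 2 := by
    rw [map_add, map_neg, double_one, sub_eq_add_neg]
  fin_cases d <;> simp [corner, dualCorner, h2] <;> grind

/-- The corner to the right of, respectively above, a given corner. -/
def nextCorner (x : (ZMod (2 * m) × ZMod (2 * n)) × Fin 4) (d : Fin 2) :
    (ZMod (2 * m) × ZMod (2 * n)) × Fin 4 :=
  ![![(x.1, 1), (x.1 + (1, 0), 0), (x.1 + (1, 0), 3), (x.1, 2)] x.2,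
    ![(x.1, 3), (x.1, 2), (x.1 + (0, 1), 1), (x.1 + (0, 1), 0)] x.2] d

theorem corner_nextCorner (x : (ZMod (2 * m) × ZMod (2 * n)) × Fin 4) (d : Fin 2) :
    corner m n (nextCorner x d) = corner m n x + step m n (Fin.castLE (by simp) d) := by
  obtain ⟨⟨a, b⟩, i⟩ := x
  have h3 (k : ℕ) (t : ZMod (2 * k)) : double k (t + 1) = double k t + 2 := by
    rw [map_add, double_one]
  fin_cases d <;> fin_cases i <;> simp [corner, nextCorner, step, h3] <;> ring

theorem dir_nextCorner (H V : ZMod (2 * m) × ZMod (2 * n) → Prop)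
    (x : (ZMod (2 * m) × ZMod (2 * n)) × Fin 4) (d : Fin 2) (e : Fin 4)
    (he : e = Fin.castLE (by simp) d) :
    ((gridSystem H V).dir x = e ∨ (gridSystem H V).dir (nextCorner x d) = e + 2) ↔
      ¬ ((dualSystem H V).dir (dualCorner x) = e ∨
        (dualSystem H V).dir (dualCorner (nextCorner x d)) = e + 2) := by
  subst he
  obtain ⟨⟨a, b⟩, i⟩ := x
  fin_cases d <;> fin_cases i <;>
    simp [nextCorner, dualCorner, CellSystem.dir_eq_iff, dualSystem, gridSystem, add_assoc]

theorem cycleGraph_adj_iff_finEquiv {k : ℕ} [NeZero k] (u v : Fin (4 * k)) :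
    (cycleGraph (4 * k)).Adj u v ↔
      ZMod.finEquiv _ v = ZMod.finEquiv _ u + 1 ∨ ZMod.finEquiv _ u = ZMod.finEquiv _ v + 1 := by
  have hk := NeZero.pos k
  have key (a b : Fin (4 * k)) : (b - a).val = 1 ↔
      ZMod.finEquiv _ b = ZMod.finEquiv _ a + 1 := by
    rw [← sub_eq_iff_eq_add', ← map_sub, ← map_one (ZMod.finEquiv _),
      (ZMod.finEquiv _).injective.eq_iff, Fin.ext_iff, Fin.val_one', Nat.mod_eq_of_lt (by omega)]
  rw [cycleGraph_adj', key, key, or_comm]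

theorem boxProd_cycleGraph_adj_iff [NeZero m] [NeZero n]
    (v w : Fin (4 * m) × Fin (4 * n)) :
    (cycleGraph (4 * m) □ cycleGraph (4 * n)).Adj v w ↔ ∃ d,
      (ZMod.finEquiv _ w.1, ZMod.finEquiv _ w.2) =
        (ZMod.finEquiv _ v.1, ZMod.finEquiv _ v.2) + step m n d := by
  rw [boxProd_adj, cycleGraph_adj_iff_finEquiv, cycleGraph_adj_iff_finEquiv]
  have neg {k : ℕ} (a b : ZMod k) : a = b + -1 ↔ b = a + 1 := by
    rw [← sub_eq_add_neg, eq_sub_iff_add_eq, eq_comm]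
  simp only [Fin.exists_fin_succ]
  simp [step, neg]
  rw [eq_comm (a := v.1), eq_comm (a := v.2)]
  tauto

theorem sameCycle_permCongr {α β : Type*} (e : α ≃ β) (f : Perm α) (x y : β) :
    SameCycle (e.permCongr f) x y ↔ SameCycle f (e.symm x) (e.symm y) := by
  refine exists_congr fun i => ?_
  rw [← e.permCongrHom_coe, ← map_zpow]
  simp [Equiv.eq_symm_apply]

/-- If merging the cells across the walls given by `H` and `V` leads to clusters of `k` cells in
tree shape, both for the cells and the complementary cells, then walking around the clusters
decomposes the torus into cycles. -/
theorem cycleDecomposes_boxProd_of_turn [NeZero m] [NeZero n] {k : ℕ} (hk : 0 < k)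
    (H V : ZMod (2 * m) × ZMod (2 * n) → Prop)
    (hcell : ∀ x, Nat.card {y // SameCycle (gridSystem H V).turn x y} = 4 * k)
    (hdual : ∀ x, Nat.card {y // SameCycle (dualSystem H V).turn x y} = 4 * k) :
    CycleDecomposes (4 * k) (cycleGraph (4 * m) □ cycleGraph (4 * n)) := by
  let ψ : Fin (4 * m) × Fin (4 * n) ≃ ZMod (4 * m) × ZMod (4 * n) :=
    (ZMod.finEquiv _).toEquiv.prodCongr (ZMod.finEquiv _).toEquiv
  let E : Bool → (ZMod (2 * m) × ZMod (2 * n)) × Fin 4 ≃ Fin (4 * m) × Fin (4 * n) := fun c =>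
    ((Equiv.ofBijective _ (corner_bijective m n)).trans
      (Equiv.addRight (bif c then 0 else (1, 1)))).trans ψ.symm
  let S : Bool → CellSystem (ZMod (2 * m) × ZMod (2 * n)) := fun c =>
    bif c then gridSystem H V else dualSystem H V
  have hadj (v w) : (cycleGraph (4 * m) □ cycleGraph (4 * n)).Adj v w ↔
      ∃ d, ψ w = ψ v + step m n d := boxProd_cycleGraph_adj_iff v w
  have hE (c x) : ψ (E c x) = corner m n x + bif c then 0 else (1, 1) := by simp [E]
  have hσ (c v) : ψ ((E c).permCongr (S c).turn v) = ψ v + step m n ((S c).dir ((E c).symm v)) := by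
    obtain ⟨x, rfl⟩ := (E c).surjective v
    rw [Equiv.permCongr_apply, Equiv.symm_apply_apply, hE, hE, add_right_comm]
    obtain ⟨H', V', hS⟩ : ∃ H' V', S c = gridSystem H' V' := by
      cases c
      · exact ⟨fun c => V (c + (1, 0)), fun c => H (c + (0, 1)), rfl⟩
      · exact ⟨H, V, rfl⟩
    rw [hS, corner_turn]
  refine cycleDecomposes_of_perms (by omega) (fun c => (E c).permCongr (S c).turn) ?_ ?_ ?_
  · intro c v
    have := fun w => sameCycle_permCongr (E c) (S c).turn v w
    rw [Nat.card_congr (Equiv.subtypeEquiv (E c).symm this)]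
    cases c
    · exact hdual _
    · exact hcell _
  · exact fun c v => (hadj _ _).2 ⟨_, hσ c v⟩
  · have main (v w) (d : Fin 2) (h : ψ w = ψ v + step m n (Fin.castLE (by simp) d)) :
        ∃! c, (E c).permCongr (S c).turn v = w ∨ (E c).permCongr (S c).turn w = v := by
      set e : Fin 4 := Fin.castLE (by simp) d with he
      have h' : ψ v = ψ w + step m n (e + 2) := by rw [h, step_add_two]; simp
      have h1 (c) : (E c).permCongr (S c).turn v = w ↔ (S c).dir ((E c).symm v) = e := by
        rw [← ψ.injective.eq_iff, hσ, h, add_right_inj, step_injective.eq_iff]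
      have h2 (c) : (E c).permCongr (S c).turn w = v ↔ (S c).dir ((E c).symm w) = e + 2 := by
        rw [← ψ.injective.eq_iff, hσ, h', add_right_inj, step_injective.eq_iff]
      simp only [h1, h2]
      obtain ⟨x, rfl⟩ := (E true).surjective v
      have hw : w = E true (nextCorner x d) := by
        rw [← ψ.injective.eq_iff, h, hE, hE, corner_nextCorner, he, add_right_comm]
      have hd (x) : (E false).symm (E true x) = dualCorner x := by
        rw [Equiv.symm_apply_eq, ← ψ.injective.eq_iff, hE, hE]
        simpa using (corner_dualCorner x).symm
      have key := dir_nextCorner H V x d e he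
      subst hw
      have hf : (S false).dir ((E false).symm (E true x)) = e ∨
          (S false).dir ((E false).symm (E true (nextCorner x d))) = e + 2 ↔
          ((dualSystem H V).dir (dualCorner x) = e ∨
        (dualSystem H V).dir (dualCorner (nextCorner x d)) = e + 2) := by rw [hd, hd]; rfl
      have ht : (S true).dir ((E true).symm (E true x)) = e ∨
          (S true).dir ((E true).symm (E true (nextCorner x d))) = e + 2 ↔
          ((gridSystem H V).dir x = e ∨
        (gridSystem H V).dir (nextCorner x d) = e + 2) := by
        rw [Equiv.symm_apply_apply, Equiv.symm_apply_apply]; rfl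
      by_cases hb : ((dualSystem H V).dir (dualCorner x) = e ∨
        (dualSystem H V).dir (dualCorner (nextCorner x d)) = e + 2)
      · refine ⟨false, hf.2 hb, fun c hc => ?_⟩
        cases c
        · rfl
        · exact absurd hb (key.1 (ht.1 hc))
      · refine ⟨true, ht.2 (key.2 hb), fun c hc => ?_⟩
        cases c
        · exact absurd (hf.1 hc) hb
        · rfl
    have symm {v w}
        (h : ∃! c, (E c).permCongr (S c).turn v = w ∨ (E c).permCongr (S c).turn w = v) :
        ∃! c, (E c).permCongr (S c).turn w = v ∨ (E c).permCongr (S c).turn v = w := by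
      obtain ⟨c, hc, hu⟩ := h
      exact ⟨c, hc.symm, fun c' h' => hu c' h'.symm⟩
    intro v w hvw
    obtain ⟨d, hd⟩ := (hadj v w).1 hvw
    have hd' : ψ v = ψ w + step m n (d + 2) := by rw [hd, step_add_two]; simp
    fin_cases d
    · exact main v w 0 hd
    · exact main v w 1 hd
    · exact symm (main w v 0 hd')
    · exact symm (main w v 1 hd')

end Torus

namespace CellSystem

open Equiv Equiv.Perm

variable {C K : Type*} (S : CellSystem C) {x y : ℕ}

/-- A cluster consists of `y` paths of `x` cells each; every path but the first one is joined, at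
its cell number `a`, to the preceding one. -/
theorem card_sameCycle_turn_of_combs [Finite C] [NeZero y] (e : C ≃ K × Fin y × Fin x)
    (a : K → Fin x)
    (h : ∀ c, ∃ dS dP dI,
      (∀ d, S.act c d → (e (S.nb c d)).1 = (e c).1 ∧
        (d = dS ∧ ((e (S.nb c d)).2.1 : ℕ) = (e c).2.1 ∧
            ((e (S.nb c d)).2.2 : ℕ) = (e c).2.2 + 1 ∨
          d = dP ∧ ((e (S.nb c d)).2.1 : ℕ) = (e c).2.1 ∧
            ((e (S.nb c d)).2.2 : ℕ) + 1 = (e c).2.2 ∨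
          ((e (S.nb c d)).2.1 : ℕ) = (e c).2.1 + 1 ∧ (e (S.nb c d)).2.2 = a (e c).1 ∨
          d = dI ∧ ((e (S.nb c d)).2.1 : ℕ) + 1 = (e c).2.1 ∧ (e c).2.2 = a (e c).1)) ∧
      (((e c).2.2 : ℕ) + 1 < x → S.act c dS ∧ (e (S.nb c dS)).2.1 = (e c).2.1 ∧
        ((e (S.nb c dS)).2.2 : ℕ) = (e c).2.2 + 1) ∧
      (((e c).2.2 : ℕ) ≠ 0 → S.act c dP ∧ (e (S.nb c dP)).2.1 = (e c).2.1 ∧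
        ((e (S.nb c dP)).2.2 : ℕ) + 1 = (e c).2.2) ∧
      (((e c).2.1 : ℕ) ≠ 0 → (e c).2.2 = a (e c).1 → S.act c dI ∧
        ((e (S.nb c dI)).2.1 : ℕ) + 1 = (e c).2.1))
    (z : C × Fin 4) : Nat.card {w // SameCycle S.turn z w} = 4 * (y * x) := by
  have hκ (c d) (hd : S.act c d) : (e (S.nb c d)).1 = (e c).1 := by
    obtain ⟨dS, dP, dI, h1, -⟩ := h c
    exact (h1 d hd).1
  let rank (c : C) : ℕ :=
    (e c).2.1 * x + (((e c).2.2 - a (e c).1 : ℕ) + (a (e c).1 - (e c).2.2 : ℕ))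
  have hrank (c) : rank c =
    (e c).2.1 * x + (((e c).2.2 - a (e c).1 : ℕ) + (a (e c).1 - (e c).2.2 : ℕ)) := rfl
  have hranking : S.IsRanking rank := by
    intro c
    obtain ⟨dS, dP, dI, h1, -⟩ := h c
    refine ⟨if (e c).2.2 < a (e c).1 then dS else if a (e c).1 < (e c).2.2 then dP else dI,
      fun d hd0 hd => ?_⟩
    obtain ⟨hk, h2⟩ := h1 d hd
    have hl := (e c).2.2.2
    have ha := (a (e c).1).2
    simp only [hrank, hk]
    simp only [Fin.lt_def] at hd0
    rcases h2 with ⟨rfl, h2, h3⟩ | ⟨rfl, h2, h3⟩ | ⟨h2, h3⟩ | ⟨rfl, h2, h3⟩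
    · have : ¬ ((e c).2.2 : ℕ) < a (e c).1 := fun hlt => hd0 (by simp [hlt])
      rw [h2]; omega
    · have : ¬ (a (e c).1 : ℕ) < (e c).2.2 := fun hlt => hd0 (by
        rw [if_neg (by omega), if_pos hlt])
      rw [h2]; omega
    · rw [h2, h3, add_mul]; omega
    · exact absurd (by rw [if_neg (by simp [h3]), if_neg (by simp [h3])]) hd0
  refine card_sameCycle_turn (κ := fun c => (e c).1) (base := fun k => e.symm (k, 0, a k))
    hranking hκ (fun c => ?_) (fun c => ?_) z
  · obtain ⟨dS, dP, dI, -, h1, h2, h3⟩ := h c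
    have hl := (e c).2.2.2
    have ha := (a (e c).1).2
    rcases lt_trichotomy ((e c).2.2 : ℕ) (a (e c).1) with hlt | heq | hgt
    · obtain ⟨hd, h4, h5⟩ := h1 (by omega)
      refine Or.inr ⟨dS, hd, ?_⟩
      rw [hrank, hrank, hκ c dS hd, h4]
      omega
    · by_cases hr : ((e c).2.1 : ℕ) = 0
      · left
        rw [Equiv.eq_symm_apply]
        exact Prod.ext rfl (Prod.ext (Fin.ext hr) (Fin.ext heq))
      · obtain ⟨hd, h4⟩ := h3 hr (Fin.ext heq)
        refine Or.inr ⟨dI, hd, ?_⟩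
        have := (e (S.nb c dI)).2.2.2
        rw [hrank, hrank, hκ c dI hd, ← h4, add_mul]
        omega
    · obtain ⟨hd, h4, h5⟩ := h2 (by omega)
      refine Or.inr ⟨dP, hd, ?_⟩
      rw [hrank, hrank, hκ c dP hd, h4]
      omega
  · have e' : {c' // (e c').1 = (e c).1} ≃ {k // k = (e c).1} × (Fin y × Fin x) :=
      (e.subtypeEquiv fun _ => Iff.rfl).trans
        (Equiv.prodSubtypeFstEquivSubtypeProd (p := fun k => k = (e c).1))
    rw [Nat.card_congr e']
    simp

end CellSystem

section Staircase

open Equiv Equiv.Perm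

/-- The cell number `p` of the staircase number `s`; each staircase alternates between steps to
the right and upwards. -/
def cellAt (m n : ℕ) (s p : ℤ) : ZMod (2 * m) × ZMod (2 * n) :=
  ((s + (p + 1) / 2 : ℤ), (p / 2 - s : ℤ))

variable {m n : ℕ} {s p s' p' : ℤ}

theorem cellAt_add (m n : ℕ) (s p u v : ℤ) (hs : s' + (p' + 1) / 2 = s + (p + 1) / 2 + u)
    (hp : p' / 2 - s' = p / 2 - s + v) :
    cellAt m n s p + ((u : ZMod (2 * m)), (v : ZMod (2 * n))) = cellAt m n s' p' := by
  rw [cellAt, cellAt, hs, hp, Int.cast_add _ u, Int.cast_add _ v, Prod.mk_add_mk]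

theorem cellAt_right_of_even (hp : p % 2 = 0) :
    cellAt m n s p + (1, 0) = cellAt m n s (p + 1) := by
  simpa using cellAt_add m n s p 1 0 (s' := s) (p' := p + 1) (by omega) (by omega)

theorem cellAt_right_of_odd (hp : p % 2 = 1) :
    cellAt m n s p + (1, 0) = cellAt m n (s + 1) (p + 1) := by
  simpa using cellAt_add m n s p 1 0 (s' := s + 1) (p' := p + 1) (by omega) (by omega)

theorem cellAt_up_of_odd (hp : p % 2 = 1) :
    cellAt m n s p + (0, 1) = cellAt m n s (p + 1) := by
  simpa using cellAt_add m n s p 0 1 (s' := s) (p' := p + 1) (by omega) (by omega)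

theorem cellAt_up_of_even (hp : p % 2 = 0) :
    cellAt m n s p + (0, 1) = cellAt m n (s - 1) (p + 1) := by
  simpa using cellAt_add m n s p 0 1 (s' := s - 1) (p' := p + 1) (by omega) (by omega)

theorem cellAt_left_of_odd (hp : p % 2 = 1) :
    cellAt m n s p + (-1, 0) = cellAt m n s (p - 1) := by
  simpa using cellAt_add m n s p (-1) 0 (s' := s) (p' := p - 1) (by omega) (by omega)

theorem cellAt_left_of_even (hp : p % 2 = 0) :
    cellAt m n s p + (-1, 0) = cellAt m n (s - 1) (p - 1) := by
  simpa using cellAt_add m n s p (-1) 0 (s' := s - 1) (p' := p - 1) (by omega) (by omega)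

theorem cellAt_down_of_even (hp : p % 2 = 0) :
    cellAt m n s p + (0, -1) = cellAt m n s (p - 1) := by
  simpa using cellAt_add m n s p 0 (-1) (s' := s) (p' := p - 1) (by omega) (by omega)

theorem cellAt_down_of_odd (hp : p % 2 = 1) :
    cellAt m n s p + (0, -1) = cellAt m n (s + 1) (p - 1) := by
  simpa using cellAt_add m n s p 0 (-1) (s' := s + 1) (p' := p - 1) (by omega) (by omega)

theorem dvd_of_cellAt_eq (h : cellAt m n s p = cellAt m n s' p') :
    ((m.gcd n : ℕ) : ℤ) ∣ s' - s ∧ p' % 2 = p % 2 ∧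
      (s' = s → ((4 * m.lcm n : ℕ) : ℤ) ∣ p' - p) := by
  rw [cellAt, cellAt, Prod.mk.injEq, ZMod.intCast_eq_intCast_iff_dvd_sub,
    ZMod.intCast_eq_intCast_iff_dvd_sub] at h
  obtain ⟨⟨a, ha⟩, ⟨b, hb⟩⟩ := h
  push_cast at ha hb
  rw [mul_assoc] at ha hb
  have hp : p' % 2 = p % 2 := by omega
  refine ⟨?_, hp, fun hs => ?_⟩
  · have h1 : s' - s = m * a - n * b := by omega
    rw [h1]
    exact dvd_sub ((Int.natCast_dvd_natCast.2 (Nat.gcd_dvd_left m n)).mul_right a)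
      ((Int.natCast_dvd_natCast.2 (Nat.gcd_dvd_right m n)).mul_right b)
  · have h1 : p' - p = 4 * (m * a) := by omega
    have h2 : (m : ℤ) * a = n * b := by omega
    rw [h1, Nat.cast_mul]
    refine mul_dvd_mul_left 4 ?_
    exact Int.natCast_dvd.2 (Nat.lcm_dvd (Int.natCast_dvd.1 (dvd_mul_right _ _))
      (Int.natCast_dvd.1 (h2 ▸ dvd_mul_right _ _)))

theorem eq_and_dvd_of_cellAt_eq (hs : 0 ≤ s) (hs1 : s < m.gcd n) (hs' : 0 ≤ s')
    (hs1' : s' < m.gcd n) (h : cellAt m n s p = cellAt m n s' p') :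
    s' = s ∧ p' % 2 = p % 2 ∧ ((4 * m.lcm n : ℕ) : ℤ) ∣ p' - p := by
  obtain ⟨h1, h2, h3⟩ := dvd_of_cellAt_eq h
  have : s' = s := by
    have := Int.eq_zero_of_abs_lt_dvd h1 (by rw [abs_lt]; omega)
    omega
  exact ⟨this, h2, h3 this⟩

theorem dvd_mul_add_iff_of_le {x j u : ℤ} (h1 : -x < u) (h2 : u ≤ x) :
    x ∣ j * x + u ↔ u = 0 ∨ u = x := by
  rw [Int.dvd_add_right (dvd_mul_left x j)]
  constructor
  · intro h
    rcases eq_or_lt_of_le h2 with h2 | h2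
    · exact Or.inr h2
    · exact Or.inl (Int.eq_zero_of_abs_lt_dvd h (by rw [abs_lt]; omega))
  · rintro (rfl | rfl) <;> simp

theorem mul_add_inj {x q q' r r' : ℕ} (hr : r < x) (hr' : r' < x)
    (h : q * x + r = q' * x + r') : q = q' ∧ r = r' := by
  have h1 : q = q' := by
    have := congrArg (· / x) h
    simpa [mul_comm _ x, Nat.mul_add_div (Nat.zero_lt_of_lt hr), Nat.div_eq_of_lt, hr, hr']
      using this
  subst h1
  exact ⟨rfl, by omega⟩

variable {x y G J : ℕ}

theorem bijective_cellAt [NeZero m] [NeZero n] (hG : m.gcd n = G * y) (hJ : 4 * m.lcm n = J * x)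
    (t : ℤ) : Function.Bijective fun i : (Fin G × Fin J) × Fin y × Fin x =>
      cellAt m n (i.1.1 * y + i.2.1 : ℕ) ((i.1.2 * x + i.2.2 : ℕ) + t) := by
  have : NeZero (2 * m) := ⟨by simp [NeZero.ne m]⟩
  have : NeZero (2 * n) := ⟨by simp [NeZero.ne n]⟩
  have lt {a b c d : ℕ} (h1 : a < b) (h2 : c < d) : a * d + c < b * d := by
    calc a * d + c < a * d + d := by omega
      _ = (a + 1) * d := by ring
      _ ≤ b * d := Nat.mul_le_mul_right d h1
  rw [Fintype.bijective_iff_injective_and_card]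
  constructor
  · rintro ⟨⟨q, j⟩, r, l⟩ ⟨⟨q', j'⟩, r', l'⟩ h
    dsimp only at h
    have h1 := lt q.2 r.2
    have h2 := lt q'.2 r'.2
    have h3 := lt j.2 l.2
    have h4 := lt j'.2 l'.2
    obtain ⟨hs, -, hp⟩ := eq_and_dvd_of_cellAt_eq (by omega) (by omega) (by omega) (by omega) h
    obtain ⟨hq, hr⟩ := mul_add_inj r'.2 r.2 (Int.ofNat.inj hs)
    have h5 : (j' * x + l' : ℕ) = j * x + l := by
      have := Int.eq_zero_of_abs_lt_dvd hp (by rw [abs_lt]; omega)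
      omega
    obtain ⟨hj, hl⟩ := mul_add_inj l'.2 l.2 h5
    exact Prod.ext (Prod.ext (Fin.ext hq.symm) (Fin.ext hj.symm))
      (Prod.ext (Fin.ext hr.symm) (Fin.ext hl.symm))
  · simp only [Fintype.card_prod, Fintype.card_fin, ZMod.card]
    calc G * J * (y * x) = G * y * (J * x) := by ring
      _ = 4 * (m.gcd n * m.lcm n) := by rw [← hG, ← hJ]; ring
      _ = _ := by rw [Nat.gcd_mul_lcm]; ring

/-- Staircases are cut into paths of length `x`, and `y` consecutive ones of these form a
cluster. -/
theorem card_sameCycle_turn_of_staircases [NeZero m] [NeZero n] (hG : m.gcd n = G * y)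
    (hJ : 4 * m.lcm n = J * x) (hy : 0 < y) (S : CellSystem (ZMod (2 * m) × ZMod (2 * n))) (t : ℤ)
    (a : ℕ → ℕ) (ha : ∀ j, a j < x)
    (h : ∀ q j r l s p c, q < G → r < y → l < x → s = ((q * y + r : ℕ) : ℤ) →
      p = ((j * x + l : ℕ) : ℤ) → c = cellAt m n s (p + t) →
      ∃ dS dP dI dO : Fin 4, (∀ d, d = dS ∨ d = dP ∨ d = dI ∨ d = dO) ∧
        (S.nb c dS = cellAt m n s (p + t + 1) ∧ (S.act c dS ↔ l + 1 < x)) ∧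
        (S.nb c dP = cellAt m n s (p + t - 1) ∧ (S.act c dP ↔ l ≠ 0)) ∧
        ((S.act c dI ↔ r ≠ 0 ∧ l = a j) ∧ (S.act c dI →
          ∃ l' < x, S.nb c dI = cellAt m n (s - 1) ((j * x + l' : ℕ) + t))) ∧
        (S.act c dO → r + 1 < y ∧ S.nb c dO = cellAt m n (s + 1) ((j * x + a j : ℕ) + t)))
    (z : (ZMod (2 * m) × ZMod (2 * n)) × Fin 4) :
    Nat.card {w // SameCycle S.turn z w} = 4 * (y * x) := by
  have : NeZero (2 * m) := ⟨by simp [NeZero.ne m]⟩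
  have : NeZero (2 * n) := ⟨by simp [NeZero.ne n]⟩
  have : NeZero y := ⟨hy.ne'⟩
  let F := Equiv.ofBijective _ (bijective_cellAt hG hJ t)
  have hF (q j r l) : F ((q, j), r, l) =
    cellAt m n (q * y + r : ℕ) ((j * x + l : ℕ) + t) := rfl
  refine CellSystem.card_sameCycle_turn_of_combs S F.symm (fun k => ⟨a k.2, ha k.2⟩)
    (fun c => ?_) z
  obtain ⟨⟨⟨q, j⟩, r, l⟩, rfl⟩ := F.surjective c
  rw [F.symm_apply_apply]
  obtain ⟨dS, dP, dI, dO, hd, ⟨hS, hS'⟩, ⟨hP, hP'⟩, ⟨hI', hI⟩, hO⟩ :=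
    h q j r l _ _ _ q.2 r.2 l.2 rfl rfl (hF q j r l)
  generalize F ((q, j), r, l) = c at *
  dsimp only
  have hS (hl : (l : ℕ) + 1 < x) : F.symm (S.nb c dS) = ((q, j), r, ⟨l + 1, hl⟩) := by
    rw [Equiv.symm_apply_eq, hF, hS]
    congr 1
    push_cast
    ring
  have hP (hl : (l : ℕ) ≠ 0) : F.symm (S.nb c dP) = ((q, j), r, ⟨l - 1, by omega⟩) := by
    rw [Equiv.symm_apply_eq, hF, hP]
    congr 1
    dsimp only
    omega
  have hI (hi : S.act c dI) :
      ∃ l', F.symm (S.nb c dI) = ((q, j), ⟨r - 1, by omega⟩, l') := by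
    obtain ⟨l', hl', hI⟩ := hI hi
    refine ⟨⟨l', hl'⟩, ?_⟩
    rw [Equiv.symm_apply_eq, hF, hI]
    congr 1
    have := hI'.1 hi
    dsimp only
    omega
  have hO (ho : S.act c dO) : ∃ hr : (r : ℕ) + 1 < y,
      F.symm (S.nb c dO) = ((q, j), ⟨r + 1, hr⟩, ⟨a j, ha j⟩) := by
    obtain ⟨hr, hO⟩ := hO ho
    refine ⟨hr, ?_⟩
    rw [Equiv.symm_apply_eq, hF, hO]
    rfl
  refine ⟨dS, dP, dI, fun d hact => ?_, fun hl => ?_, fun hl => ?_, fun hr hl => ?_⟩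
  · rcases hd d with rfl | rfl | rfl | rfl
    · rw [hS (hS'.1 hact)]
      simp
    · have := hP'.1 hact
      rw [hP this]
      refine ⟨rfl, Or.inr (Or.inl ⟨rfl, rfl, ?_⟩)⟩
      dsimp only
      omega
    · obtain ⟨l', hl'⟩ := hI hact
      have := hI'.1 hact
      rw [hl']
      refine ⟨rfl, Or.inr (Or.inr (Or.inr ⟨rfl, ?_, Fin.ext this.2⟩))⟩
      dsimp only
      omega
    · obtain ⟨hr, hO⟩ := hO hact
      rw [hO]
      exact ⟨rfl, Or.inr (Or.inr (Or.inl ⟨rfl, rfl⟩))⟩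
  · rw [hS hl]
    exact ⟨hS'.2 hl, rfl, rfl⟩
  · rw [hP hl]
    refine ⟨hP'.2 hl, rfl, ?_⟩
    dsimp only
    omega
  · have hact := hI'.2 ⟨hr, congrArg Fin.val hl⟩
    obtain ⟨l', hl'⟩ := hI hact
    rw [hl']
    refine ⟨hact, ?_⟩
    dsimp only
    omega

/-- The horizontal walls to be removed: staircases are cut every `x` cells. -/
def wallV (m n x : ℕ) (c : ZMod (2 * m) × ZMod (2 * n)) : Prop :=
  ∃ s p : ℤ, (0 ≤ s ∧ s < m.gcd n) ∧ c = cellAt m n s p ∧ p % 2 = 1 ∧ ¬ (x : ℤ) ∣ p + 1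

/-- The vertical walls to be removed: staircases are cut every `x` cells, and groups of `y`
consecutive staircases are joined near these cuts. -/
def wallH (m n x y : ℕ) (c : ZMod (2 * m) × ZMod (2 * n)) : Prop :=
  ∃ s p : ℤ, (0 ≤ s ∧ s < m.gcd n) ∧ c = cellAt m n s p ∧ (p % 2 = 0 ∧ ¬ (x : ℤ) ∣ p + 1 ∨
    p % 2 = 1 ∧ ¬ (y : ℤ) ∣ s + 1 ∧ ((x : ℤ) ∣ p ∨ (x : ℤ) ∣ p - 1))

theorem dvd_add_iff_of_dvd_sub {x L u : ℤ} (hx : x ∣ L) (h : L ∣ p' - p) :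
    x ∣ p' + u ↔ x ∣ p + u := by
  rw [show p' + u = (p' - p) + (p + u) by ring, Int.dvd_add_right (hx.trans h)]

theorem wallV_of_odd (hx : x ∣ 4 * m.lcm n) (hs : 0 ≤ s) (hs' : s < m.gcd n) (hp : p % 2 = 1) :
    wallV m n x (cellAt m n s p) ↔ ¬ (x : ℤ) ∣ p + 1 := by
  constructor
  · rintro ⟨s', p', ⟨h1, h2⟩, h, -, h3⟩
    obtain ⟨-, -, h4⟩ := eq_and_dvd_of_cellAt_eq hs hs' h1 h2 h
    rwa [dvd_add_iff_of_dvd_sub (Int.natCast_dvd_natCast.2 hx) h4] at h3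
  · exact fun h => ⟨s, p, ⟨hs, hs'⟩, rfl, hp, h⟩

theorem not_wallV_of_even (hp : p % 2 = 0) : ¬ wallV m n x (cellAt m n s p) := by
  rintro ⟨s', p', -, h, hp', -⟩
  have := (dvd_of_cellAt_eq h).2.1
  omega

theorem wallH_of_even (hx : x ∣ 4 * m.lcm n) (hs : 0 ≤ s) (hs' : s < m.gcd n) (hp : p % 2 = 0) :
    wallH m n x y (cellAt m n s p) ↔ ¬ (x : ℤ) ∣ p + 1 := by
  constructor
  · rintro ⟨s', p', ⟨h1, h2⟩, h, ⟨-, h3⟩ | ⟨h3, -⟩⟩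
    · obtain ⟨-, -, h4⟩ := eq_and_dvd_of_cellAt_eq hs hs' h1 h2 h
      rwa [dvd_add_iff_of_dvd_sub (Int.natCast_dvd_natCast.2 hx) h4] at h3
    · have := (dvd_of_cellAt_eq h).2.1
      omega
  · exact fun h => ⟨s, p, ⟨hs, hs'⟩, rfl, Or.inl ⟨hp, h⟩⟩

theorem wallH_of_odd (hx : x ∣ 4 * m.lcm n) (hy : y ∣ m.gcd n) (hs : -1 ≤ s) (hs' : s < m.gcd n)
    (hp : p % 2 = 1) : wallH m n x y (cellAt m n s p) ↔
      ¬ (y : ℤ) ∣ s + 1 ∧ ((x : ℤ) ∣ p ∨ (x : ℤ) ∣ p - 1) := by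
  constructor
  · rintro ⟨s', p', ⟨h1, h2⟩, h, ⟨h3, -⟩ | ⟨-, h3, h4⟩⟩
    · have := (dvd_of_cellAt_eq h).2.1
      omega
    · have hy' : ¬ (y : ℤ) ∣ s + 1 := by
        rwa [dvd_add_iff_of_dvd_sub (Int.natCast_dvd_natCast.2 hy) (dvd_of_cellAt_eq h).1] at h3
      have hs0 : 0 ≤ s := by
        by_contra hlt
        exact hy' (by rw [show s + 1 = 0 by omega]; exact dvd_zero _)
      obtain ⟨-, -, h5⟩ := eq_and_dvd_of_cellAt_eq hs0 hs' h1 h2 h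
      have key := fun u => dvd_add_iff_of_dvd_sub (u := u) (Int.natCast_dvd_natCast.2 hx) h5
      refine ⟨hy', ?_⟩
      rwa [sub_eq_add_neg, key, ← add_zero p', key, add_zero, ← sub_eq_add_neg] at h4
  · rintro ⟨h1, h2⟩
    refine ⟨s, p, ⟨?_, hs'⟩, rfl, Or.inr ⟨hp, h1, h2⟩⟩
    by_contra hlt
    exact h1 (by rw [show s + 1 = 0 by omega]; exact dvd_zero _)

theorem dvd_staircase {q j r l : ℕ} (hG : m.gcd n = G * y) (hq : q < G) (hr : r < y) (hl : l < x)
    (hs : s = ((q * y + r : ℕ) : ℤ)) (hp : p = ((j * x + l : ℕ) : ℤ)) :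
    0 ≤ s ∧ s < m.gcd n ∧ ((y : ℤ) ∣ s + 1 ↔ r + 1 = y) ∧ ((y : ℤ) ∣ s ↔ r = 0) ∧
      ((x : ℤ) ∣ p + 1 ↔ l + 1 = x) ∧ ((x : ℤ) ∣ p ↔ l = 0) ∧
      (3 ≤ x → ((x : ℤ) ∣ p - 1 ↔ l = 1)) ∧ (3 ≤ x → ((x : ℤ) ∣ p - 1 - 1 ↔ l = 2)) := by
  have hs0 : 0 ≤ s := by omega
  have hsg : s < m.gcd n := by
    have := Nat.mul_le_mul_right y hq
    rw [Nat.succ_mul] at this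
    omega
  have hsy : (y : ℤ) ∣ s + 1 ↔ r + 1 = y := by
    rw [hs, Nat.cast_add, Nat.cast_mul, add_assoc, dvd_mul_add_iff_of_le (by omega) (by omega)]
    omega
  have hsy' : (y : ℤ) ∣ s ↔ r = 0 := by
    rw [hs, Nat.cast_add, Nat.cast_mul, dvd_mul_add_iff_of_le (by omega) (by omega)]
    omega
  have hpx (u : ℤ) (h1 : -x < l + u) (h2 : l + u ≤ x) :
      (x : ℤ) ∣ p + u ↔ l + u = 0 ∨ l + u = x := by
    rw [hp, Nat.cast_add, Nat.cast_mul, add_assoc, dvd_mul_add_iff_of_le (by omega) (by omega)]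
  have hx1 : (x : ℤ) ∣ p + 1 ↔ l + 1 = x := by rw [hpx 1 (by omega) (by omega)]; omega
  have hx0 : (x : ℤ) ∣ p ↔ l = 0 := by have := hpx 0 (by omega) (by omega); simp at this; omega
  have hxm1 (h : 3 ≤ x) : (x : ℤ) ∣ p - 1 ↔ l = 1 := by
    rw [sub_eq_add_neg, hpx (-1) (by omega) (by omega)]; omega
  have hxm2 (h : 3 ≤ x) : (x : ℤ) ∣ p - 1 - 1 ↔ l = 2 := by
    rw [sub_sub, sub_eq_add_neg, hpx (-(1 + 1)) (by omega) (by omega)]; omega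
  exact ⟨hs0, hsg, hsy, hsy', hx1, hx0, hxm1, hxm2⟩

variable [NeZero m] [NeZero n]

theorem card_sameCycle_turn_gridSystem (hG : m.gcd n = G * y) (hJ : 4 * m.lcm n = J * x)
    (hy : 0 < y) (hx : 0 < x) (hxy : y = 1 ∨ 3 ≤ x)
    (z : (ZMod (2 * m) × ZMod (2 * n)) × Fin 4) :
    Nat.card {w // SameCycle (gridSystem (wallH m n x y) (wallV m n x)).turn z w} =
      4 * (y * x) := by
  have hxL : x ∣ 4 * m.lcm n := hJ ▸ dvd_mul_left _ _
  have hyg : y ∣ m.gcd n := hG ▸ dvd_mul_left _ _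
  refine card_sameCycle_turn_of_staircases hG hJ hy _ 0
    (fun j => if 3 ≤ x then (j * x + 1) % 2 + 1 else 0) (fun j => by split_ifs <;> omega) ?_ z
  intro q j r l s p c hq hr hl hs hp hc
  obtain ⟨hs0, hsg, hsy, hsy', hx1, hx0, hxm1, hxm2⟩ := dvd_staircase hG hq hr hl hs hp
  rw [add_zero] at hc ⊢
  subst hc
  dsimp only [gridSystem]
  generalize j * x = b at *
  rcases Int.emod_two_eq_zero_or_one p with hp2 | hp2
  · have hin : wallH m n x y (cellAt m n s p + (-1, 0)) ↔
        r ≠ 0 ∧ l = if 3 ≤ x then (b + 1) % 2 + 1 else 0 := by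
      rw [cellAt_left_of_even hp2, wallH_of_odd hxL hyg (by omega) (by omega) (by omega),
        sub_add_cancel, hsy']
      refine and_congr_right fun hr0 => ?_
      have h3 : 3 ≤ x := by omega
      rw [hxm1 h3, hxm2 h3, if_pos h3]
      omega
    refine ⟨1, 0, 3, 2, by decide, ⟨cellAt_right_of_even hp2, ?_⟩, ⟨cellAt_down_of_even hp2, ?_⟩,
      ⟨?_, ?_⟩, ?_⟩
    · change wallH m n x y _ ↔ _
      rw [wallH_of_even hxL hs0 hsg hp2, hx1]
      omega
    · change wallV m n x (_ + (0, -1)) ↔ _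
      rw [cellAt_down_of_even hp2, wallV_of_odd hxL hs0 hsg (by omega), sub_add_cancel, hx0]
    · exact hin
    · intro h
      obtain ⟨hr0, hl1⟩ := hin.1 h
      rw [if_pos (by omega)] at hl1
      refine ⟨l - 1, by omega, (cellAt_left_of_even hp2).trans ?_⟩
      congr 1
      omega
    · exact fun h => absurd h (not_wallV_of_even hp2)
  · refine ⟨2, 3, 0, 1, by decide, ⟨cellAt_up_of_odd hp2, ?_⟩, ⟨cellAt_left_of_odd hp2, ?_⟩,
      ⟨?_, ?_⟩, ?_⟩
    · change wallV m n x _ ↔ _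
      rw [wallV_of_odd hxL hs0 hsg hp2, hx1]
      omega
    · change wallH m n x y (_ + (-1, 0)) ↔ _
      rw [cellAt_left_of_odd hp2, wallH_of_even hxL hs0 hsg (by omega), sub_add_cancel, hx0]
    · change wallV m n x (_ + (0, -1)) ↔ _
      rw [cellAt_down_of_odd hp2]
      refine iff_of_false (not_wallV_of_even (by omega)) fun ⟨hr0, hl1⟩ => ?_
      rw [if_pos (by omega)] at hl1
      omega
    · change wallV m n x (_ + (0, -1)) → _
      rw [cellAt_down_of_odd hp2]
      exact fun h => absurd h (not_wallV_of_even (by omega))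
    · change wallH m n x y _ → _
      rw [wallH_of_odd hxL hyg (by omega) hsg hp2, hsy, hx0]
      rintro ⟨hr1, hl1⟩
      have h3 : 3 ≤ x := by omega
      rw [hxm1 h3] at hl1
      refine ⟨by omega, (cellAt_right_of_odd hp2).trans ?_⟩
      rw [if_pos h3]
      congr 1
      omega

theorem card_sameCycle_turn_dualSystem (hG : m.gcd n = G * y) (hJ : 4 * m.lcm n = J * x)
    (hy : 0 < y) (hx : 0 < x) (hxy : y = 1 ∨ 3 ≤ x)
    (z : (ZMod (2 * m) × ZMod (2 * n)) × Fin 4) :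
    Nat.card {w // SameCycle (dualSystem (wallH m n x y) (wallV m n x)).turn z w} =
      4 * (y * x) := by
  have hxL : x ∣ 4 * m.lcm n := hJ ▸ dvd_mul_left _ _
  have hyg : y ∣ m.gcd n := hG ▸ dvd_mul_left _ _
  refine card_sameCycle_turn_of_staircases hG hJ hy _ (-1)
    (fun j => if 3 ≤ x then (j * x + 1) % 2 else 0) (fun j => by split_ifs <;> omega) ?_ z
  intro q j r l s p c hq hr hl hs hp hc
  obtain ⟨hs0, hsg, hsy, hsy', hx1, hx0, hxm1, hxm2⟩ := dvd_staircase hG hq hr hl hs hp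
  rw [← sub_eq_add_neg] at hc ⊢
  rw [sub_add_cancel]
  subst hc
  have hact0 (c : ZMod (2 * m) × ZMod (2 * n)) : c + (0, -1) + (0, 1) = c := by
    simp [add_assoc]
  have hact3 (c : ZMod (2 * m) × ZMod (2 * n)) : c + (-1, 0) + (1, 0) = c := by
    simp [add_assoc]
  dsimp only [dualSystem, gridSystem]
  generalize j * x = b at *
  rcases Int.emod_two_eq_zero_or_one p with hp2 | hp2
  · have hp1 : (p - 1) % 2 = 1 := by omega
    have hright := cellAt_right_of_odd (m := m) (n := n) (s := s) hp1
    have hup := cellAt_up_of_odd (m := m) (n := n) (s := s) hp1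
    rw [sub_add_cancel] at hright hup
    refine ⟨2, 3, 1, 0, by decide, ⟨hup, ?_⟩, ⟨cellAt_left_of_odd hp1, ?_⟩, ⟨?_, ?_⟩, ?_⟩
    · change wallH m n x y (_ + (0, 1)) ↔ _
      rw [hup, wallH_of_even hxL hs0 hsg hp2, hx1]
      omega
    · change wallV m n x (_ + (-1, 0) + (1, 0)) ↔ _
      rw [hact3, wallV_of_odd hxL hs0 hsg hp1, sub_add_cancel, hx0]
    · change wallV m n x (_ + (1, 0)) ↔ _
      rw [hright]
      refine iff_of_false (not_wallV_of_even hp2) fun ⟨hr0, hl1⟩ => ?_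
      rw [if_pos (by omega)] at hl1
      omega
    · change wallV m n x (_ + (1, 0)) → _
      rw [hright]
      exact fun h => absurd h (not_wallV_of_even hp2)
    · change wallH m n x y (_ + (0, -1) + (0, 1)) → _
      rw [hact0, wallH_of_odd hxL hyg (by omega) hsg hp1, hsy]
      rintro ⟨hr1, hl1⟩
      have h3 : 3 ≤ x := by omega
      rw [hxm1 h3, hxm2 h3] at hl1
      refine ⟨by omega, (cellAt_down_of_odd hp1).trans ?_⟩
      rw [if_pos h3]
      congr 1
      omega
  · have hp1 : (p - 1) % 2 = 0 := by omega
    have hright := cellAt_right_of_even (m := m) (n := n) (s := s) hp1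
    have hup := cellAt_up_of_even (m := m) (n := n) (s := s) hp1
    rw [sub_add_cancel] at hright hup
    have hin : wallH m n x y (cellAt m n s (p - 1) + (0, 1)) ↔
        r ≠ 0 ∧ l = if 3 ≤ x then (b + 1) % 2 else 0 := by
      rw [hup, wallH_of_odd hxL hyg (by omega) (by omega) hp2, sub_add_cancel, hsy', hx0]
      refine and_congr_right fun hr0 => ?_
      have h3 : 3 ≤ x := by omega
      rw [hxm1 h3, if_pos h3]
      omega
    refine ⟨1, 0, 2, 3, by decide, ⟨hright, ?_⟩, ⟨cellAt_down_of_even hp1, ?_⟩, ⟨hin, ?_⟩, ?_⟩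
    · change wallV m n x (_ + (1, 0)) ↔ _
      rw [hright, wallV_of_odd hxL hs0 hsg hp2, hx1]
      omega
    · change wallH m n x y (_ + (0, -1) + (0, 1)) ↔ _
      rw [hact0, wallH_of_even hxL hs0 hsg hp1, sub_add_cancel, hx0]
    · intro h
      obtain ⟨hr0, hl1⟩ := hin.1 h
      rw [if_pos (by omega)] at hl1
      refine ⟨l + 1, by omega, hup.trans ?_⟩
      congr 1
      omega
    · change wallV m n x (_ + (-1, 0) + (1, 0)) → _
      rw [hact3]
      exact fun h => absurd h (not_wallV_of_even hp1)

end Staircase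

theorem exists_factors {k g L : ℕ} (hk : 0 < k) (hg : 4 * g ∣ L) (h : k ∣ g * L) :
    ∃ x y, k = y * x ∧ x ∣ L ∧ y ∣ g ∧ (y = 1 ∨ 3 ≤ x) := by
  have hx : 0 < k.gcd L := Nat.gcd_pos_of_pos_left L hk
  have hkx : k = k / k.gcd L * k.gcd L := (Nat.div_mul_cancel (Nat.gcd_dvd_left k L)).symm
  have hy : k / k.gcd L ∣ g := by
    refine (Nat.coprime_div_gcd_div_gcd hx).dvd_of_dvd_mul_right ?_
    rw [← Nat.mul_div_assoc _ (Nat.gcd_dvd_right k L)]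
    exact Nat.div_dvd_div (Nat.gcd_dvd_left k L) h
  refine ⟨k.gcd L, k / k.gcd L, hkx, Nat.gcd_dvd_right k L, hy, ?_⟩
  by_contra! hxy
  have hx4 : k.gcd L ∣ 4 := by
    have : k.gcd L < 3 := hxy.2
    interval_cases k.gcd L <;> decide
  have hkL : k ∣ L := by
    rw [hkx, mul_comm]
    exact (mul_dvd_mul hx4 hy).trans hg
  rw [Nat.gcd_eq_left hkL, Nat.div_self hk] at hxy
  exact hxy.1 rfl

theorem cycle_4k_decomposes_C4m_boxProd_C4n (k m n : ℕ)
    (hk : 0 < k) (hm : 0 < m) (hn : 0 < n) (hdvd : k ∣ 4 * m * n) :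
    CycleDecomposes (4 * k) (cycleGraph (4 * m) □ cycleGraph (4 * n)) := by
  have : NeZero m := ⟨hm.ne'⟩
  have : NeZero n := ⟨hn.ne'⟩
  obtain ⟨x, y, rfl, ⟨J, hJ⟩, ⟨G, hG⟩, hxy⟩ := exists_factors (g := m.gcd n) (L := 4 * m.lcm n) hk
    (mul_dvd_mul_left 4 ((Nat.gcd_dvd_left m n).trans (Nat.dvd_lcm_left m n)))
    (by rwa [mul_left_comm, Nat.gcd_mul_lcm, ← mul_assoc])
  have hy : 0 < y := Nat.pos_of_mul_pos_right hk
  have hx : 0 < x := Nat.pos_of_mul_pos_left hk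
  rw [mul_comm x] at hJ
  rw [mul_comm y] at hG
  exact cycleDecomposes_boxProd_of_turn hk (wallH m n x y) (wallV m n x)
    (card_sameCycle_turn_gridSystem hG hJ hy hx hxy)
    (card_sameCycle_turn_dualSystem hG hJ hy hx hxy)
end

section
/- For every odd integer n ≥ 5, the Cartesian product C_6 □ C_n admits no C_6-decomposition. -/
open SimpleGraph

/-- The row displacement of a unit step `(h, p)` on the grid: the step is horizontal iff `h` holds,
and goes in the positive direction iff `p` holds. -/
def rowStep : Bool × Bool → Fin 6
  | (true, _) => 0
  | (false, true) => 1
  | (false, false) => -1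

/-- The column displacement of a unit step on the grid, encoded as in `rowStep`. -/
def colStep : Bool × Bool → ℤ
  | (true, true) => 1
  | (true, false) => -1
  | (false, _) => 0

/-- The step `t` does not undo the step `s`. -/
def NoBacktrack (s t : Bool × Bool) : Prop := s.1 = t.1 → s.2 = t.2

instance (s t : Bool × Bool) : Decidable (NoBacktrack s t) :=
  inferInstanceAs (Decidable (_ → _))

/-- The indicator of a horizontal step `s` leaving from a row `x` of even index. -/
def evenRowCount (s : Bool × Bool) (x : Fin 6) : ℕ :=
  if s.1 = true ∧ x.val % 2 = 0 then 1 else 0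

set_option maxRecDepth 100000 in
set_option synthInstance.maxHeartbeats 400000 in
set_option synthInstance.maxSize 2000 in
theorem even_evenRowCount_of_closed : ∀ (x : Fin 6) (s₀ s₁ : Bool × Bool), NoBacktrack s₀ s₁ →
    ∀ s₂, NoBacktrack s₁ s₂ → ∀ s₃, NoBacktrack s₂ s₃ → ∀ s₄, NoBacktrack s₃ s₄ →
    ∀ s₅, NoBacktrack s₄ s₅ → NoBacktrack s₅ s₀ →
    x + rowStep s₀ + rowStep s₁ + rowStep s₂ + rowStep s₃ + rowStep s₄ + rowStep s₅ = x →
    (colStep s₀ + colStep s₁ + colStep s₂ + colStep s₃ + colStep s₄ + colStep s₅) % 5 = 0 →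
    (evenRowCount s₀ x + evenRowCount s₁ (x + rowStep s₀) +
      evenRowCount s₂ (x + rowStep s₀ + rowStep s₁) +
      evenRowCount s₃ (x + rowStep s₀ + rowStep s₁ + rowStep s₂) +
      evenRowCount s₄ (x + rowStep s₀ + rowStep s₁ + rowStep s₂ + rowStep s₃) +
      evenRowCount s₅ (x + rowStep s₀ + rowStep s₁ + rowStep s₂ + rowStep s₃ + rowStep s₄)) % 2
      = 0 := by
  decide +kernel

theorem steps_cancel : ∀ s t : Bool × Bool, s.1 = t.1 → s.2 ≠ t.2 →
    rowStep s + rowStep t = 0 ∧ colStep s + colStep t = 0 := by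
  decide

theorem abs_colStep_le (s : Bool × Bool) : |colStep s| ≤ 1 := by
  revert s; decide

theorem emod_five_eq_zero_of_dvd {n : ℕ} (hn : 5 ≤ n) (hodd : Odd n) {t : ℤ} (ht : |t| ≤ 6)
    (h : (n : ℤ) ∣ t) : t % 5 = 0 := by
  rcases eq_or_ne t 0 with rfl | h0
  · rfl
  have hle : (n : ℤ) ≤ |t| := Int.le_of_dvd (abs_pos.2 h0) ((dvd_abs _ _).2 h)
  have hn5 : n = 5 := by
    obtain ⟨r, rfl⟩ := hodd
    omega
  subst hn5
  exact Int.emod_eq_zero_of_dvd h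

/-- Each edge of `C_6 □ C_n` is a unit step. -/
theorem exists_step_of_adj {m : ℕ} {u v : Fin 6 × Fin (m + 2)}
    (h : (cycleGraph 6 □ cycleGraph (m + 2)).Adj u v) :
    ∃ s : Bool × Bool, v.1 = u.1 + rowStep s ∧
      (v.2.val : ZMod (m + 2)) = u.2.val + colStep s ∧
      (s.1 = true ↔ u.1 = v.1) := by
  have key (a b : Fin (m + 2)) (h : a - b = 1) : (a.val : ZMod (m + 2)) = b.val + 1 := by
    rw [sub_eq_iff_eq_add'.1 h, Fin.val_add, ZMod.natCast_mod, Fin.val_one]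
    push_cast
    rfl
  rcases h with ⟨h, h₂⟩ | ⟨h, h₁⟩
  · have hne := h.ne
    rw [cycleGraph_adj] at h
    rcases h with h | h
    · exact ⟨(false, false), by rw [rowStep, ← h]; abel, by simp [colStep, h₂], by simpa using hne⟩
    · exact ⟨(false, true), by rw [rowStep, ← h]; abel, by simp [colStep, h₂], by simpa using hne⟩
  · rw [cycleGraph_adj] at h
    rcases h with h | h
    · exact ⟨(true, false), by simp [rowStep, h₁], by simp [colStep, key _ _ h], by simpa using h₁⟩
    · exact ⟨(true, true), by simp [rowStep, h₁], by simp [colStep, key _ _ h], by simpa using h₁⟩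

/-- A 6-cycle in `C_6 □ C_n` has an even number of horizontal edges in rows of even index. -/
theorem even_card_filter_horizontal {n : ℕ} (hn : 5 ≤ n) (hodd : Odd n)
    (v : Fin 6 → Fin 6 × Fin n) (hv : Function.Injective v)
    (hadj : ∀ k, (cycleGraph 6 □ cycleGraph n).Adj (v k) (v (k + 1))) :
    Even (Finset.univ.filter fun k : Fin 6 =>
      (v k).1 = (v (k + 1)).1 ∧ (v k).1.val % 2 = 0).card := by
  obtain ⟨m, rfl⟩ : ∃ m, n = m + 2 := ⟨n - 2, by omega⟩
  choose s hrow hcol hs using fun k => exists_step_of_adj (hadj k)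
  have hback (k : Fin 6) : NoBacktrack (s k) (s (k + 1)) := by
    intro h
    by_contra h'
    have hne : v (k + 1 + 1) ≠ v k := fun h => by
      exact (by decide : ∀ k : Fin 6, k + 1 + 1 ≠ k) k (hv h)
    apply hne
    have hz : rowStep (s k) + rowStep (s (k + 1)) = 0 ∧ colStep (s k) + colStep (s (k + 1)) = 0 :=
      steps_cancel _ _ h h'
    apply Prod.ext
    · rw [hrow, hrow, add_assoc, hz.1, add_zero]
    · have := hcol (k + 1)
      rw [hcol k, add_assoc _ (Int.cast _), ← Int.cast_add, hz.2, Int.cast_zero, add_zero,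
        ZMod.natCast_eq_natCast_iff', Nat.mod_eq_of_lt (Fin.is_lt _),
        Nat.mod_eq_of_lt (Fin.is_lt _)] at this
      exact Fin.ext this
  have r0 := hrow 0
  have r1 := hrow 1
  have r2 := hrow 2
  have r3 := hrow 3
  have r4 := hrow 4
  have r5 := hrow 5
  have c0 := hcol 0
  have c1 := hcol 1
  have c2 := hcol 2
  have c3 := hcol 3
  have c4 := hcol 4
  have c5 := hcol 5
  simp only [Fin.isValue, show (0 + 1 : Fin 6) = 1 from rfl, show (1 + 1 : Fin 6) = 2 from rfl,
    show (2 + 1 : Fin 6) = 3 from rfl, show (3 + 1 : Fin 6) = 4 from rfl,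
    show (4 + 1 : Fin 6) = 5 from rfl, show (5 + 1 : Fin 6) = 0 from rfl]
    at r0 r1 r2 r3 r4 r5 c0 c1 c2 c3 c4 c5
  have hdvd : ((m + 2 : ℕ) : ℤ) ∣ colStep (s 0) + colStep (s 1) + colStep (s 2) + colStep (s 3) +
      colStep (s 4) + colStep (s 5) := by
    rw [← ZMod.intCast_zmod_eq_zero_iff_dvd]
    push_cast
    linear_combination -c0 - c1 - c2 - c3 - c4 - c5
  have habs : |colStep (s 0) + colStep (s 1) + colStep (s 2) + colStep (s 3) +
      colStep (s 4) + colStep (s 5)| ≤ 6 := by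
    have h (k) := abs_le.1 (abs_colStep_le (s k))
    rw [abs_le]
    constructor <;>
      linarith only [(h 0).1, (h 0).2, (h 1).1, (h 1).2, (h 2).1, (h 2).2, (h 3).1, (h 3).2,
        (h 4).1, (h 4).2, (h 5).1, (h 5).2]
  have hmod := emod_five_eq_zero_of_dvd hn hodd habs hdvd
  have hcount := even_evenRowCount_of_closed (v 0).1 (s 0) (s 1) (hback 0) (s 2) (hback 1) (s 3)
    (hback 2) (s 4) (hback 3) (s 5) (hback 4) (hback 5)
    (by rw [← r0, ← r1, ← r2, ← r3, ← r4, ← r5]) hmod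
  rw [← r0, ← r1, ← r2, ← r3, ← r4] at hcount
  simp_rw [← hs]
  rw [Nat.even_iff, Finset.card_filter, Fin.sum_univ_six]
  exact hcount

/-- A copy of `C_6` in `G` is traced by an injective closed walk. -/
theorem exists_cycle_param {V : Type*} {G : SimpleGraph V} {H : G.Subgraph}
    (φ : H.coe ≃g cycleGraph 6) :
    ∃ v : Fin 6 → V, Function.Injective v ∧ (∀ k, H.Adj (v k) (v (k + 1))) ∧
      ∀ e ∈ H.edgeSet, ∃ k, s(v k, v (k + 1)) = e := by
  refine ⟨fun k => φ.symm k, fun k l h => φ.symm.injective (Subtype.ext h), fun k => ?_, ?_⟩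
  · have : H.coe.Adj (φ.symm k) (φ.symm (k + 1)) := by
      rw [φ.symm.map_adj_iff]
      revert k
      decide
    exact this
  · intro e
    induction e using Sym2.ind with
    | _ x y =>
      intro h
      rw [Subgraph.mem_edgeSet] at h
      have h' : H.coe.Adj ⟨x, H.edge_vert h⟩ ⟨y, H.edge_vert h.symm⟩ := h
      rw [← φ.map_adj_iff, cycleGraph_adj] at h'
      rcases h' with h' | h'
      · refine ⟨φ ⟨y, H.edge_vert h.symm⟩, ?_⟩
        rw [← h', add_sub_cancel]
        simp [Sym2.eq_swap]
      · refine ⟨φ ⟨x, H.edge_vert h⟩, ?_⟩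
        rw [← h', add_sub_cancel]
        simp

theorem mk_succ_injective {V : Type*} {v : Fin 6 → V} (hv : Function.Injective v) :
    Function.Injective fun k => s(v k, v (k + 1)) := by
  intro k l h
  rw [Sym2.eq_iff, hv.eq_iff, hv.eq_iff, hv.eq_iff, hv.eq_iff] at h
  revert k l
  decide

/-- The edge joining `p` to its successor in the same row. -/
def horizontalEdge (m : ℕ) (p : Fin 6 × Fin (m + 2)) : Sym2 (Fin 6 × Fin (m + 2)) :=
  s(p, (p.1, p.2 + 1))

/-- The horizontal edges of `C_6 □ C_{m+2}` in rows of even index. -/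
def evenRowEdges (m : ℕ) : Finset (Sym2 (Fin 6 × Fin (m + 2))) :=
  ((Finset.univ.filter fun a : Fin 6 => a.val % 2 = 0) ×ˢ Finset.univ).image (horizontalEdge m)

theorem card_evenRowEdges {m : ℕ} (hm : 3 ≤ m) : (evenRowEdges m).card = 3 * (m + 2) := by
  rw [evenRowEdges, Finset.card_image_of_injective, Finset.card_product]
  · rw [Finset.card_univ, Fintype.card_fin]
    rfl
  · rintro ⟨a, i⟩ ⟨b, j⟩ h
    simp only [horizontalEdge, Sym2.eq_iff, Prod.mk.injEq] at h
    rcases h with ⟨⟨h₁, h₂⟩, -⟩ | ⟨⟨-, h₁⟩, -, h₂⟩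
    · rw [h₁, h₂]
    · exfalso
      rw [h₁, add_assoc, add_eq_left, Fin.ext_iff, Fin.val_add, Fin.val_one,
        Nat.mod_eq_of_lt (by omega)] at h₂
      simp at h₂

theorem mk_mem_evenRowEdges {m : ℕ} {u v : Fin 6 × Fin (m + 2)}
    (h : (cycleGraph 6 □ cycleGraph (m + 2)).Adj u v) :
    s(u, v) ∈ evenRowEdges m ↔ u.1 = v.1 ∧ u.1.val % 2 = 0 := by
  simp only [evenRowEdges, Finset.mem_image, Finset.mem_product, Finset.mem_filter,
    Finset.mem_univ, true_and, and_true, horizontalEdge]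
  constructor
  · rintro ⟨p, hp, h⟩
    rcases Sym2.eq_iff.1 h with ⟨rfl, rfl⟩ | ⟨rfl, rfl⟩ <;> exact ⟨rfl, hp⟩
  · rintro ⟨h₁, h₂⟩
    rcases h with ⟨h, -⟩ | ⟨h, -⟩
    · exact absurd h₁ h.ne
    · rw [cycleGraph_adj] at h
      rcases h with h | h
      · refine ⟨v, h₁ ▸ h₂, ?_⟩
        rw [← h, add_sub_cancel, ← h₁, Sym2.eq_swap]
      · refine ⟨u, h₂, ?_⟩
        rw [← h, add_sub_cancel, h₁]

theorem evenRowEdges_subset {m : ℕ} {e : Sym2 (Fin 6 × Fin (m + 2))} (he : e ∈ evenRowEdges m) :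
    e ∈ (cycleGraph 6 □ cycleGraph (m + 2)).edgeSet := by
  simp only [evenRowEdges, Finset.mem_image] at he
  obtain ⟨p, -, rfl⟩ := he
  rw [horizontalEdge, mem_edgeSet, boxProd_adj]
  exact Or.inr ⟨by simp [cycleGraph_adj], rfl⟩

open Classical in
theorem even_card_evenRowEdges_filter {m : ℕ} (hm : 3 ≤ m) (hodd : Odd m)
    {H : (cycleGraph 6 □ cycleGraph (m + 2)).Subgraph} (φ : H.coe ≃g cycleGraph 6) :
    Even ((evenRowEdges m).filter (· ∈ H.edgeSet)).card := by
  obtain ⟨v, hv, hadj, hsurj⟩ := exists_cycle_param φ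
  have heven := even_card_filter_horizontal (by omega) (by simpa [parity_simps] using hodd) v hv
    fun k => (hadj k).adj_sub
  rw [← Finset.card_image_of_injective _ (mk_succ_injective hv)] at heven
  convert heven using 2
  ext e
  simp only [Finset.mem_filter, Finset.mem_image, Finset.mem_univ, true_and]
  constructor
  · rintro ⟨he, heH⟩
    obtain ⟨k, rfl⟩ := hsurj e heH
    exact ⟨k, (mk_mem_evenRowEdges (hadj k).adj_sub).1 he, rfl⟩
  · rintro ⟨k, hk, rfl⟩
    exact ⟨(mk_mem_evenRowEdges (hadj k).adj_sub).2 hk, hadj k⟩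

theorem no_c6_decomposition_C6_boxProd_Cn_odd (n : ℕ) (hn : 5 ≤ n) (hodd : Odd n) :
    ¬ CycleDecomposes 6 (cycleGraph 6 □ cycleGraph n) := by
  classical
  rintro ⟨D, hiso, huniq⟩
  obtain ⟨m, rfl⟩ : ∃ m, n = m + 2 := ⟨n - 2, by omega⟩
  have := Fintype.ofFinite D
  have hcount := Finset.sum_card_bipartiteAbove_eq_sum_card_bipartiteBelow
    (s := evenRowEdges m) (t := (Finset.univ : Finset D))
    fun e (H : D) => e ∈ (H : (cycleGraph 6 □ cycleGraph (m + 2)).Subgraph).edgeSet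
  have hleft : ∀ e ∈ evenRowEdges m, (Finset.univ.bipartiteAbove (fun e (H : D) =>
      e ∈ (H : (cycleGraph 6 □ cycleGraph (m + 2)).Subgraph).edgeSet) e).card = 1 := by
    intro e he
    obtain ⟨H, hH, hH'⟩ := huniq e (evenRowEdges_subset he)
    rw [Finset.card_eq_one]
    refine ⟨H, Finset.eq_singleton_iff_unique_mem.2 ⟨by simpa [Finset.bipartiteAbove] using hH, ?_⟩⟩
    intro K hK
    exact hH' K (by simpa [Finset.bipartiteAbove] using hK)
  rw [Finset.sum_congr rfl hleft, Finset.sum_const, smul_eq_mul, mul_one,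
    card_evenRowEdges (by omega)] at hcount
  have heven : Even (3 * (m + 2)) := by
    rw [hcount]
    refine Finset.even_sum _ fun H _ => ?_
    obtain ⟨φ⟩ := hiso H H.2
    exact even_card_evenRowEdges_filter (by omega) (by simpa [parity_simps] using hodd) φ
  rw [Nat.even_iff] at heven
  rw [Nat.odd_iff] at hodd
  omega
end

section
/- For every integer n ≥ 10 with n ≡ 2 (mod 4), the Cartesian product C_6 □ C_n admits no C_6-decomposition. -/
open SimpleGraph

/-- The four unit steps of the grid. -/
def stepVec : Fin 4 → ZMod 6 × ℤ
  | 0 => (1, 0)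
  | 1 => (-1, 0)
  | 2 => (0, 1)
  | 3 => (0, -1)

/-- The edge traversed by a step from `q`, given by its lower end and whether it is
along the second factor. -/
def stepEdge (q : ZMod 6 × ℤ) : Fin 4 → (ZMod 6 × ℤ) × Bool
  | 0 => (q, false)
  | 1 => (q + (-1, 0), false)
  | 2 => (q, true)
  | 3 => (q + (0, -1), true)

/-- The edges of a `2 × 1` rectangle, of a `1 × 2` rectangle and of a copy of the factor `C₆`,
each based at the origin. -/
def tileShape : Fin 3 → List ((ZMod 6 × ℤ) × Bool)
  | 0 => [((0, 0), false), ((1, 0), false), ((0, 1), false), ((1, 1), false),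
      ((0, 0), true), ((2, 0), true)]
  | 1 => [((0, 0), false), ((0, 2), false), ((0, 0), true), ((0, 1), true),
      ((1, 0), true), ((1, 1), true)]
  | 2 => [((0, 0), false), ((1, 0), false), ((2, 0), false), ((3, 0), false),
      ((4, 0), false), ((5, 0), false)]

/-- The starting points of the successive steps of a walk. -/
def walkPositions : ZMod 6 × ℤ → List (Fin 4) → List (ZMod 6 × ℤ)
  | _, [] => []
  | q, s :: l => q :: walkPositions (q + stepVec s) l

/-- The edges traversed by a walk. -/
def walkEdges : ZMod 6 × ℤ → List (Fin 4) → List ((ZMod 6 × ℤ) × Bool)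
  | _, [] => []
  | q, s :: l => stepEdge q s :: walkEdges (q + stepVec s) l

theorem closed_walk_eq_tile : ∀ a b c d e f : Fin 4,
    stepVec a + stepVec b + stepVec c + stepVec d + stepVec e + stepVec f = 0 →
    (walkPositions 0 [a, b, c, d, e, f]).Nodup →
    ∃ κ : Fin 3, ∃ x ∈ walkPositions 0 [a, b, c, d, e, f],
      walkEdges 0 [a, b, c, d, e, f] ⊆ (tileShape κ).map (fun o => (x + o.1, o.2)) ∧
      (tileShape κ).map (fun o => (x + o.1, o.2)) ⊆ walkEdges 0 [a, b, c, d, e, f] := by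
  decide +kernel

/-- Reduction of a grid vector to the torus. -/
def toTorus (n : ℕ) : ZMod 6 × ℤ →+ ZMod 6 × ZMod n :=
  (AddMonoidHom.id (ZMod 6)).prodMap (Int.castAddHom (ZMod n))

/-- The edge `e` of the grid moved to the base point `p` of the torus. -/
def translateEdge {n : ℕ} (p : ZMod 6 × ZMod n) (e : (ZMod 6 × ℤ) × Bool) :
    (ZMod 6 × ZMod n) × Bool :=
  (p + toTorus n e.1, e.2)

/-- The edges of the tile of kind `t.1` based at `t.2`. -/
def torusTile {n : ℕ} (t : Fin 3 × (ZMod 6 × ZMod n)) : List ((ZMod 6 × ZMod n) × Bool) :=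
  (tileShape t.1).map (translateEdge t.2)

theorem List.sum_indicator_eq_one {α : Type*} (S : Set α) [DecidablePred (· ∈ S)] {l : List α}
    (hl : l.Nodup) (h : ∃! x, x ∈ S ∧ x ∈ l) :
    (l.map (fun x => if x ∈ S then (1 : ℤ) else 0)).sum = 1 := by
  classical
  obtain ⟨x, ⟨hxS, hxl⟩, hx⟩ := h
  have : l.map (fun y => if y ∈ S then (1 : ℤ) else 0) = l.map (fun y => if x = y then 1 else 0) := by
    refine List.map_congr_left fun y hy => ?_
    by_cases hyS : y ∈ S
    · obtain rfl := hx y ⟨hyS, hy⟩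
      simp [hyS]
    · have : x ≠ y := by rintro rfl; exact hyS hxS
      simp [hyS, this]
  rw [this]
  have := List.count_eq_one_of_mem hl hxl
  rw [← List.sum_toFinset _ hl]
  simp [hxl]

theorem natCast_ne_zero_of_lt {n k : ℕ} (hk : 0 < k) (hkn : k < n) : (k : ZMod n) ≠ 0 := by
  rw [Ne, ZMod.natCast_eq_zero_iff]
  exact Nat.not_dvd_of_pos_of_lt hk hkn

/-- The tiles of each kind that contain the edge `e`. -/
def tilesThrough {n : ℕ} (e : (ZMod 6 × ZMod n) × Bool) : List (Fin 3 × (ZMod 6 × ZMod n)) :=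
  [0, 1, 2].flatMap fun κ : Fin 3 =>
    ((tileShape κ).filter (fun o => o.2 = e.2)).map (fun o => (κ, e.1 - toTorus n o.1))

theorem mem_tilesThrough {n : ℕ} (e : (ZMod 6 × ZMod n) × Bool)
    (t : Fin 3 × (ZMod 6 × ZMod n)) : t ∈ tilesThrough e ↔ e ∈ torusTile t := by
  obtain ⟨κ, x⟩ := t
  obtain ⟨y, b⟩ := e
  have hκ : κ ∈ [0, 1, 2] := by fin_cases κ <;> simp
  simp only [tilesThrough, torusTile, translateEdge, List.mem_flatMap, List.mem_map, List.mem_filter,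
    Prod.mk.injEq, decide_eq_true_eq]
  constructor
  · rintro ⟨κ', -, o, ⟨ho, hb⟩, rfl, rfl⟩
    exact ⟨o, ho, by simp, hb⟩
  · rintro ⟨o, ho, rfl, hb⟩
    exact ⟨κ, hκ, o, ⟨ho, hb⟩, rfl, by simp⟩

theorem nodup_tilesThrough {n : ℕ} (hn : 2 < n) (e : (ZMod 6 × ZMod n) × Bool) :
    (tilesThrough e).Nodup := by
  have h1 : (1 : ZMod n) ≠ 0 := by simpa using natCast_ne_zero_of_lt (k := 1) (by simp) (by omega)
  have h2 : (2 : ZMod n) ≠ 0 := by simpa using natCast_ne_zero_of_lt (k := 2) (by simp) hn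
  obtain ⟨y, b⟩ := e
  have d2 : (2 : ZMod 6) ≠ 0 := by decide
  cases b <;>
  · simp [tilesThrough, tileShape, toTorus, List.filter, h1, h2, h1.symm, h2.symm, d2, d2.symm]
    try decide

/-- The `0`-`1` system of a tiling by `2 × 1` rectangles `a`, `1 × 2` rectangles `b` and
circles `c` has no solution. -/
theorem tiling_system_unsolvable {n : ℕ} (hmod : n % 4 = 2) (a b c : ZMod 6 → ZMod n → ℤ)
    (ha : ∀ i j, 0 ≤ a i j) (hb : ∀ i j, 0 ≤ b i j) (hc : ∀ i j, 0 ≤ c i j)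
    (H : ∀ i j, a i j + (a (i - 1) j + (a i (j - 1) + (a (i - 1) (j - 1) + (b i j + (b i (j - 2) +
      (c i j + (c (i - 1) j + (c (i - 2) j + (c (i - 3) j +
        (c (i - 4) j + c (i - 5) j)))))))))) = 1)
    (V : ∀ i j, a i j + (a (i - 2) j + (b i j + (b i (j - 1) +
      (b (i - 1) j + b (i - 1) (j - 1))))) = 1) : False := by
  have shift (f : ZMod 6 → ZMod n → ℤ) (k : ZMod 6) (j) : ∑ i, f (i - k) j = ∑ i, f i j :=
    Equiv.sum_comp (Equiv.subRight k) (f · j)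
  obtain ⟨A, hA⟩ : ∃ A : ZMod n → ℤ, ∀ j, ∑ i, a i j = A j := ⟨_, fun _ => rfl⟩
  obtain ⟨B, hB⟩ : ∃ B : ZMod n → ℤ, ∀ j, ∑ i, b i j = B j := ⟨_, fun _ => rfl⟩
  obtain ⟨C, hC⟩ : ∃ C : ZMod n → ℤ, ∀ j, ∑ i, c i j = C j := ⟨_, fun _ => rfl⟩
  have A0 (j) : 0 ≤ A j := hA j ▸ Finset.sum_nonneg fun i _ => ha i j
  have B0 (j) : 0 ≤ B j := hB j ▸ Finset.sum_nonneg fun i _ => hb i j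
  have C0 (j) : 0 ≤ C j := hC j ▸ Finset.sum_nonneg fun i _ => hc i j
  have HS (j) : 2 * A j + 2 * A (j - 1) + B j + B (j - 2) + 6 * C j = 6 := by
    have := Finset.sum_congr (rfl : (Finset.univ : Finset (ZMod 6)) = _) fun i _ => H i j
    simp only [Finset.sum_add_distrib, shift, hA, hB, hC] at this
    simp at this
    linarith
  have VS (j) : A j + B j + B (j - 1) = 3 := by
    have := Finset.sum_congr (rfl : (Finset.univ : Finset (ZMod 6)) = _) fun i _ => V i j
    simp only [Finset.sum_add_distrib, shift, hA, hB] at this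
    simp at this
    linarith
  have e1 (j : ZMod n) : j + 1 - 1 = j := by ring
  have e2 (j : ZMod n) : j + 1 - 2 = j - 1 := by ring
  have e3 (j : ZMod n) : j + 2 - 1 = j + 1 := by ring
  have e4 (j : ZMod n) : j + 2 - 2 = j := by ring
  by_cases hcirc : ∃ j, C j ≠ 0
  · obtain ⟨j, hj⟩ := hcirc
    have step (j : ZMod n) (hj : C j ≠ 0) : C (j + 2) ≠ 0 ∧ b 0 (j + 1) + b 0 (j - 1) = 1 := by
      have h1 := HS j
      have h2 := VS j
      have h3 := HS (j + 1)
      have h4 := VS (j + 1)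
      have h5 := HS (j + 2)
      have h6 := VS (j + 2)
      have h7 := A0 (j + 1)
      have h8 := A0 (j + 2)
      have h9 := B0 (j + 2)
      have h10 := B0 (j + 1)
      have h11 := C0 (j + 1)
      have h12 := A0 j
      have h13 := B0 j
      have h14 := A0 (j - 1)
      have h15 := B0 (j - 2)
      have h16 := C0 j
      rw [e1, e2] at h3
      rw [e1] at h4
      rw [e3, e4] at h5
      rw [e3] at h6
      refine ⟨by omega, ?_⟩
      have za (i) : a i j = 0 := (Finset.sum_eq_zero_iff_of_nonneg fun i _ => ha i j).1
        (by rw [hA]; omega) i (Finset.mem_univ i)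
      have za' (i) : a i (j + 1) = 0 := (Finset.sum_eq_zero_iff_of_nonneg
        fun i _ => ha i (j + 1)).1 (by rw [hA]; omega) i (Finset.mem_univ i)
      have zc (i) : c i (j + 1) = 0 := (Finset.sum_eq_zero_iff_of_nonneg
        fun i _ => hc i (j + 1)).1 (by rw [hC]; omega) i (Finset.mem_univ i)
      have := H 0 (j + 1)
      rw [e1, e2] at this
      simpa only [za, za', zc, zero_add, add_zero] using this
    have alternate (k : ℕ) : C (j + 4 * k) ≠ 0 ∧ b 0 (j + 4 * k - 1) = b 0 (j - 1) := by
      induction k with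
      | zero => simpa using hj
      | succ k ih =>
        obtain ⟨ih1, ih2⟩ := ih
        have s1 := step _ ih1
        have s2 := step _ s1.1
        have e5 : j + 4 * ((k + 1 : ℕ) : ZMod n) = j + 4 * k + 2 + 2 := by push_cast; ring
        rw [e5, show j + 4 * (k : ZMod n) + 2 + 2 - 1 = j + 4 * k + 2 + 1 by ring]
        refine ⟨s2.1, ?_⟩
        have := s2.2
        rw [e3] at this
        linarith [s1.2]
    obtain ⟨h1, h2⟩ := alternate (n / 4)
    have h3 := (step _ h1).2
    have hn : j + 4 * ((n / 4 : ℕ) : ZMod n) + 2 = j := by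
      have : ((4 * (n / 4) + 2 : ℕ) : ZMod n) = 0 := by
        rw [show 4 * (n / 4) + 2 = n by omega, ZMod.natCast_self]
      push_cast at this
      rw [add_assoc, this, add_zero]
    rw [h2, show j + 4 * ((n / 4 : ℕ) : ZMod n) + 1 = j - 1 by linear_combination hn] at h3
    omega
  · push Not at hcirc
    have hA0 : A 0 ≠ 0 := by
      have h1 := HS 0
      have h2 := VS 0
      have h3 := HS (0 + 1)
      have h4 := VS (0 + 1)
      have h5 := HS (0 + 2)
      have h6 := VS (0 + 2)
      have h7 := VS (0 - 1)
      rw [show (0 : ZMod n) - 1 - 1 = 0 - 2 by ring] at h7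
      rw [e1, e2] at h3
      rw [e1] at h4
      rw [e3, e4] at h5
      rw [e3] at h6
      simp only [hcirc] at h1 h3 h5
      have := B0 (0 + 1)
      have := B0 0
      have := B0 (0 - 1)
      have := B0 (0 - 2)
      have := B0 (0 + 2)
      omega
    obtain ⟨i, -, hi⟩ := Finset.exists_ne_zero_of_sum_ne_zero (hA 0 ▸ hA0)
    have v0 := V i 0
    have v1 := V (i + 1) 0
    have v2 := V (i + 2) 0
    have h0 := H i 0
    have h1 := H (i + 1) 0
    rw [show i + 1 - 2 = i - 1 by ring, add_sub_cancel_right] at v1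
    rw [show i + 2 - 1 = i + 1 by ring, add_sub_cancel_right] at v2
    rw [add_sub_cancel_right] at h1
    have := ha i 0
    grind

theorem not_exists_tiling {n : ℕ} (hn : 2 < n) (hmod : n % 4 = 2)
    (S : Set (Fin 3 × (ZMod 6 × ZMod n))) (hS : ∀ e, ∃! t, t ∈ S ∧ e ∈ torusTile t) : False := by
  classical
  have key (e) := List.sum_indicator_eq_one S (nodup_tilesThrough hn e)
    (by simpa only [mem_tilesThrough] using hS e)
  obtain ⟨g, hg⟩ : ∃ g : Fin 3 → ZMod 6 → ZMod n → ℤ, ∀ κ i j,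
      g κ i j = if (κ, (i, j)) ∈ S then 1 else 0 := ⟨_, fun _ _ _ => rfl⟩
  have g0 (κ i j) : 0 ≤ g κ i j := by rw [hg]; split_ifs <;> simp
  have H (i : ZMod 6) (j : ZMod n) := key ((i, j), false)
  have V (i : ZMod 6) (j : ZMod n) := key ((i, j), true)
  simp [tilesThrough, tileShape, toTorus, List.filter, ← hg] at H V
  exact tiling_system_unsolvable hmod (g 0) (g 1) (g 2) (g0 0) (g0 1) (g0 2) H V

/-- The edge that leaves `e.1` in the positive second (`e.2 = true`) or first direction. -/
def torusEdge {n : ℕ} (e : (ZMod 6 × ZMod n) × Bool) : Sym2 (ZMod 6 × ZMod n) :=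
  s(e.1, e.1 + toTorus n (if e.2 then (0, 1) else (1, 0)))

theorem torusEdge_injective {n : ℕ} (hn : 2 < n) : Function.Injective (torusEdge (n := n)) := by
  have h1 : (1 : ZMod n) ≠ 0 := by simpa using natCast_ne_zero_of_lt (k := 1) (by simp) (by omega)
  have h2 : (1 : ZMod n) + 1 ≠ 0 := by
    rw [one_add_one_eq_two]
    simpa using natCast_ne_zero_of_lt (k := 2) (by simp) hn
  have d2 : (1 : ZMod 6) + 1 ≠ 0 := by decide
  rintro ⟨x, b⟩ ⟨y, b'⟩ h
  simp only [torusEdge, Sym2.eq_iff] at h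
  rcases h with ⟨rfl, h⟩ | ⟨rfl, h⟩
  · cases b <;> cases b' <;> simp [toTorus, h1, h1.symm] at h ⊢
  · rw [add_assoc, add_eq_left] at h
    cases b <;> cases b' <;> simp [toTorus, h1, h2, d2] at h

theorem toTorus_eq_zero {n : ℕ} {q : ZMod 6 × ℤ} (hq : |q.2| < n) (h : toTorus n q = 0) :
    q = 0 := by
  simp only [toTorus, AddMonoidHom.prodMap_def, Prod.ext_iff] at h
  refine Prod.ext h.1 (Int.eq_zero_of_abs_lt_dvd ?_ hq)
  exact (ZMod.intCast_zmod_eq_zero_iff_dvd _ _).1 h.2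

theorem abs_stepVec_snd_le (s : Fin 4) : |(stepVec s).2| ≤ 1 := by
  fin_cases s <;> simp [stepVec]

theorem torusEdge_translateEdge_stepEdge {n : ℕ} (p : ZMod 6 × ZMod n) (q : ZMod 6 × ℤ)
    (s : Fin 4) : torusEdge (translateEdge p (stepEdge q s)) =
      s(p + toTorus n q, p + toTorus n (q + stepVec s)) := by
  have h1 : ((-1, 0) : ZMod 6 × ℤ) + (1, 0) = 0 := by decide
  have h3 : ((0, -1) : ZMod 6 × ℤ) + (0, 1) = 0 := by decide
  match s with
  | 0 => simp [torusEdge, translateEdge, stepEdge, stepVec, add_assoc]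
  | 1 =>
    simp only [torusEdge, translateEdge, stepEdge, stepVec, add_assoc, ← map_add, h1,
      Bool.false_eq_true, if_false, add_zero]
    exact Sym2.eq_swap
  | 2 => simp [torusEdge, translateEdge, stepEdge, stepVec, add_assoc]
  | 3 =>
    simp only [torusEdge, translateEdge, stepEdge, stepVec, add_assoc, ← map_add, h3,
      if_true, add_zero]
    exact Sym2.eq_swap

theorem exists_torusTile_of_cycle {n : ℕ} (hn : 6 < n) {G : SimpleGraph (ZMod 6 × ZMod n)}
    (hG : ∀ u v, G.Adj u v → ∃ s, v = u + toTorus n (stepVec s)) (H : G.Subgraph)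
    (φ : H.coe ≃g cycleGraph 6) :
    ∃ t, ∀ e, torusEdge e ∈ H.edgeSet ↔ e ∈ torusTile t := by
  obtain ⟨w, hw⟩ : ∃ w : Fin 6 → ZMod 6 × ZMod n, ∀ k, w k = φ.symm k := ⟨_, fun _ => rfl⟩
  have w_inj : Function.Injective w := fun i j h =>
    φ.symm.injective (Subtype.ext (by rw [← hw, ← hw, h]))
  have w_adj (k : Fin 6) : H.Adj (w k) (w (k + 1)) := by
    rw [hw, hw]
    exact (φ.symm.map_adj_iff (v := k) (w := k + 1)).2 (by simp [cycleGraph_adj])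
  have mem_edges (e : Sym2 (ZMod 6 × ZMod n)) :
      e ∈ H.edgeSet ↔ ∃ k, s(w k, w (k + 1)) = e := by
    constructor
    · induction e with | _ u v
      intro h
      have huv : H.Adj u v := h
      have hc : (cycleGraph 6).Adj (φ ⟨u, huv.fst_mem⟩) (φ ⟨v, huv.snd_mem⟩) :=
        φ.map_adj_iff.2 huv
      have hu : w (φ ⟨u, huv.fst_mem⟩) = u := by simp [hw]
      have hv : w (φ ⟨v, huv.snd_mem⟩) = v := by simp [hw]
      rw [cycleGraph_adj] at hc
      rcases hc with hc | hc
      · refine ⟨φ ⟨v, huv.snd_mem⟩, ?_⟩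
        rw [add_comm, ← sub_eq_iff_eq_add.1 hc, hu, hv, Sym2.eq_swap]
      · refine ⟨φ ⟨u, huv.fst_mem⟩, ?_⟩
        rw [add_comm, ← sub_eq_iff_eq_add.1 hc, hu, hv]
    · rintro ⟨k, rfl⟩
      exact w_adj k
  choose s hs using fun k => hG _ _ (w_adj k).adj_sub
  have w1 : w 1 = w 0 + toTorus n (stepVec (s 0)) := hs 0
  have w2 : w 2 = w 1 + toTorus n (stepVec (s 1)) := hs 1
  have w3 : w 3 = w 2 + toTorus n (stepVec (s 2)) := hs 2
  have w4 : w 4 = w 3 + toTorus n (stepVec (s 3)) := hs 3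
  have w5 : w 5 = w 4 + toTorus n (stepVec (s 4)) := hs 4
  have w6 : w 0 = w 5 + toTorus n (stepVec (s 5)) := hs 5
  have closed : stepVec (s 0) + stepVec (s 1) + stepVec (s 2) + stepVec (s 3) + stepVec (s 4) +
      stepVec (s 5) = 0 := by
    apply toTorus_eq_zero (n := n)
    · have := fun k => abs_le.1 (abs_stepVec_snd_le (s k))
      have h0 := this 0
      have h1 := this 1
      have h2 := this 2
      have h3 := this 3
      have h4 := this 4
      have h5 := this 5
      simp only [Prod.snd_add]
      rw [abs_lt]
      omega
    · rw [w5, w4, w3, w2, w1] at w6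
      simpa only [map_add, add_assoc, left_eq_add] using w6
  have positions : (walkPositions 0 [s 0, s 1, s 2, s 3, s 4, s 5]).map (w 0 + toTorus n ·) =
      List.ofFn w := by
    simp [walkPositions, List.ofFn_succ, w5, w4, w3, w2, w1, add_assoc]
  have edges : (walkEdges 0 [s 0, s 1, s 2, s 3, s 4, s 5]).map
      (torusEdge ∘ translateEdge (w 0)) = List.ofFn fun k => s(w k, w (k + 1)) := by
    rw [show List.ofFn (fun k => s(w k, w (k + 1))) = [s(w 0, w 1), s(w 1, w 2), s(w 2, w 3),
      s(w 3, w 4), s(w 4, w 5), s(w 5, w 5 + toTorus n (stepVec (s 5)))] by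
        rw [← w6]; simp [List.ofFn_succ]]
    simp only [walkEdges, List.map_cons, List.map_nil, Function.comp_apply,
      torusEdge_translateEdge_stepEdge, map_add, map_zero, w5, w4, w3, w2, w1, add_assoc,
      zero_add, add_zero]
  obtain ⟨κ, x, -, h1, h2⟩ := closed_walk_eq_tile _ _ _ _ _ _ closed
    (List.Nodup.of_map _ (positions ▸ List.nodup_ofFn.2 w_inj))
  refine ⟨(κ, w 0 + toTorus n x), fun e => ?_⟩
  have tile : torusTile (κ, w 0 + toTorus n x) =
      ((tileShape κ).map fun o => (x + o.1, o.2)).map (translateEdge (w 0)) := by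
    simp only [torusTile, List.map_map]
    refine List.map_congr_left fun o _ => ?_
    simp [translateEdge, add_assoc]
  have : torusEdge e ∈ H.edgeSet ↔
      e ∈ (walkEdges 0 [s 0, s 1, s 2, s 3, s 4, s 5]).map (translateEdge (w 0)) := by
    rw [mem_edges, ← List.mem_map_of_injective (torusEdge_injective (by omega)), List.map_map,
      edges, List.mem_ofFn', Set.mem_range]
  rw [this, tile]
  exact ⟨fun h => List.map_subset _ h1 h, fun h => List.map_subset _ h2 h⟩

theorem not_cycleDecomposes_of_adj_iff {n : ℕ} (hn : 6 < n) (hmod : n % 4 = 2)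
    {G : SimpleGraph (ZMod 6 × ZMod n)}
    (hG : ∀ u v, G.Adj u v ↔ ∃ s, v = u + toTorus n (stepVec s)) : ¬ CycleDecomposes 6 G := by
  rintro ⟨D, hcycle, hcover⟩
  choose! φ hφ using fun H hH => exists_torusTile_of_cycle hn (fun u v => (hG u v).1) H
    (hcycle H hH).some
  refine not_exists_tiling (by omega) hmod (φ '' D) fun e => ?_
  have he : torusEdge e ∈ G.edgeSet := by
    refine (hG _ _).2 ?_
    obtain ⟨x, b⟩ := e
    cases b
    · exact ⟨0, rfl⟩
    · exact ⟨2, rfl⟩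
  obtain ⟨⟨H, hH⟩, hHe, huniq⟩ := hcover _ he
  refine ⟨φ H, ⟨Set.mem_image_of_mem φ hH, (hφ H hH e).1 hHe⟩, ?_⟩
  rintro _ ⟨⟨H', hH', rfl⟩, hH'e⟩
  have := huniq ⟨H', hH'⟩ ((hφ H' hH' e).2 hH'e)
  rw [Subtype.mk.inj this]

theorem cycleGraph_boxProd_adj_iff {m : ℕ} (u v : ZMod 6 × ZMod (m + 2)) :
    (cycleGraph 6 □ cycleGraph (m + 2)).Adj u v ↔
      ∃ s, v = u + toTorus (m + 2) (stepVec s) := by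
  have h6 (x y : ZMod 6) : (cycleGraph 6).Adj x y ↔ x - y = 1 ∨ y - x = 1 :=
    cycleGraph_adj (n := 4)
  have hm (x y : ZMod (m + 2)) : (cycleGraph (m + 2)).Adj x y ↔ x - y = 1 ∨ y - x = 1 :=
    cycleGraph_adj
  obtain ⟨x, y⟩ := u
  obtain ⟨x', y'⟩ := v
  refine boxProd_adj.trans ?_
  change (cycleGraph 6).Adj x x' ∧ y = y' ∨ (cycleGraph (m + 2)).Adj y y' ∧ x = x' ↔ _
  rw [h6, hm]
  simp only [Fin.exists_fin_succ, IsEmpty.exists_iff]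
  simp [stepVec, toTorus]
  grind

theorem no_c6_decomposition_C6_boxProd_Cn_two_mod_four (n : ℕ) (hn : 10 ≤ n)
    (hmod : n % 4 = 2) :
    ¬ CycleDecomposes 6 (cycleGraph 6 □ cycleGraph n) := by
  obtain ⟨m, rfl⟩ : ∃ m, n = m + 2 := ⟨n - 2, by omega⟩
  exact not_cycleDecomposes_of_adj_iff (by omega) hmod cycleGraph_boxProd_adj_iff
end
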